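/- Let l > 5 be a prime with l ≡ 1 (mod 4). Put τ₂ = i·√(5l)/5 ∈ ℂ and q = exp(2πi·τ₂), so that 0 < q < 1. Let χ(n) denote the Legendre symbol (n/5) ∈ {0,1,−1}. Then the infinite product ρ₂ = q·∏_{n=1}^{∞} (1 − qⁿ)^{5·χ(n)} (with integer exponents 5χ(n); the product is multipliable) is a real number, is algebraic over ℚ, and its degree over ℚ, i.e. the degree of its minimal polynomial over ℚ, is exactly 2·h(−5l). -/

import Mathlib

namespace RR
open PowerSeries Complex Filter Topology

lemma enorm_lt_one' {y : ℂ} : ‖y‖ₑ < 1 ↔ ‖y‖ < 1 := by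
  rw [← ofReal_norm, ENNReal.ofReal_lt_one]

/-- `F` is represented on the open unit disc by the power series `φ`. -/
def Ser (φ : PowerSeries ℂ) (F : ℂ → ℂ) : Prop :=
  ∀ x : ℂ, ‖x‖ < 1 → HasSum (fun k => coeff k φ * x ^ k) (F x)

lemma Ser.congr {φ : PowerSeries ℂ} {F G : ℂ → ℂ} (h : Ser φ F)
    (hFG : ∀ x : ℂ, ‖x‖ < 1 → F x = G x) : Ser φ G := by
  intro x hx; rw [← hFG x hx]; exact h x hx

lemma Ser.add {φ ψ : PowerSeries ℂ} {F G : ℂ → ℂ} (h : Ser φ F) (h' : Ser ψ G) :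
    Ser (φ + ψ) (fun x => F x + G x) := by
  intro x hx
  simpa [add_mul] using (h x hx).add (h' x hx)

lemma Ser.mul {φ ψ : PowerSeries ℂ} {F G : ℂ → ℂ} (h : Ser φ F) (h' : Ser ψ G) :
    Ser (φ * ψ) (fun x => F x * G x) := by
  intro x hx
  have h1 := (h x hx).summable.norm
  have h2 := (h' x hx).summable.norm
  have h3 := summable_norm_sum_mul_antidiagonal_of_summable_norm h1 h2
  have h4 := tsum_mul_tsum_eq_tsum_sum_antidiagonal_of_summable_norm h1 h2
  rw [(h x hx).tsum_eq, (h' x hx).tsum_eq] at h4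
  have h5 := h3.of_norm.hasSum
  rw [← h4] at h5
  refine h5.congr_fun ?_ |> fun h => h
  intro n
  rw [coeff_mul, Finset.sum_mul]
  refine Finset.sum_congr rfl fun ij hij => ?_
  rw [← Finset.HasAntidiagonal.mem_antidiagonal.mp hij, pow_add]; ring

lemma Ser.C (a : ℂ) : Ser (PowerSeries.C a) (fun _ => a) := by
  intro x hx
  have := hasSum_single (f := fun k => coeff k (PowerSeries.C a) * x ^ k) 0
    (by intro b hb; simp [coeff_C, hb])
  simpa using this

lemma Ser.one : Ser 1 (fun _ => 1) := by simpa using Ser.C 1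

lemma Ser.X_pow (n : ℕ) : Ser (PowerSeries.X ^ n) (fun x => x ^ n) := by
  intro x hx
  have := hasSum_single (f := fun k => coeff k ((PowerSeries.X : PowerSeries ℂ) ^ n) * x ^ k) n
    (by intro b hb; simp [coeff_X_pow, hb])
  simpa using this

lemma Ser.pow {φ : PowerSeries ℂ} {F : ℂ → ℂ} (h : Ser φ F) (n : ℕ) :
    Ser (φ ^ n) (fun x => F x ^ n) := by
  induction n with
  | zero => simpa using Ser.one
  | succ n ih => simpa [pow_succ] using ih.mul h

lemma Ser.sub {φ ψ : PowerSeries ℂ} {F G : ℂ → ℂ} (h : Ser φ F) (h' : Ser ψ G) :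
    Ser (φ - ψ) (fun x => F x - G x) := by
  intro x hx
  simpa [sub_mul] using (h x hx).sub (h' x hx)

lemma Ser.apply_zero {φ : PowerSeries ℂ} {F : ℂ → ℂ} (h : Ser φ F) :
    F 0 = constantCoeff φ := by
  have h1 := h 0 (by simp)
  have h2 := hasSum_single (f := fun k => coeff k φ * (0:ℂ) ^ k) 0
    (by intro b hb; simp [hb])
  simpa using h1.unique h2

lemma Ser.hasFPS {φ : PowerSeries ℂ} {F : ℂ → ℂ} (h : Ser φ F) :
    HasFPowerSeriesOnBall F (FormalMultilinearSeries.ofScalars ℂ (fun k => coeff k φ)) 0 1 where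
  r_le := by
    refine ENNReal.le_of_forall_nnreal_lt fun r hr => ?_
    apply FormalMultilinearSeries.le_radius_of_summable_norm
    have hr1 : (r : ℝ) < 1 := by exact_mod_cast hr
    have := (h (r : ℂ) (by simpa using hr1)).summable.norm
    simpa [FormalMultilinearSeries.ofScalars_norm] using this
  r_pos := by simp
  hasSum := by
    intro y hy
    have := h y (enorm_lt_one'.mp (by simpa [Metric.mem_eball, edist_eq_enorm_sub] using hy))
    simpa [FormalMultilinearSeries.ofScalars_apply_eq, mul_comm] using this

lemma Ser.differentiableOn {φ : PowerSeries ℂ} {F : ℂ → ℂ} (h : Ser φ F) :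
    DifferentiableOn ℂ F (Metric.ball 0 1) := by
  have := h.hasFPS.differentiableOn
  refine this.mono ?_
  intro y hy
  have := enorm_lt_one'.mpr (by simpa using hy : ‖y‖ < 1)
  simpa [Metric.mem_eball, edist_eq_enorm_sub] using this

lemma Ser.unique {φ ψ : PowerSeries ℂ} {F : ℂ → ℂ} (h : Ser φ F) (h' : Ser ψ F) : φ = ψ := by
  have := h.hasFPS.hasFPowerSeriesAt.eq_formalMultilinearSeries h'.hasFPS.hasFPowerSeriesAt
  ext n
  have h2 := congrArg (fun p => FormalMultilinearSeries.coeff p n) this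
  simpa [FormalMultilinearSeries.coeff_ofScalars] using h2

lemma Ser.exists_of_differentiableOn {F : ℂ → ℂ} (h : DifferentiableOn ℂ F (Metric.ball 0 1)) :
    Ser (PowerSeries.mk fun k => ((k.factorial : ℂ))⁻¹ * iteratedDeriv k F 0) F := by
  intro x hx
  have := Complex.hasSum_taylorSeries_on_ball h (z := x) (by simpa using hx)
  simpa [mul_comm, mul_assoc, mul_left_comm] using this

/-- Integer power series. -/
def IntSer (F : ℂ → ℂ) : Prop := ∃ φ : PowerSeries ℤ, Ser (φ.map (Int.castRingHom ℂ)) F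

lemma IntSer.inv {F : ℂ → ℂ} (h : IntSer F) (h0 : F 0 = 1)
    (hne : ∀ x : ℂ, ‖x‖ < 1 → F x ≠ 0) : IntSer (fun x => (F x)⁻¹) := by
  obtain ⟨φ, hφ⟩ := h
  have hc : constantCoeff φ = 1 := by
    have := hφ.apply_zero
    rw [h0] at this
    have h2 : ((constantCoeff φ : ℤ) : ℂ) = 1 := by
      rw [this, ← PowerSeries.coeff_zero_eq_constantCoeff_apply (PowerSeries.map _ φ),
        PowerSeries.coeff_map]; simp
    exact_mod_cast h2
  refine ⟨invOfUnit φ 1, ?_⟩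
  have hd : DifferentiableOn ℂ (fun x => (F x)⁻¹) (Metric.ball 0 1) :=
    hφ.differentiableOn.inv (fun x hx => hne x (by simpa using hx))
  have hs := Ser.exists_of_differentiableOn hd
  set χ := (PowerSeries.mk fun k => ((k.factorial : ℂ))⁻¹ * iteratedDeriv k (fun x => (F x)⁻¹) 0)
  have h1 : φ.map (Int.castRingHom ℂ) * χ = 1 :=
    (hφ.mul hs).unique (Ser.one.congr fun x hx => by rw [mul_inv_cancel₀ (hne x hx)])
  have h2 : φ.map (Int.castRingHom ℂ) * (invOfUnit φ 1).map (Int.castRingHom ℂ) = 1 := by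
    rw [← map_mul, mul_invOfUnit φ 1 (by simp [hc]), map_one]
  have h3 : χ = (invOfUnit φ 1).map (Int.castRingHom ℂ) := by
    calc χ = χ * (φ.map (Int.castRingHom ℂ) * (invOfUnit φ 1).map (Int.castRingHom ℂ)) := by
            rw [h2, mul_one]
      _ = (φ.map (Int.castRingHom ℂ) * χ) * (invOfUnit φ 1).map (Int.castRingHom ℂ) := by ring
      _ = _ := by rw [h1, one_mul]
  rwa [h3] at hs

lemma IntSer.mul {F G : ℂ → ℂ} (h : IntSer F) (h' : IntSer G) : IntSer (fun x => F x * G x) := by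
  obtain ⟨φ, hφ⟩ := h
  obtain ⟨ψ, hψ⟩ := h'
  exact ⟨φ * ψ, by rw [map_mul]; exact hφ.mul hψ⟩

lemma IntSer.pow {F : ℂ → ℂ} (h : IntSer F) (n : ℕ) : IntSer (fun x => F x ^ n) := by
  obtain ⟨φ, hφ⟩ := h
  exact ⟨φ ^ n, by rw [map_pow]; exact hφ.pow n⟩

lemma IntSer.one : IntSer (fun _ => 1) := ⟨1, by rw [map_one]; exact Ser.one⟩

lemma IntSer.one_sub_X_pow (n : ℕ) : IntSer (fun x => 1 - x ^ n) :=
  ⟨1 - PowerSeries.X ^ n, by simpa using Ser.one.sub (Ser.X_pow n)⟩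

lemma IntSer.prod {ι : Type*} (s : Finset ι) {F : ι → ℂ → ℂ} (h : ∀ i, IntSer (F i)) :
    IntSer (fun x => ∏ i ∈ s, F i x) := by
  classical
  induction s using Finset.induction_on with
  | empty => simpa using IntSer.one
  | insert a s ha ih => simpa [Finset.prod_insert ha] using (h a).mul ih

lemma IntSer.comp_pow {F : ℂ → ℂ} (h : IntSer F) {n : ℕ} (hn : n ≠ 0) :
    IntSer (fun x => F (x ^ n)) := by
  obtain ⟨φ, hφ⟩ := h
  refine ⟨PowerSeries.mk fun k => if n ∣ k then coeff (k / n) φ else 0, ?_⟩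
  intro x hx
  have h1 := hφ (x ^ n) (by rw [norm_pow]; exact pow_lt_one₀ (norm_nonneg _) hx hn)
  have hinj : Function.Injective (fun k : ℕ => n * k) := fun a b hab =>
    Nat.eq_of_mul_eq_mul_left (Nat.pos_of_ne_zero hn) hab
  rw [← hinj.hasSum_iff]
  · refine h1.congr_fun ?_ |> fun h => h
    intro k
    simp [Nat.mul_div_cancel_left _ (Nat.pos_of_ne_zero hn), pow_mul]
  · intro k hk
    have : ¬ n ∣ k := fun ⟨j, hj⟩ => hk ⟨j, hj.symm⟩
    simp [this]

end RR

namespace RR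
open PowerSeries Complex Filter Topology

/-- Restricted Euler product. -/
noncomputable def PS (S : Set ℕ) (x : ℂ) : ℂ := ∏' n : ℕ, (1 + S.indicator (fun n => -x ^ (n + 1)) n)

lemma PS_term_norm (S : Set ℕ) (x : ℂ) (n : ℕ) :
    ‖S.indicator (fun n => -x ^ (n + 1)) n‖ ≤ ‖x‖ ^ (n + 1) := by
  by_cases h : n ∈ S <;> simp [h]

lemma PS_summable (S : Set ℕ) {x : ℂ} (hx : ‖x‖ < 1) :
    Summable fun n => ‖S.indicator (fun n => -x ^ (n + 1)) n‖ :=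
  Summable.of_nonneg_of_le (fun _ => norm_nonneg _) (PS_term_norm S x)
    ((summable_nat_add_iff 1).mpr (summable_geometric_of_lt_one (norm_nonneg _) hx))

lemma PS_multipliable (S : Set ℕ) {x : ℂ} (hx : ‖x‖ < 1) :
    Multipliable fun n => (1 + S.indicator (fun n => -x ^ (n + 1)) n) :=
  multipliable_one_add_of_summable (PS_summable S hx)

lemma one_sub_pow_ne_zero {x : ℂ} (hx : ‖x‖ < 1) (n : ℕ) : 1 - x ^ (n + 1) ≠ 0 := by
  intro h
  have h1 : x ^ (n + 1) = 1 := (sub_eq_zero.mp h).symm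
  have h2 : ‖x‖ ^ (n + 1) < 1 := pow_lt_one₀ (norm_nonneg _) hx (by simp)
  rw [← norm_pow, h1] at h2
  simp at h2

lemma PS_term_ne_zero (S : Set ℕ) {x : ℂ} (hx : ‖x‖ < 1) (n : ℕ) :
    1 + S.indicator (fun n => -x ^ (n + 1)) n ≠ 0 := by
  by_cases h : n ∈ S
  · simpa [h, ← sub_eq_add_neg] using one_sub_pow_ne_zero hx n
  · simp [h]

lemma PS_ne_zero (S : Set ℕ) {x : ℂ} (hx : ‖x‖ < 1) : PS S x ≠ 0 :=
  tprod_one_add_ne_zero_of_summable (PS_term_ne_zero S hx) (PS_summable S hx)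

lemma PS_zero (S : Set ℕ) : PS S 0 = 1 := by
  unfold PS
  have : ∀ n : ℕ, (1 + S.indicator (fun n => -(0:ℂ) ^ (n + 1)) n) = 1 := by
    intro n; by_cases h : n ∈ S <;> simp [h]
  simp [this]

lemma PS_tendsto (S : Set ℕ) : TendstoLocallyUniformlyOn
    (fun (N : ℕ) (x : ℂ) => ∏ n ∈ Finset.range N, (1 + S.indicator (fun n => -x ^ (n + 1)) n))
    (PS S) atTop (Metric.ball 0 1) := by
  have : HasProdLocallyUniformlyOn (fun (n : ℕ) (x : ℂ) =>
      (1 + S.indicator (fun n => -x ^ (n + 1)) n)) (PS S) (Metric.ball 0 1) := by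
    apply hasProdLocallyUniformlyOn_of_forall_compact Metric.isOpen_ball
    intro K hK hcK
    by_cases hN : K.Nonempty
    · obtain ⟨z, hz, h1⟩ := hcK.exists_sSup_image_eq_and_ge hN (continuous_norm.continuousOn)
      have hz1 : ‖z‖ < 1 := by simpa using hK hz
      refine Summable.hasProdUniformlyOn_nat_one_add hcK
        (u := fun n => ‖z‖ ^ (n + 1))
        ((summable_nat_add_iff 1).mpr (summable_geometric_of_lt_one (norm_nonneg _) hz1))
        (Eventually.of_forall fun n x hx => ?_) (fun n => ?_)
      · exact (PS_term_norm S x n).trans (pow_le_pow_left₀ (norm_nonneg _) (h1.2 x hx) _)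
      · by_cases h : n ∈ S
        · simp only [h, Set.indicator_of_mem]; fun_prop
        · simp only [h, Set.indicator_of_notMem, not_false_eq_true]; fun_prop
    · rw [Set.not_nonempty_iff_eq_empty] at hN
      subst hN
      simp [hasProdUniformlyOn_iff_tendstoUniformlyOn, tendstoUniformlyOn_empty]
  exact this.tendstoLocallyUniformlyOn_finsetRange

lemma ser_coeff_eq {φ : PowerSeries ℂ} {F : ℂ → ℂ} (h : Ser φ F) (k : ℕ) :
    ((k.factorial : ℂ))⁻¹ * iteratedDeriv k F 0 = coeff k φ := by
  have := (Ser.exists_of_differentiableOn h.differentiableOn).unique h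
  rw [← this]; simp

lemma tendsto_iteratedDeriv {F : ℕ → ℂ → ℂ} {f : ℂ → ℂ} {U : Set ℂ} (hU : IsOpen U)
    (hf : TendstoLocallyUniformlyOn F f atTop U) (hF : ∀ n, DifferentiableOn ℂ (F n) U) (k : ℕ) :
    TendstoLocallyUniformlyOn (fun n => iteratedDeriv k (F n)) (iteratedDeriv k f) atTop U ∧
    ∀ n, DifferentiableOn ℂ (iteratedDeriv k (F n)) U := by
  induction k with
  | zero => simpa using ⟨hf, hF⟩
  | succ k ih =>
    simp only [iteratedDeriv_succ]
    exact ⟨ih.1.deriv (Eventually.of_forall ih.2) hU, fun n => (ih.2 n).deriv hU⟩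

lemma int_closed {u : ℕ → ℂ} {a : ℂ} (hu : ∀ n, ∃ m : ℤ, (m : ℂ) = u n)
    (h : Tendsto u atTop (𝓝 a)) : ∃ m : ℤ, (m : ℂ) = a := by
  have hre : Tendsto (fun n => (u n).re) atTop (𝓝 a.re) := (continuous_re.tendsto a).comp h
  have him : Tendsto (fun n => (u n).im) atTop (𝓝 a.im) := (continuous_im.tendsto a).comp h
  have h1 : a.im = 0 := by
    refine tendsto_nhds_unique him ?_
    have : (fun n => (u n).im) = fun _ => 0 := by
      funext n; obtain ⟨m, hm⟩ := hu n; rw [← hm]; simp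
    rw [this]; exact tendsto_const_nhds
  have h2 : a.re ∈ Set.range ((↑) : ℤ → ℝ) := by
    refine Int.isClosedEmbedding_coe_real.isClosed_range.mem_of_tendsto hre
      (Eventually.of_forall fun n => ?_)
    obtain ⟨m, hm⟩ := hu n
    exact ⟨m, by rw [← hm]; simp⟩
  obtain ⟨m, hm⟩ := h2
  exact ⟨m, Complex.ext (by simpa using hm) (by simpa using h1.symm)⟩

lemma IntSer.of_tendsto {F : ℕ → ℂ → ℂ} {f : ℂ → ℂ}
    (hf : TendstoLocallyUniformlyOn F f atTop (Metric.ball 0 1)) (hF : ∀ n, IntSer (F n)) :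
    IntSer f := by
  have hd : ∀ n, DifferentiableOn ℂ (F n) (Metric.ball 0 1) := fun n => by
    obtain ⟨φ, hφ⟩ := hF n; exact hφ.differentiableOn
  have hfd : DifferentiableOn ℂ f (Metric.ball 0 1) :=
    hf.differentiableOn (Eventually.of_forall hd) Metric.isOpen_ball
  have key : ∀ k : ℕ, ∃ m : ℤ, (m : ℂ) = ((k.factorial : ℂ))⁻¹ * iteratedDeriv k f 0 := by
    intro k
    have h1 := ((tendsto_iteratedDeriv Metric.isOpen_ball hf hd k).1.tendsto_at
      (a := 0) (by simp)).const_mul ((k.factorial : ℂ))⁻¹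
    refine int_closed (fun n => ?_) h1
    obtain ⟨φ, hφ⟩ := hF n
    exact ⟨coeff k φ, by rw [ser_coeff_eq hφ]; simp⟩
  choose m hm using key
  refine ⟨PowerSeries.mk m, ?_⟩
  have h1 := Ser.exists_of_differentiableOn hfd
  have h2 : (PowerSeries.mk fun k => ((k.factorial : ℂ))⁻¹ * iteratedDeriv k f 0) =
      (PowerSeries.mk m).map (Int.castRingHom ℂ) := by
    ext k; simp [hm]
  rwa [h2] at h1

lemma IntSer.congr {F G : ℂ → ℂ} (h : IntSer F) (hFG : ∀ x : ℂ, ‖x‖ < 1 → F x = G x) :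
    IntSer G := by
  obtain ⟨φ, hφ⟩ := h
  exact ⟨φ, hφ.congr hFG⟩

lemma PS_intSer (S : Set ℕ) : IntSer (PS S) := by
  refine IntSer.of_tendsto (PS_tendsto S) fun N => IntSer.prod _ fun n => ?_
  by_cases h : n ∈ S
  · refine (IntSer.one_sub_X_pow (n + 1)).congr fun x _ => ?_
    simp [h, sub_eq_add_neg]
  · refine IntSer.one.congr fun x _ => ?_
    simp [h]

/-- Indices of quadratic residues mod 5. -/
def QR : Set ℕ := {n | jacobiSym (n + 1) 5 = 1}
/-- Indices of quadratic nonresidues mod 5. -/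
def NR : Set ℕ := {n | jacobiSym (n + 1) 5 = -1}

lemma RR_term {x : ℂ} (n : ℕ) :
    (1 - x ^ (n + 1)) ^ (5 * jacobiSym (n + 1) 5) =
    (1 + QR.indicator (fun n => -x ^ (n + 1)) n) ^ 5 *
      ((1 + NR.indicator (fun n => -x ^ (n + 1)) n) ^ 5)⁻¹ := by
  rcases jacobiSym.trichotomy (n + 1) 5 with h | h | h
  · have h1 : n ∉ QR := by simp [QR, h]
    have h2 : n ∉ NR := by simp [NR, h]
    simp [h, h1, h2]
  · have h1 : n ∈ QR := by simp [QR, h]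
    have h2 : n ∉ NR := by simp [NR, h]
    simp only [h, h1, h2, Set.indicator_of_mem, Set.indicator_of_notMem, not_false_eq_true]
    rw [← sub_eq_add_neg]
    norm_cast
    simp
  · have h1 : n ∉ QR := by simp [QR, h]
    have h2 : n ∈ NR := by simp [NR, h]
    simp only [h, h1, h2, Set.indicator_of_mem, Set.indicator_of_notMem, not_false_eq_true]
    rw [← sub_eq_add_neg]
    rw [show (5 * -1 : ℤ) = -((5 : ℕ) : ℤ) by norm_num, zpow_neg, zpow_natCast]
    simp

/-- The Rogers-Ramanujan product (fifth power, without the leading `q`). -/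
noncomputable def U (x : ℂ) : ℂ := ∏' n : ℕ, (1 - x ^ (n + 1)) ^ (5 * jacobiSym (n + 1) 5)

lemma U_multipliable {x : ℂ} (hx : ‖x‖ < 1) :
    Multipliable fun n : ℕ => (1 - x ^ (n + 1)) ^ (5 * jacobiSym (n + 1) 5) := by
  simp_rw [RR_term]
  exact ((PS_multipliable QR hx).pow 5).mul
    ((((PS_multipliable NR hx).hasProd.pow 5).inv₀ (pow_ne_zero _ (PS_ne_zero NR hx))).multipliable)

lemma U_eq {x : ℂ} (hx : ‖x‖ < 1) : U x = PS QR x ^ 5 * (PS NR x ^ 5)⁻¹ := by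
  unfold U
  simp_rw [RR_term]
  exact (((PS_multipliable QR hx).hasProd.pow 5).mul
    (((PS_multipliable NR hx).hasProd.pow 5).inv₀ (pow_ne_zero _ (PS_ne_zero NR hx)))).tprod_eq

lemma U_ne_zero {x : ℂ} (hx : ‖x‖ < 1) : U x ≠ 0 := by
  rw [U_eq hx]
  exact mul_ne_zero (pow_ne_zero _ (PS_ne_zero QR hx))
    (inv_ne_zero (pow_ne_zero _ (PS_ne_zero NR hx)))

lemma U_zero : U 0 = 1 := by rw [U_eq (by simp), PS_zero, PS_zero]; simp

lemma U_intSer : IntSer U := by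
  refine (((PS_intSer QR).pow 5).mul (((PS_intSer NR).pow 5).inv (by simp [PS_zero])
    (fun x hx => pow_ne_zero _ (PS_ne_zero NR hx)))).congr fun x hx => (U_eq hx).symm

lemma Uinv_intSer : IntSer (fun x => (U x)⁻¹) :=
  U_intSer.inv U_zero (fun _ hx => U_ne_zero hx)

/-- The quotient `∏ (1-x^(5 n))^120/(1-x^n)^24`. -/
noncomputable def V (x : ℂ) : ℂ := (PS Set.univ (x ^ 5)) ^ 120 * ((PS Set.univ x) ^ 24)⁻¹

lemma pow5_lt {x : ℂ} (hx : ‖x‖ < 1) : ‖x ^ 5‖ < 1 := by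
  rw [norm_pow]; exact pow_lt_one₀ (norm_nonneg _) hx (by simp)

lemma V_ne_zero {x : ℂ} (hx : ‖x‖ < 1) : V x ≠ 0 :=
  mul_ne_zero (pow_ne_zero _ (PS_ne_zero _ (pow5_lt hx)))
    (inv_ne_zero (pow_ne_zero _ (PS_ne_zero _ hx)))

lemma V_zero : V 0 = 1 := by simp [V, PS_zero]

lemma V_intSer : IntSer V :=
  (((PS_intSer Set.univ).comp_pow (n := 5) (by simp)).pow 120).mul
    (((PS_intSer Set.univ).pow 24).inv (by simp [PS_zero])
    (fun x hx => pow_ne_zero _ (PS_ne_zero _ hx)))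

lemma Vinv_intSer : IntSer (fun x => (V x)⁻¹) :=
  V_intSer.inv V_zero (fun _ hx => V_ne_zero hx)

end RR

namespace RR
open Complex Filter Topology

/-- finite Euler product -/
noncomputable def QP (X : ℂ) (n : ℕ) : ℂ := ∏ k ∈ Finset.range n, (1 - X ^ (k + 1))

lemma QP_succ (X : ℂ) (n : ℕ) : QP X (n + 1) = QP X n * (1 - X ^ (n + 1)) :=
  Finset.prod_range_succ _ _

lemma QP_ne_zero {X : ℂ} (hX : ‖X‖ < 1) (n : ℕ) : QP X n ≠ 0 :=
  Finset.prod_ne_zero_iff.mpr fun k _ => one_sub_pow_ne_zero hX k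

/-- Gaussian binomial -/
noncomputable def gb (X : ℂ) (M m : ℕ) : ℂ :=
  if m ≤ M then QP X M / (QP X m * QP X (M - m)) else 0

lemma gb_succ {X : ℂ} (hX : ‖X‖ < 1) {M m : ℕ} (hm : m ≤ M) :
    gb X (M + 1) (m + 1) = gb X M (m + 1) + X ^ (M - m) * gb X M m := by
  obtain ⟨j, rfl⟩ := Nat.exists_eq_add_of_le hm
  unfold gb
  rcases j with _ | j
  · simp only [add_zero, le_refl, if_true]
    have h1 := QP_ne_zero hX m
    have h2 := QP_ne_zero hX (m + 1)
    have h0 : QP X 0 = 1 := by simp [QP]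
    simp [h0, h1, h2]
  · rw [if_pos (by omega), if_pos (by omega), if_pos (by omega)]
    rw [show m + (j + 1) + 1 - (m + 1) = j + 1 by omega, show m + (j + 1) - (m + 1) = j by omega,
      show m + (j + 1) - m = j + 1 by omega, QP_succ X (m + (j + 1)), QP_succ X m, QP_succ X j]
    have h1 := QP_ne_zero hX m
    have h2 := QP_ne_zero hX j
    have h3 := one_sub_pow_ne_zero hX m
    have h4 := one_sub_pow_ne_zero hX j
    field_simp
    ring

lemma qbinom {X : ℂ} (hX : ‖X‖ < 1) (y : ℂ) (M : ℕ) :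
    ∏ k ∈ Finset.range M, (1 + y * X ^ k) =
    ∑ m ∈ Finset.range (M + 1), gb X M m * X ^ (m.choose 2) * y ^ m := by
  have gb0 : ∀ M, gb X M 0 = 1 := by
    intro M
    have h1 := QP_ne_zero hX M
    have h0 : QP X 0 = 1 := by simp [QP]
    simp [gb, h0, h1]
  induction M with
  | zero => simp [gb0]
  | succ M ih =>
    rw [Finset.prod_range_succ, ih, Finset.sum_range_succ' _ (M + 1), mul_add, mul_one, gb0]
    have e1 : ∑ m ∈ Finset.range (M + 1), gb X M m * X ^ (m.choose 2) * y ^ m =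
        ∑ m ∈ Finset.range (M + 1), gb X M (m + 1) * X ^ ((m + 1).choose 2) * y ^ (m + 1) + 1 := by
      have : gb X M (M + 1) = 0 := by simp [gb]
      have h := Finset.sum_range_succ' (fun m => gb X M m * X ^ (m.choose 2) * y ^ m) (M + 1)
      rw [Finset.sum_range_succ, this] at h
      simpa [gb0] using h
    nth_rewrite 1 [e1]
    rw [Finset.sum_mul, add_right_comm, ← Finset.sum_add_distrib]
    simp only [Nat.choose_zero_succ, pow_zero, mul_one, Nat.choose_zero_succ]
    congr 1
    refine Finset.sum_congr rfl fun m hm => ?_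
    have hm' : m ≤ M := by simpa [Nat.lt_succ_iff] using hm
    rw [gb_succ hX hm']
    have : X ^ M = X ^ (M - m) * X ^ m := by rw [← pow_add]; congr 1; omega
    rw [this, show (m + 1).choose 2 = m + m.choose 2 by
      rw [Nat.choose_succ_succ' m 1, Nat.choose_one_right], pow_add, pow_succ]
    ring

lemma finite_triple {x w : ℂ} (hx : ‖x‖ < 1) (hx0 : x ≠ 0) (hw : w ≠ 0) (N : ℕ) :
    (∏ n ∈ Finset.range N, (1 + x ^ (2 * n + 1) * w)) *
      (∏ n ∈ Finset.range N, (1 + x ^ (2 * n + 1) * w⁻¹)) =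
    ∑ m ∈ Finset.range (2 * N + 1), gb (x ^ 2) (2 * N) m *
      (x ^ (((m : ℤ) - N) ^ 2) * w ^ ((m : ℤ) - N)) := by
  have hX : ‖x ^ 2‖ < 1 := by rw [norm_pow]; exact pow_lt_one₀ (norm_nonneg _) hx (by simp)
  have h := qbinom hX (w * x ^ (1 - 2 * (N : ℤ))) (2 * N)
  rw [two_mul N, Finset.prod_range_add, ← two_mul] at h
  have e1 : ∀ n : ℕ, 1 + w * x ^ (1 - 2 * (N : ℤ)) * (x ^ 2) ^ (N + n) = 1 + x ^ (2 * n + 1) * w := by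
    intro n
    have : x ^ (1 - 2 * (N : ℤ)) * (x ^ 2) ^ (N + n) = x ^ (2 * n + 1) := by
      rw [← zpow_natCast, ← zpow_natCast x 2, ← zpow_mul, ← zpow_natCast, ← zpow_add₀ hx0]
      congr 1; push_cast; ring
    rw [mul_assoc, this, mul_comm]
  have e2 : ∏ k ∈ Finset.range N, (1 + w * x ^ (1 - 2 * (N : ℤ)) * (x ^ 2) ^ k) =
      w ^ N * x ^ (-((N : ℤ) ^ 2)) * ∏ n ∈ Finset.range N, (1 + x ^ (2 * n + 1) * w⁻¹) := by
    rw [← Finset.prod_range_reflect]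
    have e3 : ∀ j ∈ Finset.range N, 1 + w * x ^ (1 - 2 * (N : ℤ)) * (x ^ 2) ^ (N - 1 - j) =
        (w * x ^ (-(2 * (j : ℤ) + 1))) * (1 + x ^ (2 * j + 1) * w⁻¹) := by
      intro j hj
      have hj' : j < N := by simpa using hj
      have : x ^ (1 - 2 * (N : ℤ)) * (x ^ 2) ^ (N - 1 - j) = x ^ (-(2 * (j : ℤ) + 1)) := by
        rw [← zpow_natCast, ← zpow_natCast x 2, ← zpow_mul, ← zpow_add₀ hx0]
        congr 1; rw [Nat.cast_sub (by omega), Nat.cast_sub (by omega)]; push_cast; ring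
      rw [mul_assoc, this, mul_add, mul_one, add_comm]
      congr 1
      have h2 : x ^ (-(2 * (j : ℤ) + 1)) * x ^ (2 * j + 1) = 1 := by
        rw [← zpow_natCast, ← zpow_add₀ hx0]; simp
      calc (1:ℂ) = (w * w⁻¹) * (x ^ (-(2 * (j : ℤ) + 1)) * x ^ (2 * j + 1)) := by
            rw [h2, mul_inv_cancel₀ hw, one_mul]
        _ = _ := by ring
    rw [Finset.prod_congr rfl e3, Finset.prod_mul_distrib, Finset.prod_mul_distrib]
    congr 1
    simp only [Finset.prod_const, Finset.card_range]
    congr 1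
    clear e1 h e3
    induction N with
    | zero => simp
    | succ N ih => rw [Finset.prod_range_succ, ih, ← zpow_add₀ hx0]; congr 1; push_cast; ring
  rw [e2, Finset.prod_congr rfl (fun n _ => e1 n)] at h
  have h3 : w ^ (-(N : ℤ)) * x ^ ((N : ℤ) ^ 2) * (w ^ N * x ^ (-((N : ℤ) ^ 2))) = 1 := by
    rw [← zpow_natCast w N]
    calc _ = (w ^ (-(N:ℤ)) * w ^ (N:ℤ)) * (x ^ ((N : ℤ) ^ 2) * x ^ (-((N : ℤ) ^ 2))) := by ring
      _ = _ := by rw [← zpow_add₀ hw, ← zpow_add₀ hx0]; simp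
  have h4 := congrArg (fun t => w ^ (-(N : ℤ)) * x ^ ((N : ℤ) ^ 2) * t) h
  rw [← mul_assoc, ← mul_assoc, h3, one_mul, mul_comm] at h4
  rw [h4, Finset.mul_sum]
  refine Finset.sum_congr rfl fun m _ => ?_
  have h5 : x ^ (((m : ℤ) - N) ^ 2) = x ^ ((N : ℤ) ^ 2) * (x ^ 2) ^ (m.choose 2) *
      (x ^ (1 - 2 * (N : ℤ))) ^ m := by
    have hc : ((m.choose 2 : ℕ) : ℤ) * 2 = m * (m - 1) := by
      have := Nat.choose_two_right m
      rcases m with _ | m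
      · simp
      · have h6 : (m + 1) * m = (m + 1).choose 2 * 2 := by
          rw [this]; simp
          rw [Nat.div_mul_cancel]
          have := Nat.even_mul_succ_self m
          rw [mul_comm]; exact this.two_dvd
        push_cast; rw [add_sub_cancel_right]; exact_mod_cast h6.symm
    rw [← zpow_natCast, ← zpow_natCast x 2, ← zpow_mul, ← zpow_natCast, ← zpow_mul,
      ← zpow_add₀ hx0, ← zpow_add₀ hx0]
    congr 1
    push_cast
    rw [mul_comm (2:ℤ), hc]; ring
  rw [h5, mul_pow, sub_eq_neg_add (m : ℤ), zpow_add₀ hw, zpow_natCast]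
  ring

lemma QP_tendsto {X : ℂ} (hX : ‖X‖ < 1) : Tendsto (QP X) atTop (𝓝 (PS Set.univ X)) := by
  have := (PS_multipliable Set.univ hX).hasProd.tendsto_prod_nat
  refine this.congr fun n => ?_
  simp [QP, sub_eq_add_neg]

lemma gb_bound {X : ℂ} (hX : ‖X‖ < 1) : ∃ C : ℝ, ∀ M m, ‖gb X M m‖ ≤ C := by
  have hL := PS_ne_zero Set.univ hX
  obtain ⟨B, hB⟩ := (Metric.isBounded_range_of_tendsto _ (QP_tendsto hX)).exists_norm_le
  obtain ⟨B', hB'⟩ := (Metric.isBounded_range_of_tendsto _ ((QP_tendsto hX).inv₀ hL)).exists_norm_le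
  have hB0 : 0 ≤ B := (norm_nonneg _).trans (hB _ ⟨0, rfl⟩)
  have hB0' : 0 ≤ B' := (norm_nonneg _).trans (hB' _ ⟨0, rfl⟩)
  refine ⟨B * (B' * B'), fun M m => ?_⟩
  unfold gb
  split_ifs
  · rw [div_eq_mul_inv, mul_inv, norm_mul, norm_mul]
    have h1 := hB _ ⟨M, rfl⟩
    have h2 := hB' _ ⟨m, rfl⟩
    have h3 := hB' _ ⟨M - m, rfl⟩
    gcongr
  · simp; positivity

theorem triple_product (z : ℂ) {τ : ℂ} (hτ : 0 < τ.im) :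
    jacobiTheta₂ z τ = PS Set.univ (cexp (Real.pi * I * τ) ^ 2) *
      ((∏' n : ℕ, (1 + cexp (Real.pi * I * τ) ^ (2 * n + 1) * cexp (2 * Real.pi * I * z))) *
      ∏' n : ℕ, (1 + cexp (Real.pi * I * τ) ^ (2 * n + 1) * (cexp (2 * Real.pi * I * z))⁻¹)) := by
  set x := cexp (Real.pi * I * τ) with hxdef
  set w := cexp (2 * Real.pi * I * z) with hwdef
  have hx : ‖x‖ < 1 := by
    rw [hxdef, Complex.norm_exp]
    simp
    positivity
  have hx0 : x ≠ 0 := exp_ne_zero _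
  have hw : w ≠ 0 := exp_ne_zero _
  have hX : ‖x ^ 2‖ < 1 := by rw [norm_pow]; exact pow_lt_one₀ (norm_nonneg _) hx (by simp)
  have hL := PS_ne_zero Set.univ hX
  have hterm : ∀ j : ℤ, x ^ (j ^ 2) * w ^ j = jacobiTheta₂_term j z τ := by
    intro j
    rw [jacobiTheta₂_term, hxdef, hwdef, ← exp_int_mul, ← exp_int_mul, ← exp_add]
    congr 1; push_cast; ring
  have hmul : ∀ v : ℂ, Multipliable fun n : ℕ => (1 + x ^ (2 * n + 1) * v) := by
    intro v
    apply multipliable_one_add_of_summable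
    have : Summable fun n : ℕ => (‖x‖ * ‖v‖) * (‖x‖ ^ 2) ^ n :=
      (summable_geometric_of_lt_one (by positivity)
        (pow_lt_one₀ (norm_nonneg _) hx (by simp))).mul_left _
    refine this.congr fun n => ?_
    rw [norm_mul, norm_pow, pow_succ ‖x‖ (2 * n), pow_mul]; ring
  have hlim := ((hmul w).hasProd.tendsto_prod_nat).mul ((hmul w⁻¹).hasProd.tendsto_prod_nat)
  obtain ⟨C, hC⟩ := gb_bound hX
  let b : ℕ → ℤ → ℂ := fun N j => if -(N : ℤ) ≤ j then gb (x ^ 2) (2 * N) (N + j).toNat else 0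
  have hbC : ∀ N j, ‖b N j‖ ≤ C := by
    intro N j
    simp only [b]
    split_ifs
    · exact hC _ _
    · simpa using (norm_nonneg _).trans (hC 0 0)
  have hsum : ∀ N : ℕ, (∏ n ∈ Finset.range N, (1 + x ^ (2 * n + 1) * w)) *
      (∏ n ∈ Finset.range N, (1 + x ^ (2 * n + 1) * w⁻¹)) =
      ∑' j : ℤ, b N j * jacobiTheta₂_term j z τ := by
    intro N
    rw [finite_triple hx hx0 hw, tsum_eq_sum (s := Finset.Icc (-(N:ℤ)) N)]
    · refine Finset.sum_nbij' (fun m : ℕ => (m : ℤ) - N) (fun j : ℤ => (N + j).toNat) ?_ ?_ ?_ ?_ ?_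
      · intro m hm; simp at hm ⊢; omega
      · intro m hm; simp at hm ⊢; omega
      · intro m hm; simp
      · intro m hm; simp at hm ⊢; omega
      · intro m hm
        have h1 : -(N : ℤ) ≤ (m : ℤ) - N := by omega
        simp only [b, if_pos h1, ← hterm]
        congr 2
        simp
    · intro j hj
      have : b N j = 0 := by
        simp only [b]
        split_ifs with h
        · unfold gb
          rw [if_neg]
          simp at hj; have := hj h; omega
        · rfl
      rw [this, zero_mul]
  have hb : ∀ j : ℤ, Tendsto (fun N => b N j * jacobiTheta₂_term j z τ) atTop
      (𝓝 ((PS Set.univ (x ^ 2))⁻¹ * jacobiTheta₂_term j z τ)) := by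
    intro j
    refine Tendsto.mul_const _ ?_
    have hq := QP_tendsto hX
    have h1 : Tendsto (fun N : ℕ => 2 * N) atTop atTop :=
      tendsto_atTop_mono (fun n => by simp only [id]; omega) tendsto_id
    have h2 : Tendsto (fun N : ℕ => ((N : ℤ) + j).toNat) atTop atTop := by
      refine tendsto_atTop.mpr fun B => ?_
      filter_upwards [eventually_ge_atTop (B + j.natAbs)] with N hN
      omega
    have h3 : Tendsto (fun N : ℕ => 2 * N - ((N : ℤ) + j).toNat) atTop atTop := by
      refine tendsto_atTop.mpr fun B => ?_
      filter_upwards [eventually_ge_atTop (B + j.natAbs)] with N hN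
      omega
    have h4 := (hq.comp h1).div ((hq.comp h2).mul (hq.comp h3)) (mul_ne_zero hL hL)
    have h5 : PS Set.univ (x ^ 2) / (PS Set.univ (x ^ 2) * PS Set.univ (x ^ 2)) =
        (PS Set.univ (x ^ 2))⁻¹ := by field_simp
    rw [h5] at h4
    refine h4.congr' ?_
    filter_upwards [eventually_ge_atTop j.natAbs] with N hN
    simp only [b, gb, Function.comp]
    rw [if_pos (by omega), if_pos (by omega)]
    rfl
  have hT := tendsto_tsum_of_dominated_convergence
    (bound := fun j : ℤ => C * ‖jacobiTheta₂_term j z τ‖)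
    ((((summable_jacobiTheta₂_term_iff z τ).mpr hτ).norm).mul_left C) hb
    (Eventually.of_forall fun N j => by
      rw [norm_mul]; exact mul_le_mul_of_nonneg_right (hbC N j) (norm_nonneg _))
  have heq := tendsto_nhds_unique (hlim.congr hsum) hT
  rw [tsum_mul_left] at heq
  rw [heq]
  change _ = _ * (_ * jacobiTheta₂ z τ)
  rw [mul_inv_cancel_left₀ hL]

end RR

namespace RR
open Complex Filter Topology

local notation "π" => (Real.pi : ℂ)

/-- Klein-type form. -/
noncomputable def KF (a b τ : ℂ) : ℂ :=
  cexp (π * I * (a * (a * τ + b) + τ / 4 + (a * τ + b + 1 / 2))) *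
    jacobiTheta₂ (a * τ + b + 1 / 2 + τ / 2) τ

lemma theta_add_one (z τ : ℂ) : jacobiTheta₂ z (τ + 1) = jacobiTheta₂ (z + 1 / 2) τ := by
  unfold jacobiTheta₂
  refine tsum_congr fun n => ?_
  unfold jacobiTheta₂_term
  have h : (2 : ℤ) ∣ n * (n - 1) := by
    have := Int.even_mul_pred_self n
    exact this.two_dvd
  obtain ⟨k, hk⟩ := h
  have hk' : (n : ℂ) ^ 2 = n + 2 * k := by
    have : (n : ℂ) * (n - 1) = 2 * k := by exact_mod_cast hk
    linear_combination this
  rw [Complex.exp_eq_exp_iff_exists_int]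
  refine ⟨k, ?_⟩
  linear_combination (π * I) * hk'

lemma exp_half : cexp (π * I * (1 / 2)) = I := by
  rw [show π * I * (1 / 2) = π / 2 * I by ring, exp_pi_div_two_mul_I]

lemma neg_exp (y : ℂ) : -cexp y = cexp (y + π * I) := by
  rw [exp_add, exp_pi_mul_I]; ring

lemma KF_T (a b τ : ℂ) : KF a b (τ + 1) = cexp (π * I * (1 / 4)) * KF a (a + b) τ := by
  unfold KF
  rw [theta_add_one, show a * (τ + 1) + b + 1 / 2 + (τ + 1) / 2 + 1 / 2 =
    a * τ + (a + b) + 1 / 2 + τ / 2 + 1 by ring, jacobiTheta₂_add_left, ← mul_assoc, ← exp_add]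
  congr 2; ring

lemma KF_S (a b : ℂ) {τ : ℂ} (hτ : τ ≠ 0) : KF a b (-1 / τ) =
    (cexp (π * I * (-1 / 2)) * (-I * τ) ^ (1 / 2 : ℂ)) * KF b (-a) τ := by
  unfold KF
  have h := jacobiTheta₂_functional_equation ((b + 1 / 2) * τ - (a + 1 / 2)) τ
  have hne : (-I * τ) ^ (1 / 2 : ℂ) ≠ 0 := by
    rw [Ne, cpow_eq_zero_iff]; simp [hτ]
  have e1 : ((b + 1 / 2) * τ - (a + 1 / 2)) / τ = a * (-1 / τ) + b + 1 / 2 + (-1 / τ) / 2 := by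
    field_simp; ring
  have e2 : b * τ + -a + 1 / 2 + τ / 2 = (b + 1 / 2) * τ - (a + 1 / 2) + 1 := by ring
  rw [e1] at h
  rw [e2, jacobiTheta₂_add_left, h]
  set Θ := jacobiTheta₂ (a * (-1 / τ) + b + 1 / 2 + -1 / τ / 2) (-1 / τ)
  set R := (-I * τ) ^ (1 / 2 : ℂ)
  have e3 : cexp (π * I * (-1 / 2)) * R * (cexp (π * I * (b * (b * τ + -a) + τ / 4 +
      (b * τ + -a + 1 / 2))) *
      (1 / R * cexp (-π * I * ((b + 1 / 2) * τ - (a + 1 / 2)) ^ 2 / τ) * Θ)) =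
      (R * (1 / R)) * (cexp (π * I * (-1 / 2)) * cexp (π * I * (b * (b * τ + -a) + τ / 4 +
      (b * τ + -a + 1 / 2))) *
      cexp (-π * I * ((b + 1 / 2) * τ - (a + 1 / 2)) ^ 2 / τ)) * Θ := by ring
  rw [e3, mul_one_div_cancel hne, one_mul, ← exp_add, ← exp_add]
  congr 2
  field_simp
  ring

lemma KF_add_right (a b τ : ℂ) : KF a (b + 1) τ = -cexp (π * I * a) * KF a b τ := by
  unfold KF
  rw [show a * τ + (b + 1) + 1 / 2 + τ / 2 = a * τ + b + 1 / 2 + τ / 2 + 1 by ring,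
    jacobiTheta₂_add_left, neg_mul, ← mul_assoc, ← exp_add, ← neg_mul]
  congr 1
  rw [show π * I * (a * (a * τ + (b + 1)) + τ / 4 + (a * τ + (b + 1) + 1 / 2)) =
    π * I * a + π * I * (a * (a * τ + b) + τ / 4 + (a * τ + b + 1 / 2)) + π * I by ring,
    exp_add _ (π * I), exp_pi_mul_I]
  ring

lemma KF_add_left (a b τ : ℂ) : KF (a + 1) b τ = -cexp (-(π * I * b)) * KF a b τ := by
  unfold KF
  rw [show (a + 1) * τ + b + 1 / 2 + τ / 2 = a * τ + b + 1 / 2 + τ / 2 + τ by ring,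
    jacobiTheta₂_add_left', neg_exp, ← mul_assoc, ← mul_assoc, ← exp_add, ← exp_add]
  congr 1
  rw [Complex.exp_eq_exp_iff_exists_int]
  refine ⟨-1, ?_⟩
  push_cast
  ring

lemma KF_neg (a b τ : ℂ) : KF (-a) (-b) τ = -KF a b τ := by
  unfold KF
  have h1 : jacobiTheta₂ (-a * τ + -b + 1 / 2 + τ / 2) τ =
      jacobiTheta₂ (a * τ + b - 1 / 2 - τ / 2) τ := by
    rw [← jacobiTheta₂_neg_left]; congr 1; ring
  have h2 := jacobiTheta₂_add_left' (a * τ + b - 1 / 2 - τ / 2 + 1) τ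
  rw [jacobiTheta₂_add_left, show a * τ + b - 1 / 2 - τ / 2 + 1 + τ =
    a * τ + b + 1 / 2 + τ / 2 by ring] at h2
  rw [h1, h2, ← mul_assoc, ← exp_add, ← neg_mul]
  congr 1
  rw [neg_exp, Complex.exp_eq_exp_iff_exists_int]
  refine ⟨0, ?_⟩
  push_cast
  ring

/-- Fifth powers of Klein forms at 5-division points. -/
noncomputable def kk (r s : ℤ) (τ : ℂ) : ℂ := KF (r / 5) (s / 5) τ ^ 5

lemma exp_pi_int (n : ℤ) : cexp (π * I * n) = (-1) ^ n := by
  rw [← exp_pi_mul_I, ← exp_int_mul]; congr 1; ring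

lemma kk_add_left (r s : ℤ) (τ : ℂ) : kk (r + 5) s τ = -(-1) ^ s * kk r s τ := by
  unfold kk
  rw [show (((r + 5 : ℤ) : ℂ) / 5) = (r : ℂ) / 5 + 1 by push_cast; ring, KF_add_left, mul_pow]
  congr 1
  rw [Odd.neg_pow (by decide), ← exp_nat_mul]
  rw [show ((5 : ℕ) : ℂ) * -(π * I * (s / 5)) = π * I * ((-s : ℤ) : ℂ) by push_cast; ring,
    exp_pi_int, zpow_neg, ← inv_zpow]
  norm_num

lemma kk_add_right (r s : ℤ) (τ : ℂ) : kk r (s + 5) τ = -(-1) ^ r * kk r s τ := by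
  unfold kk
  rw [show (((s + 5 : ℤ) : ℂ) / 5) = (s : ℂ) / 5 + 1 by push_cast; ring, KF_add_right, mul_pow]
  congr 1
  rw [Odd.neg_pow (by decide), ← exp_nat_mul]
  rw [show ((5 : ℕ) : ℂ) * (π * I * (r / 5)) = π * I * ((r : ℤ) : ℂ) by push_cast; ring,
    exp_pi_int]

lemma kk_neg (r s : ℤ) (τ : ℂ) : kk (-r) (-s) τ = - kk r s τ := by
  unfold kk
  rw [show (((-r : ℤ) : ℂ) / 5) = -((r : ℂ) / 5) by push_cast; ring,
    show (((-s : ℤ) : ℂ) / 5) = -((s : ℂ) / 5) by push_cast; ring, KF_neg, Odd.neg_pow (by decide)]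

/-- Modular units indexed by vectors. -/
noncomputable def GG (r s : ℤ) (τ : ℂ) : ℂ :=
  (-1) ^ (r * s + r + s + 1) * (kk r s τ / kk (2 * r) (2 * s) τ)

lemma negone_ne : (-1 : ℂ) ≠ 0 := by norm_num

lemma neg_one_zpow_congr {a b : ℤ} (h : Even (a - b)) : (-1 : ℂ) ^ a = (-1) ^ b := by
  rw [show a = b + (a - b) by ring, zpow_add₀ negone_ne, h.neg_one_zpow, mul_one]

lemma GG_add_left (r s : ℤ) (τ : ℂ) : GG (r + 5) s τ = GG r s τ := by
  unfold GG
  rw [kk_add_left, show 2 * (r + 5) = 2 * r + 5 + 5 by ring, kk_add_left, kk_add_left]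
  have h1 : (-1 : ℂ) ^ (2 * s) = 1 := (even_two_mul s).neg_one_zpow
  have h2 : (-1 : ℂ) ^ ((r + 5) * s + (r + 5) + s + 1) = (-1) ^ (r * s + r + s + 1) * -(-1) ^ s := by
    rw [show -(-1 : ℂ) ^ s = (-1) ^ (s + 1) by rw [zpow_add₀ negone_ne]; simp,
      ← zpow_add₀ negone_ne]
    exact neg_one_zpow_congr ⟨2 * s + 2, by ring⟩
  have h3 : (-1 : ℂ) ^ s * (-1) ^ s = 1 := by rw [← zpow_add₀ negone_ne, ← two_mul, h1]
  rw [h1, h2]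
  rw [show -1 * (-1 * kk (2 * r) (2 * s) τ) = kk (2 * r) (2 * s) τ by ring]
  linear_combination ((-1) ^ (r * s + r + s + 1) * (kk r s τ / kk (2 * r) (2 * s) τ)) * h3

lemma GG_add_right (r s : ℤ) (τ : ℂ) : GG r (s + 5) τ = GG r s τ := by
  unfold GG
  rw [kk_add_right, show 2 * (s + 5) = 2 * s + 5 + 5 by ring, kk_add_right, kk_add_right]
  have h1 : (-1 : ℂ) ^ (2 * r) = 1 := (even_two_mul r).neg_one_zpow
  have h2 : (-1 : ℂ) ^ (r * (s + 5) + r + (s + 5) + 1) = (-1) ^ (r * s + r + s + 1) * -(-1) ^ r := by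
    rw [show -(-1 : ℂ) ^ r = (-1) ^ (r + 1) by rw [zpow_add₀ negone_ne]; simp,
      ← zpow_add₀ negone_ne]
    exact neg_one_zpow_congr ⟨2 * r + 2, by ring⟩
  have h3 : (-1 : ℂ) ^ r * (-1) ^ r = 1 := by rw [← zpow_add₀ negone_ne, ← two_mul, h1]
  rw [h1, h2]
  rw [show -1 * (-1 * kk (2 * r) (2 * s) τ) = kk (2 * r) (2 * s) τ by ring]
  linear_combination ((-1) ^ (r * s + r + s + 1) * (kk r s τ / kk (2 * r) (2 * s) τ)) * h3

lemma GG_add_left_mul (r s k : ℤ) (τ : ℂ) : GG (r + 5 * k) s τ = GG r s τ := by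
  induction k using Int.induction_on with
  | zero => simp
  | succ n ih => rw [show r + 5 * ((n : ℤ) + 1) = (r + 5 * n) + 5 by ring, GG_add_left, ih]
  | pred n ih => rw [← ih, ← GG_add_left]; congr 1; ring

lemma GG_add_right_mul (r s k : ℤ) (τ : ℂ) : GG r (s + 5 * k) τ = GG r s τ := by
  induction k using Int.induction_on with
  | zero => simp
  | succ n ih => rw [show s + 5 * ((n : ℤ) + 1) = (s + 5 * n) + 5 by ring, GG_add_right, ih]
  | pred n ih => rw [← ih, ← GG_add_right]; congr 1; ring

lemma GG_neg (r s : ℤ) (τ : ℂ) : GG (-r) (-s) τ = GG r s τ := by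
  unfold GG
  rw [kk_neg, show 2 * -r = -(2 * r) by ring, show 2 * -s = -(2 * s) by ring, kk_neg, neg_div_neg_eq,
    neg_one_zpow_congr (b := r * s + r + s + 1) ⟨-r - s, by ring⟩]

lemma GG_two (τ : ℂ) : GG 2 0 τ = -(GG 1 0 τ)⁻¹ := by
  unfold GG
  have h : kk 4 0 τ = kk 1 0 τ := by
    have h1 := kk_add_left (-1) 0 τ
    have h2 := kk_neg 1 0 τ
    simp at h1 h2
    rw [h1, h2]; simp
  norm_num
  rw [h]

lemma GG_T (r s : ℤ) (τ : ℂ) : GG r s (τ + 1) = GG r (r + s) τ := by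
  have hk : ∀ r s : ℤ, kk r s (τ + 1) = cexp (π * I * (1 / 4)) ^ 5 * kk r (r + s) τ := by
    intro r s
    unfold kk
    rw [KF_T, mul_pow, show (r : ℂ) / 5 + s / 5 = ((r + s : ℤ) : ℂ) / 5 by push_cast; ring]
  unfold GG
  rw [hk, hk, mul_div_mul_left _ _ (pow_ne_zero _ (exp_ne_zero _)), ← mul_add]
  congr 1
  have : Even (r * (r - 1)) := Int.even_mul_pred_self r
  refine neg_one_zpow_congr ?_
  obtain ⟨k, hk⟩ := this
  exact ⟨-k - r, by linear_combination -hk⟩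

lemma GG_S (r s : ℤ) {τ : ℂ} (hτ : τ ≠ 0) : GG r s (-1 / τ) = GG s (-r) τ := by
  have hk : ∀ r s : ℤ, kk r s (-1 / τ) =
      (cexp (π * I * (-1 / 2)) * (-I * τ) ^ (1 / 2 : ℂ)) ^ 5 * kk s (-r) τ := by
    intro r s
    unfold kk
    rw [KF_S _ _ hτ, mul_pow, show -((r : ℂ) / 5) = ((-r : ℤ) : ℂ) / 5 by push_cast; ring]
  have hne : (-I * τ) ^ (1 / 2 : ℂ) ≠ 0 := by
    rw [Ne, cpow_eq_zero_iff]; simp [hτ]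
  unfold GG
  rw [hk, hk, mul_div_mul_left _ _ (pow_ne_zero _ (mul_ne_zero (exp_ne_zero _) hne)),
    show 2 * -r = -(2 * r) by ring]
  congr 1
  exact neg_one_zpow_congr ⟨r * s + r, by ring⟩

open UpperHalfPlane Matrix.SpecialLinearGroup in
theorem GG_smul (γ : Matrix.SpecialLinearGroup (Fin 2) ℤ) : ∀ (r s : ℤ) (τ : ℍ),
    GG r s ((γ • τ : ℍ) : ℂ) = GG (r * γ 0 0 + s * γ 1 0) (r * γ 0 1 + s * γ 1 1) (τ : ℂ) := by
  have hγ : γ ∈ Subgroup.closure {ModularGroup.S, ModularGroup.T} := by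
    rw [SpecialLinearGroup.SL2Z_generators]; trivial
  induction hγ using Subgroup.closure_induction with
  | mem x hx =>
    intro r s τ
    rcases hx with rfl | rfl
    · rw [UpperHalfPlane.modular_S_smul]
      have : ((UpperHalfPlane.mk (-(τ : ℂ))⁻¹ τ.im_inv_neg_coe_pos : ℍ) : ℂ) = -1 / (τ : ℂ) := by
        rw [UpperHalfPlane.coe_mk, inv_neg, div_eq_mul_inv, neg_one_mul]
      rw [this, GG_S _ _ τ.ne_zero]
      simp [ModularGroup.S]
    · rw [UpperHalfPlane.modular_T_smul]
      rw [UpperHalfPlane.coe_vadd]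
      push_cast
      rw [add_comm, GG_T]
      simp [ModularGroup.T]
  | one => intro r s τ; simp
  | mul x y _ _ hx hy =>
    intro r s τ
    rw [mul_smul, hx, hy]
    simp only [Matrix.SpecialLinearGroup.coe_mul, Matrix.mul_apply, Fin.sum_univ_two]
    congr 1 <;> ring
  | inv x _ hx =>
    intro r s τ
    have h := hx (r * (x⁻¹) 0 0 + s * (x⁻¹) 1 0) (r * (x⁻¹) 0 1 + s * (x⁻¹) 1 1) (x⁻¹ • τ)
    rw [smul_inv_smul] at h
    rw [h]
    have hd := Matrix.SpecialLinearGroup.det_coe x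
    rw [Matrix.det_fin_two] at hd
    have i00 : (x⁻¹) 0 0 = x 1 1 := by simp [Matrix.SpecialLinearGroup.coe_inv, Matrix.adjugate_fin_two]
    have i01 : (x⁻¹) 0 1 = -x 0 1 := by simp [Matrix.SpecialLinearGroup.coe_inv, Matrix.adjugate_fin_two]
    have i10 : (x⁻¹) 1 0 = -x 1 0 := by simp [Matrix.SpecialLinearGroup.coe_inv, Matrix.adjugate_fin_two]
    have i11 : (x⁻¹) 1 1 = x 0 0 := by simp [Matrix.SpecialLinearGroup.coe_inv, Matrix.adjugate_fin_two]
    rw [i00, i01, i10, i11]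
    congr 1
    · linear_combination (-r) * hd
    · linear_combination (-s) * hd

end RR

namespace RR
open Complex Filter Topology
open UpperHalfPlane hiding I

local notation "π" => (Real.pi : ℂ)

/-- `∏ (1 - X^n u)` -/
noncomputable def EP (u X : ℂ) : ℂ := ∏' n : ℕ, (1 - X ^ n * u)

lemma EP_summable (u : ℂ) {X : ℂ} (hX : ‖X‖ < 1) : Summable fun n : ℕ => ‖-(X ^ n * u)‖ := by
  have := (summable_geometric_of_lt_one (norm_nonneg _) hX).mul_right ‖u‖
  refine this.congr fun n => ?_
  rw [norm_neg, norm_mul, norm_pow]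

lemma EP_multipliable (u : ℂ) {X : ℂ} (hX : ‖X‖ < 1) : Multipliable fun n : ℕ => (1 - X ^ n * u) := by
  simp_rw [sub_eq_add_neg]
  exact multipliable_one_add_of_summable (EP_summable u hX)

lemma KF_prod (a b : ℂ) {τ : ℂ} (hτ : 0 < τ.im) : KF a b τ =
    cexp (π * I * (a * (a * τ + b) + τ / 4 + (a * τ + b + 1 / 2))) *
    (PS Set.univ (cexp (2 * π * I * τ)) *
      (EP (cexp (2 * π * I * τ) * cexp (2 * π * I * (a * τ + b))) (cexp (2 * π * I * τ)) *
       EP (cexp (2 * π * I * (a * τ + b)))⁻¹ (cexp (2 * π * I * τ)))) := by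
  unfold KF
  rw [triple_product _ hτ]
  have hX : cexp (π * I * τ) ^ 2 = cexp (2 * π * I * τ) := by
    rw [← exp_nat_mul]; congr 1; push_cast; ring
  rw [hX]
  have hw : cexp (2 * π * I * (a * τ + b + 1 / 2 + τ / 2)) =
      - (cexp (2 * π * I * (a * τ + b)) * cexp (π * I * τ)) := by
    rw [← exp_add, neg_exp]; congr 1; ring
  rw [hw]
  have hx0 := exp_ne_zero (π * I * τ)
  congr 3
  · unfold EP
    refine tprod_congr fun n => ?_
    rw [← hX]; ring
  · unfold EP
    refine tprod_congr fun n => ?_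
    rw [← hX, inv_neg, mul_inv]
    field_simp
    ring

/-- The nome. -/
noncomputable def qq (τ : ℍ) : ℂ := cexp (2 * π * I * τ)

lemma norm_qq (τ : ℍ) : ‖qq τ‖ = Real.exp (-2 * Real.pi * τ.im) := by
  unfold qq
  rw [Complex.norm_exp]
  congr 1
  simp

lemma norm_qq_lt (τ : ℍ) : ‖qq τ‖ < 1 := by
  rw [norm_qq, Real.exp_lt_one_iff]
  have := τ.im_pos
  have := Real.pi_pos
  nlinarith [mul_pos Real.pi_pos τ.im_pos]

lemma qq_ne_zero (τ : ℍ) : qq τ ≠ 0 := exp_ne_zero _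

/-- The fifth power of the Rogers-Ramanujan continued fraction. -/
noncomputable def f (τ : ℍ) : ℂ := qq τ * U (qq τ)

lemma f_ne_zero (τ : ℍ) : f τ ≠ 0 := mul_ne_zero (qq_ne_zero τ) (U_ne_zero (norm_qq_lt τ))

lemma jac5 (n : ℕ) : jacobiSym (n + 1) 5 =
    if (n + 1) % 5 = 1 ∨ (n + 1) % 5 = 4 then 1 else if (n + 1) % 5 = 0 then 0 else -1 := by
  rw [jacobiSym.mod_left]
  have h : ((n : ℤ) + 1) % ((5 : ℕ) : ℤ) = (((n + 1) % 5 : ℕ) : ℤ) := by push_cast; rfl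
  rw [h]
  have h5 : (n + 1) % 5 < 5 := Nat.mod_lt _ (by norm_num)
  interval_cases (n + 1) % 5 <;> norm_num

lemma tendsto_mul5 : Tendsto (fun N : ℕ => 5 * N) atTop atTop :=
  tendsto_atTop_mono (fun n => by simp only [id]; omega) tendsto_id

lemma PS_QR {x : ℂ} (hx : ‖x‖ < 1) : PS QR x = EP x (x ^ 5) * EP (x ^ 4) (x ^ 5) := by
  have h1 := (PS_multipliable QR hx).hasProd.tendsto_prod_nat.comp tendsto_mul5
  have h2 := (EP_multipliable x (pow5_lt hx)).hasProd.tendsto_prod_nat.mul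
    (EP_multipliable (x ^ 4) (pow5_lt hx)).hasProd.tendsto_prod_nat
  refine tendsto_nhds_unique (h1.congr fun N => ?_) h2
  simp only [Function.comp]
  induction N with
  | zero => simp
  | succ N ih =>
    rw [Finset.prod_range_succ _ N, Finset.prod_range_succ _ N, mul_mul_mul_comm, ← ih,
      show 5 * (N + 1) = 5 * N + 1 + 1 + 1 + 1 + 1 by ring]
    simp only [Finset.prod_range_succ]
    have a0 : 5 * N ∈ QR := by simp only [QR, Set.mem_ofPred_eq]; rw [jac5]; rw [if_pos]; omega
    have a1 : 5 * N + 1 ∉ QR := by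
      simp only [QR, Set.mem_ofPred_eq]; rw [jac5, if_neg (by omega), if_neg (by omega)]; norm_num
    have a2 : 5 * N + 1 + 1 ∉ QR := by
      simp only [QR, Set.mem_ofPred_eq]; rw [jac5, if_neg (by omega), if_neg (by omega)]; norm_num
    have a3 : 5 * N + 1 + 1 + 1 ∈ QR := by
      simp only [QR, Set.mem_ofPred_eq]; rw [jac5, if_pos (by omega)]
    have a4 : 5 * N + 1 + 1 + 1 + 1 ∉ QR := by
      simp only [QR, Set.mem_ofPred_eq]; rw [jac5, if_neg (by omega), if_pos (by omega)]; norm_num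
    simp only [a0, a1, a2, a3, a4, Set.indicator_of_mem, Set.indicator_of_notMem, not_false_eq_true]
    ring

lemma PS_NR {x : ℂ} (hx : ‖x‖ < 1) : PS NR x = EP (x ^ 2) (x ^ 5) * EP (x ^ 3) (x ^ 5) := by
  have h1 := (PS_multipliable NR hx).hasProd.tendsto_prod_nat.comp tendsto_mul5
  have h2 := (EP_multipliable (x ^ 2) (pow5_lt hx)).hasProd.tendsto_prod_nat.mul
    (EP_multipliable (x ^ 3) (pow5_lt hx)).hasProd.tendsto_prod_nat
  refine tendsto_nhds_unique (h1.congr fun N => ?_) h2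
  simp only [Function.comp]
  induction N with
  | zero => simp
  | succ N ih =>
    rw [Finset.prod_range_succ _ N, Finset.prod_range_succ _ N, mul_mul_mul_comm, ← ih,
      show 5 * (N + 1) = 5 * N + 1 + 1 + 1 + 1 + 1 by ring]
    simp only [Finset.prod_range_succ]
    have a0 : 5 * N ∉ NR := by
      simp only [NR, Set.mem_ofPred_eq]; rw [jac5, if_pos (by omega)]; norm_num
    have a1 : 5 * N + 1 ∈ NR := by
      simp only [NR, Set.mem_ofPred_eq]; rw [jac5, if_neg (by omega), if_neg (by omega)]
    have a2 : 5 * N + 1 + 1 ∈ NR := by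
      simp only [NR, Set.mem_ofPred_eq]; rw [jac5, if_neg (by omega), if_neg (by omega)]
    have a3 : 5 * N + 1 + 1 + 1 ∉ NR := by
      simp only [NR, Set.mem_ofPred_eq]; rw [jac5, if_pos (by omega)]; norm_num
    have a4 : 5 * N + 1 + 1 + 1 + 1 ∉ NR := by
      simp only [NR, Set.mem_ofPred_eq]; rw [jac5, if_neg (by omega), if_pos (by omega)]; norm_num
    simp only [a0, a1, a2, a3, a4, Set.indicator_of_mem, Set.indicator_of_notMem, not_false_eq_true]
    ring

lemma f_eq_GG (τ : ℍ) : f τ = GG 1 0 (5 * τ) := by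
  have him : 0 < (5 * (τ : ℂ)).im := by
    have := τ.im_pos
    simpa using this
  have hq := norm_qq_lt τ
  have hq0 := qq_ne_zero τ
  rw [← GG_neg, GG, kk, kk, ← div_pow, KF_prod _ _ him, KF_prod _ _ him]
  have hX : cexp (2 * π * I * (5 * (τ : ℂ))) = qq τ ^ 5 := by
    rw [qq, ← exp_nat_mul]; congr 1; push_cast; ring
  have hu1 : cexp (2 * π * I * (((-1 : ℤ) : ℂ) / 5 * (5 * (τ : ℂ)) + ((-0 : ℤ) : ℂ) / 5)) =
      (qq τ)⁻¹ := by
    rw [qq, ← exp_neg]; congr 1; push_cast; ring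
  have hu2 : cexp (2 * π * I * (((2 * -1 : ℤ) : ℂ) / 5 * (5 * (τ : ℂ)) + ((2 * -0 : ℤ) : ℂ) / 5)) =
      (qq τ ^ 2)⁻¹ := by
    rw [qq, ← exp_nat_mul, ← exp_neg]; congr 1; push_cast; ring
  rw [hX, hu1, hu2, show qq τ ^ 5 * (qq τ)⁻¹ = qq τ ^ 4 by field_simp,
    show qq τ ^ 5 * (qq τ ^ 2)⁻¹ = qq τ ^ 3 by field_simp, inv_inv, inv_inv]
  rw [mul_comm (EP (qq τ ^ 4) _), mul_comm (EP (qq τ ^ 3) _), ← PS_QR hq, ← PS_NR hq]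
  rw [mul_div_mul_comm, mul_div_mul_left _ _ (PS_ne_zero _ (pow5_lt hq)), ← exp_sub, mul_pow,
    ← exp_nat_mul, f, U_eq hq, div_pow, div_eq_mul_inv (PS QR _ ^ 5)]
  have : cexp (((5 : ℕ) : ℂ) * (π * I * (((-1 : ℤ) : ℂ) / 5 * (((-1 : ℤ) : ℂ) / 5 * (5 * (τ : ℂ)) +
      ((-0 : ℤ) : ℂ) / 5) + 5 * (τ : ℂ) / 4 + (((-1 : ℤ) : ℂ) / 5 * (5 * (τ : ℂ)) +
      ((-0 : ℤ) : ℂ) / 5 + 1 / 2)) -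
      π * I * (((2 * -1 : ℤ) : ℂ) / 5 * (((2 * -1 : ℤ) : ℂ) / 5 * (5 * (τ : ℂ)) +
      ((2 * -0 : ℤ) : ℂ) / 5) + 5 * (τ : ℂ) / 4 + (((2 * -1 : ℤ) : ℂ) / 5 * (5 * (τ : ℂ)) +
      ((2 * -0 : ℤ) : ℂ) / 5 + 1 / 2)))) = qq τ := by
    rw [qq]; congr 1; push_cast; ring
  rw [this]
  norm_num

/-- The diamond operation. -/
noncomputable def dia (α : ℤ) (x : ℂ) : ℂ := if α % 5 = 1 ∨ α % 5 = 4 then x else -x⁻¹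

lemma GG_dia {α : ℤ} (hα : α % 5 ≠ 0) (τ : ℂ) : GG α 0 τ = dia α (GG 1 0 τ) := by
  have h := GG_add_left_mul (α % 5) 0 (α / 5) τ
  rw [Int.emod_add_mul_ediv] at h
  rw [h, dia]
  have h1 : 0 ≤ α % 5 := Int.emod_nonneg _ (by norm_num)
  have h2 : α % 5 < 5 := Int.emod_lt_of_pos _ (by norm_num)
  have h4 : GG 4 0 τ = GG 1 0 τ := by
    have := GG_add_left (-1) 0 τ
    have h' := GG_neg 1 0 τ
    simp at this h'
    rw [this, h']
  have h3 : GG 3 0 τ = GG 2 0 τ := by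
    have := GG_add_left (-2) 0 τ
    have h' := GG_neg 2 0 τ
    simp at this h'
    rw [this, h']
  interval_cases (α % 5)
  · exact absurd rfl hα
  · simp
  · simp [GG_two]
  · simp [h3, GG_two]
  · simp [h4]

/-- scaling of the upper half plane by 5 -/
noncomputable def five (τ : ℍ) : ℍ := ⟨5 * (τ : ℂ), by
  have := τ.im_pos
  simpa using this⟩

/-- Explicit matrices in `SL(2,ℤ)`. -/
def mkSL (a b c d : ℤ) (h : a * d - b * c = 1) : Matrix.SpecialLinearGroup (Fin 2) ℤ :=
  ⟨!![a, b; c, d], by rw [Matrix.det_fin_two]; simpa using h⟩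

@[simp] lemma mkSL_00 (a b c d : ℤ) (h : a * d - b * c = 1) : mkSL a b c d h 0 0 = a := rfl
@[simp] lemma mkSL_01 (a b c d : ℤ) (h : a * d - b * c = 1) : mkSL a b c d h 0 1 = b := rfl
@[simp] lemma mkSL_10 (a b c d : ℤ) (h : a * d - b * c = 1) : mkSL a b c d h 1 0 = c := rfl
@[simp] lemma mkSL_11 (a b c d : ℤ) (h : a * d - b * c = 1) : mkSL a b c d h 1 1 = d := rfl

lemma coe_smul (γ : Matrix.SpecialLinearGroup (Fin 2) ℤ) (τ : ℍ) :
    ((γ • τ : ℍ) : ℂ) = (γ 0 0 * τ + γ 0 1) / (γ 1 0 * τ + γ 1 1) := by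
  rw [UpperHalfPlane.coe_specialLinearGroup_apply]
  simp

lemma five_smul (γ : Matrix.SpecialLinearGroup (Fin 2) ℤ) (c : ℤ) (hc : γ 1 0 = 5 * c) :
    ∃ γ' : Matrix.SpecialLinearGroup (Fin 2) ℤ, γ' 0 0 = γ 0 0 ∧ γ' 0 1 = 5 * γ 0 1 ∧ γ' 1 0 = c ∧
      γ' 1 1 = γ 1 1 ∧ ∀ τ, five (γ • τ) = γ' • five τ := by
  have hd := Matrix.SpecialLinearGroup.det_coe γ
  rw [Matrix.det_fin_two, hc] at hd
  refine ⟨mkSL (γ 0 0) (5 * γ 0 1) c (γ 1 1) (by linear_combination hd), rfl, rfl, rfl, rfl,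
    fun τ => ?_⟩
  · ext1
    change 5 * ((γ • τ : ℍ) : ℂ) = _
    rw [coe_smul, coe_smul, hc]
    simp [five]
    ring

theorem f_smul (γ : Matrix.SpecialLinearGroup (Fin 2) ℤ) (h5 : (5 : ℤ) ∣ γ 1 0) (τ : ℍ) :
    f (γ • τ) = dia (γ 0 0) (f τ) := by
  obtain ⟨c, hc⟩ := h5
  obtain ⟨γ', h00, h01, h10, h11, h⟩ := five_smul γ c hc
  have hd := Matrix.SpecialLinearGroup.det_coe γ
  rw [Matrix.det_fin_two, hc] at hd
  have hα : γ 0 0 % 5 ≠ 0 := by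
    intro h0
    obtain ⟨k, hk⟩ := Int.dvd_of_emod_eq_zero h0
    rw [hk] at hd
    have : (5:ℤ) * (k * γ 1 1 - γ 0 1 * c) = 1 := by linear_combination hd
    omega
  rw [f_eq_GG, f_eq_GG]
  change GG 1 0 (five (γ • τ) : ℂ) = dia (γ 0 0) (GG 1 0 (five τ : ℂ))
  rw [h, GG_smul, h00, h01, ← GG_dia hα]
  have := GG_add_right_mul (γ 0 0) 0 (γ 0 1) (five τ : ℂ)
  simpa using this

theorem f_S (τ : ℍ) : f (ModularGroup.S • τ) =
    (cexp (-(π * I / 5)) *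
      (EP (cexp (2 * π * I * (τ / 5)) * cexp (2 * π * I / 5)) (cexp (2 * π * I * (τ / 5))) *
       EP (cexp (2 * π * I / 5))⁻¹ (cexp (2 * π * I * (τ / 5)))) /
      (EP (cexp (2 * π * I * (τ / 5)) * cexp (2 * π * I / 5) ^ 2) (cexp (2 * π * I * (τ / 5))) *
       EP (cexp (2 * π * I / 5) ^ 2)⁻¹ (cexp (2 * π * I * (τ / 5))))) ^ 5 := by
  have hτ := τ.ne_zero
  have him : 0 < ((τ : ℂ) / 5).im := by
    have := τ.im_pos
    rw [show (τ : ℂ) / 5 = ((1 / 5 : ℝ) : ℂ) * τ by push_cast; ring, Complex.im_ofReal_mul]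
    positivity
  have hX : ‖cexp (2 * π * I * ((τ : ℂ) / 5))‖ < 1 := by
    have := norm_qq_lt ⟨(τ : ℂ) / 5, him⟩
    simpa [qq] using this
  rw [f_eq_GG, UpperHalfPlane.modular_S_smul, UpperHalfPlane.coe_mk]
  rw [show 5 * (-(τ : ℂ))⁻¹ = -1 / ((τ : ℂ) / 5) by field_simp]
  rw [GG_S _ _ (div_ne_zero hτ (by norm_num)), ← GG_neg, neg_neg, neg_zero]
  rw [GG, kk, kk, ← div_pow, KF_prod _ _ him, KF_prod _ _ him]
  have hu1 : cexp (2 * π * I * (((0 : ℤ) : ℂ) / 5 * ((τ : ℂ) / 5) + ((1 : ℤ) : ℂ) / 5)) =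
      cexp (2 * π * I / 5) := by
    congr 1; push_cast; ring
  have hu2 : cexp (2 * π * I * (((2 * 0 : ℤ) : ℂ) / 5 * ((τ : ℂ) / 5) + ((2 * 1 : ℤ) : ℂ) / 5)) =
      cexp (2 * π * I / 5) ^ 2 := by
    rw [← exp_nat_mul]; congr 1; push_cast; ring
  rw [hu1, hu2, mul_div_mul_comm, mul_div_mul_left _ _ (PS_ne_zero _ hX), ← exp_sub]
  norm_num
  rw [mul_div_assoc (cexp (-(π * I / 5)))]
  congr 3
  ring

end RR

namespace RR
open Complex Filter Topology
open UpperHalfPlane hiding I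

local notation "π" => (Real.pi : ℂ)

lemma tprod_near_one {a : ℕ → ℂ} {s : ℝ} (hs : HasSum (fun n => ‖a n‖) s) :
    ‖∏' n, (1 + a n) - 1‖ ≤ Real.exp s - 1 := by
  have h := (multipliable_one_add_of_summable hs.summable).hasProd.tendsto_prod_nat
  refine le_of_tendsto (h.sub_const 1).norm (Eventually.of_forall fun n => ?_)
  refine (Finset.norm_prod_one_add_sub_one_le _ _).trans ?_
  gcongr
  exact sum_le_hasSum _ (fun i _ => norm_nonneg _) hs

/-- Pair products. -/
noncomputable def PP (t X : ℂ) : ℂ := ∏' n : ℕ, (1 + (-(t * X ^ (n + 1)) + X ^ (2 * (n + 1))))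

lemma EP_pair (z : ℂ) (hz : z ≠ 0) {X : ℂ} (hX : ‖X‖ < 1) :
    EP (X * z) X * EP z⁻¹ X = (1 - z⁻¹) * PP (z + z⁻¹) X := by
  have h1 := EP_multipliable (X * z⁻¹) hX
  have h2 : EP z⁻¹ X = (1 - z⁻¹) * EP (X * z⁻¹) X := by
    unfold EP
    rw [tprod_eq_zero_mul']
    · simp only [pow_zero, one_mul]
      congr 1
      refine tprod_congr fun n => ?_
      ring
    · refine h1.congr fun n => ?_
      ring
  rw [h2, mul_left_comm]
  congr 1
  unfold EP PP
  rw [← (EP_multipliable (X * z) hX).tprod_mul h1]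
  refine tprod_congr fun n => ?_
  field_simp
  ring

lemma PP_bounds {t X : ℂ} {T s : ℝ} (hT : ‖t‖ ≤ T) (hX : ‖X‖ ≤ 337 / 1000)
    (hs : T * (337 / 1000) ^ 2 / (1 - 337 / 1000) + (337 / 1000) ^ 4 / (1 - (337 / 1000) ^ 2) ≤ s)
    (h2 : Real.exp s ≤ 2) :
    (1 - (T * (337 / 1000) + (337 / 1000) ^ 2)) * (2 - Real.exp s) ≤ ‖PP t X‖ ∧
    ‖PP t X‖ ≤ (1 + (T * (337 / 1000) + (337 / 1000) ^ 2)) * Real.exp s := by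
  set r : ℝ := 337 / 1000 with hr
  have hT0 : 0 ≤ T := (norm_nonneg _).trans hT
  have hXn := norm_nonneg X
  have hX1 : ‖X‖ < 1 := by rw [hr] at hX; linarith
  set a : ℕ → ℂ := fun n => -(t * X ^ (n + 1)) + X ^ (2 * (n + 1)) with ha
  have hbd : ∀ n, ‖a n‖ ≤ T * r ^ (n + 1) + r ^ (2 * (n + 1)) := by
    intro n
    refine (norm_add_le _ _).trans ?_
    rw [norm_neg, norm_mul, norm_pow, norm_pow]
    gcongr
  have hg1 : HasSum (fun n : ℕ => T * r ^ (n + 1 + 1) + r ^ (2 * (n + 1 + 1)))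
      (T * r ^ 2 / (1 - r) + r ^ 4 / (1 - r ^ 2)) := by
    have e1 := (hasSum_geometric_of_lt_one (r := r) (by rw [hr]; norm_num) (by rw [hr]; norm_num)).mul_left (T * r ^ 2)
    have e2 := (hasSum_geometric_of_lt_one (r := r ^ 2) (by rw [hr]; norm_num) (by rw [hr]; norm_num)).mul_left (r ^ 4)
    rw [div_eq_mul_inv, div_eq_mul_inv]
    refine HasSum.congr_fun (e1.add e2) fun n => ?_
    ring
  have hsum : Summable (fun n => ‖a (n + 1)‖) :=
    Summable.of_nonneg_of_le (fun _ => norm_nonneg _) (fun n => hbd (n + 1)) hg1.summable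
  have hle : ∑' n, ‖a (n + 1)‖ ≤ s :=
    (hasSum_le (fun n => hbd (n + 1)) hsum.hasSum hg1).trans hs
  have key := tprod_near_one hsum.hasSum
  have heq : PP t X = (1 + a 0) * ∏' n, (1 + a (n + 1)) := by
    unfold PP
    rw [tprod_eq_zero_mul']
    exact multipliable_one_add_of_summable hsum
  set Q := ∏' n, (1 + a (n + 1)) with hQ
  have hQ1 : ‖Q - 1‖ ≤ Real.exp s - 1 := key.trans (by gcongr)
  have hQl : 2 - Real.exp s ≤ ‖Q‖ := by
    have := norm_sub_norm_le 1 (1 - Q)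
    rw [norm_one, sub_sub_cancel, norm_sub_rev] at this
    linarith
  have hQu : ‖Q‖ ≤ Real.exp s := by
    have := norm_sub_norm_le Q 1
    rw [norm_one] at this
    linarith
  have ha0 : ‖a 0‖ ≤ T * r + r ^ 2 := by simpa using hbd 0
  have hal : 1 - (T * r + r ^ 2) ≤ ‖1 + a 0‖ := by
    have := norm_sub_norm_le (1 : ℂ) (-a 0)
    rw [norm_one, norm_neg, sub_neg_eq_add] at this
    linarith
  have hau : ‖1 + a 0‖ ≤ 1 + (T * r + r ^ 2) := by
    have := norm_add_le (1 : ℂ) (a 0)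
    rw [norm_one] at this
    linarith
  rw [heq, norm_mul]
  constructor
  · exact mul_le_mul hal hQl (by linarith) (norm_nonneg _)
  · gcongr

/-- the fifth root of unity -/
noncomputable def z5 : ℂ := cexp (2 * π * I / 5)

lemma z5_ne : z5 ≠ 0 := exp_ne_zero _

lemma z5_pow : z5 ^ 5 = 1 := by
  rw [z5, ← exp_nat_mul, show ((5 : ℕ) : ℂ) * (2 * π * I / 5) = 2 * π * I by push_cast; ring,
    exp_two_pi_mul_I]

lemma z5_tr : z5 + z5⁻¹ = (((√5 - 1) / 2 : ℝ) : ℂ) := by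
  have h : z5 + z5⁻¹ = ((2 * Real.cos (2 * (Real.pi / 5)) : ℝ) : ℂ) := by
    rw [z5, ← exp_neg]
    push_cast
    rw [Complex.two_cos]
    congr 2 <;> ring
  rw [h, Real.cos_two_mul, Real.cos_pi_div_five]
  congr 1
  have : √5 * √5 = 5 := Real.mul_self_sqrt (by norm_num)
  nlinarith

lemma z5_sq_tr : z5 ^ 2 + (z5 ^ 2)⁻¹ = ((-(√5 + 1) / 2 : ℝ) : ℂ) := by
  have h : z5 ^ 2 + (z5 ^ 2)⁻¹ = (z5 + z5⁻¹) ^ 2 - 2 := by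
    have := z5_ne
    field_simp; ring
  rw [h, z5_tr, ← ofReal_pow]
  have h2 : ((2 : ℝ) : ℂ) = 2 := by norm_num
  rw [← h2, ← ofReal_sub]
  congr 1
  have : √5 * √5 = 5 := Real.mul_self_sqrt (by norm_num)
  nlinarith

lemma sqrt5_lt : √5 < 2.2361 := by
  rw [Real.sqrt_lt' (by norm_num)]; norm_num
lemma lt_sqrt5 : 2.236 < √5 := by
  apply Real.lt_sqrt_of_sq_lt; norm_num

lemma one_add_z5 : ‖1 + z5⁻¹‖ ^ 2 = 2 + (√5 - 1) / 2 := by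
  have hn : ‖z5‖ = 1 := by
    have : ‖z5‖ ^ 5 = 1 := by rw [← norm_pow, z5_pow, norm_one]
    exact (pow_eq_one_iff_of_nonneg (norm_nonneg _) (by norm_num)).mp this
  have hc : (starRingEnd ℂ) z5⁻¹ = z5 := by
    rw [Complex.inv_def, normSq_eq_norm_sq, hn]
    simp
  have := Complex.mul_conj (1 + z5⁻¹)
  rw [map_add, hc, map_one, normSq_eq_norm_sq] at this
  have h2 : (1 + z5⁻¹) * (1 + z5) = 2 + (z5 + z5⁻¹) := by
    have := z5_ne
    field_simp; ring
  rw [h2, z5_tr] at this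
  exact_mod_cast this.symm

lemma f_S' (τ : ℍ) (X : ℂ) (hX : X = cexp (2 * π * I * (τ / 5))) (hX1 : ‖X‖ < 1) :
    ‖f (ModularGroup.S • τ)‖ =
      (‖PP (((√5 - 1) / 2 : ℝ) : ℂ) X‖ / (‖1 + z5⁻¹‖ * ‖PP ((-(√5 + 1) / 2 : ℝ) : ℂ) X‖)) ^ 5 := by
  rw [f_S, ← hX, ← z5, EP_pair _ z5_ne hX1, EP_pair _ (pow_ne_zero _ z5_ne) hX1, z5_tr, z5_sq_tr]
  rw [norm_pow, norm_div, norm_mul, norm_mul, norm_mul]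
  have h1 : ‖cexp (-(π * I / 5))‖ = 1 := by
    rw [show -(π * I / 5) = ((-(Real.pi / 5) : ℝ) : ℂ) * I by push_cast; ring, norm_exp_ofReal_mul_I]
  have h3 : (1 : ℂ) - z5⁻¹ ≠ 0 := by
    intro h
    have h1 : z5 = 1 := by rw [sub_eq_zero] at h; rw [← inv_inv z5, ← h, inv_one]
    have := z5_tr
    rw [h1] at this
    have h' : (1 : ℂ) + 1⁻¹ = ((2 : ℝ) : ℂ) := by norm_num
    rw [h', ofReal_inj] at this
    linarith [sqrt5_lt]
  have h2 : ‖1 - (z5 ^ 2)⁻¹‖ = ‖1 - z5⁻¹‖ * ‖1 + z5⁻¹‖ := by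
    rw [← norm_mul]; congr 1; ring
  rw [h1, h2, one_mul, mul_assoc ‖1 - z5⁻¹‖, mul_div_mul_left _ _ (norm_ne_zero_iff.mpr h3)]

lemma exp_bound1 : Real.exp 0.1205 ≤ 1.1281 := by
  have := Real.exp_bound' (x := 0.1205) (by norm_num) (by norm_num) (n := 4) (by norm_num)
  refine this.trans ?_
  norm_num [Finset.sum_range_succ, Nat.factorial]

lemma exp_bound2 : Real.exp 0.2921 ≤ 1.3393 := by
  have := Real.exp_bound' (x := 0.2921) (by norm_num) (by norm_num) (n := 5) (by norm_num)
  refine this.trans ?_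
  norm_num [Finset.sum_range_succ, Nat.factorial]

/-- Two-sided bounds for `f` near the cusp `0`. -/
theorem f_S_bounds (τ : ℍ) (hτ : ‖cexp (2 * π * I * (τ / 5))‖ ≤ 337 / 1000) :
    (11 / 100000 : ℝ) ≤ ‖f (ModularGroup.S • τ)‖ ∧ ‖f (ModularGroup.S • τ)‖ ≤ 9000 := by
  set X := cexp (2 * π * I * ((τ : ℂ) / 5)) with hX
  have h5u := sqrt5_lt
  have h5l := lt_sqrt5
  rw [f_S' τ X hX (by linarith)]
  have b1 := PP_bounds (t := (((√5 - 1) / 2 : ℝ) : ℂ)) (X := X) (T := 0.61805) (s := 0.1205)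
    (by rw [norm_real, Real.norm_of_nonneg (by linarith)]; linarith) hτ (by norm_num)
    (by linarith [exp_bound1, exp_bound2])
  have b2 := PP_bounds (t := ((-(√5 + 1) / 2 : ℝ) : ℂ)) (X := X) (T := 1.61805) (s := 0.2921)
    (by rw [norm_real, Real.norm_of_nonpos (by linarith)]; linarith) hτ (by norm_num)
    (by linarith [exp_bound1, exp_bound2])
  have e1 := exp_bound1
  have e2 := exp_bound2
  have hz := one_add_z5
  have hz0 := norm_nonneg (1 + z5⁻¹)
  set P1 := ‖PP (((√5 - 1) / 2 : ℝ) : ℂ) X‖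
  set P2 := ‖PP ((-(√5 + 1) / 2 : ℝ) : ℂ) X‖
  set z := ‖1 + z5⁻¹‖
  have hzu : z ≤ 1.6181 := by nlinarith
  have hzl : 1.618 ≤ z := by nlinarith
  have a1 : 0.590 ≤ P1 := by nlinarith [b1.1]
  have a2 : P1 ≤ 1.5 := by nlinarith [b1.2]
  have a3 : 0.22 ≤ P2 := by nlinarith [b2.1]
  have a4 : P2 ≤ 2.222 := by nlinarith [b2.2]
  have hpos : 0 < z * P2 := by positivity
  constructor
  · have : (0.1640 : ℝ) ≤ P1 / (z * P2) := by
      rw [le_div_iff₀ hpos]; nlinarith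
    calc (11 / 100000 : ℝ) ≤ 0.1640 ^ 5 := by norm_num
      _ ≤ _ := by gcongr
  · have : P1 / (z * P2) ≤ 6 := by
      rw [div_le_iff₀ hpos]; nlinarith
    calc _ ≤ (6 : ℝ) ^ 5 := by gcongr
      _ ≤ _ := by norm_num

end RR

namespace RR
open Complex Filter Topology ModularForm
open UpperHalfPlane hiding I
open Matrix (SpecialLinearGroup)
open scoped MatrixGroups

local notation "π" => (Real.pi : ℂ)

lemma Delta_eq (τ : ℍ) : discriminant τ = qq τ * PS Set.univ (qq τ) ^ 24 := by
  rw [discriminant_eq_q_prod]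
  have hq : Function.Periodic.qParam 1 (τ : ℂ) = qq τ := by
    simp [Function.Periodic.qParam, qq]
  simp only [eta_q, hq]
  congr 1
  have := PS_multipliable Set.univ (norm_qq_lt τ)
  rw [PS, ← this.tprod_pow]
  refine tprod_congr fun n => ?_
  simp [sub_eq_add_neg]

lemma Delta_smul (γ : SL(2, ℤ)) : ∀ τ : ℍ,
    discriminant (γ • τ) = (γ 1 0 * τ + γ 1 1) ^ 12 * discriminant τ := by
  intro τ
  have h2 := congrFun
    (SlashInvariantForm.slash_action_generators_SL2Z discriminant_S_invariant discriminant_T_invariant γ) τ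
  rw [ModularForm.SL_slash_apply] at h2
  have hd : denom γ τ = γ 1 0 * τ + γ 1 1 := by
    simp [denom]
  have hd0 := denom_ne_zero γ τ
  rw [hd] at h2 hd0
  rw [zpow_neg] at h2
  rw [← h2]
  have : ((γ 1 0 * τ + γ 1 1 : ℂ) ^ (12 : ℤ)) = (γ 1 0 * τ + γ 1 1 : ℂ) ^ 12 := by norm_cast
  rw [this]
  field_simp

/-- The auxiliary form of weight 48. -/
noncomputable def EE (τ : ℍ) : ℂ := discriminant (five τ) ^ 5 / discriminant τ

lemma qq_five (τ : ℍ) : qq (five τ) = qq τ ^ 5 := by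
  rw [qq, qq, ← exp_nat_mul]; congr 1; simp only [five]; push_cast; ring

lemma EE_eq (τ : ℍ) : EE τ = qq τ ^ 24 * V (qq τ) := by
  have h0 := qq_ne_zero τ
  have h1 := PS_ne_zero Set.univ (norm_qq_lt τ)
  rw [EE, Delta_eq, Delta_eq, qq_five, V]
  field_simp

lemma EE_ne_zero (τ : ℍ) : EE τ ≠ 0 := by
  rw [EE_eq]; exact mul_ne_zero (pow_ne_zero _ (qq_ne_zero τ)) (V_ne_zero (norm_qq_lt τ))

lemma EE_smul (γ : SL(2, ℤ)) (h5 : (5 : ℤ) ∣ γ 1 0) (τ : ℍ) :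
    EE (γ • τ) = (γ 1 0 * τ + γ 1 1) ^ 48 * EE τ := by
  obtain ⟨c, hc⟩ := h5
  obtain ⟨γ', h00, h01, h10, h11, h⟩ := five_smul γ c hc
  have hd0 : (γ 1 0 * τ + γ 1 1 : ℂ) ≠ 0 := by
    have := denom_ne_zero γ τ
    simpa [denom] using this
  have hD := discriminant_ne_zero τ
  rw [EE, EE, h, Delta_smul, Delta_smul, h10, h11]
  rw [show ((c : ℂ) * (five τ : ℂ) + γ 1 1) = γ 1 0 * τ + γ 1 1 by rw [hc]; simp [five]; ring]
  field_simp

/-- `τ/5` -/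
noncomputable def fifth (τ : ℍ) : ℍ := ⟨(τ : ℂ) / 5, by
  have := τ.im_pos
  rw [show (τ : ℂ) / 5 = ((1 / 5 : ℝ) : ℂ) * τ by push_cast; ring, Complex.im_ofReal_mul]
  have h : 0 < (τ : ℂ).im := this
  positivity⟩

lemma EE_S (τ : ℍ) : EE (ModularGroup.S • τ) =
    τ ^ 48 * ((5 : ℂ) ^ 60)⁻¹ * (PS Set.univ (qq (fifth τ)) ^ 120 *
      (PS Set.univ (qq (fifth τ) ^ 5) ^ 24)⁻¹) := by
  have hτ := τ.ne_zero
  have e1 : five (ModularGroup.S • τ) = ModularGroup.S • fifth τ := by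
    ext1
    rw [UpperHalfPlane.modular_S_smul, UpperHalfPlane.modular_S_smul]
    simp only [five, fifth, UpperHalfPlane.coe_mk]
    field_simp
  have e2 : qq τ = qq (fifth τ) ^ 5 := by
    rw [qq, qq, ← exp_nat_mul]; congr 1; simp only [fifth, UpperHalfPlane.coe_mk]; push_cast; ring
  have hS0 : ModularGroup.S 1 0 = 1 := rfl
  have hS1 : ModularGroup.S 1 1 = 0 := rfl
  have h0 := qq_ne_zero (fifth τ)
  have h1 := PS_ne_zero Set.univ (pow5_lt (norm_qq_lt (fifth τ)))
  rw [EE, e1, Delta_smul, Delta_smul, Delta_eq τ, e2, Delta_eq, hS0, hS1]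
  have e3 : ((fifth τ : ℍ) : ℂ) = τ / 5 := rfl
  rw [e3]
  push_cast
  rw [one_mul, one_mul, add_zero, add_zero]
  field_simp

/-- elements of `SL(2,ℤ)` outside `Γ₀(5)` -/
lemma coset (γ : SL(2, ℤ)) (h : ¬ (5 : ℤ) ∣ γ 1 0) : ∃ (γ₀ : SL(2, ℤ)) (j : ℤ), (5 : ℤ) ∣ γ₀ 1 0 ∧
    γ = γ₀ * (ModularGroup.S * ModularGroup.T ^ j) := by
  have : ∃ j : ℤ, (5 : ℤ) ∣ γ 1 1 - j * γ 1 0 := by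
    have h1 : IsCoprime (γ 1 0) 5 :=
      ((Int.prime_iff_natAbs_prime.mpr (by norm_num) : Prime (5 : ℤ)).coprime_iff_not_dvd.mpr h).symm
    obtain ⟨u, v, huv⟩ := h1
    exact ⟨u * γ 1 1, v * γ 1 1, by linear_combination (-γ 1 1) * huv⟩
  obtain ⟨j, hj⟩ := this
  refine ⟨γ * (ModularGroup.S * ModularGroup.T ^ j)⁻¹, j, ?_, by rw [inv_mul_cancel_right]⟩
  have : (γ * (ModularGroup.S * ModularGroup.T ^ j)⁻¹) 1 0 = -(γ 1 1 - j * γ 1 0) := by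
    rw [mul_inv_rev, ← zpow_neg, ← mul_assoc]
    have e1 : (γ * ModularGroup.T ^ (-j)) 1 0 = γ 1 0 := by
      simp [Matrix.SpecialLinearGroup.coe_mul, Matrix.mul_apply, ModularGroup.coe_T_zpow]
    have e2 : (γ * ModularGroup.T ^ (-j)) 1 1 = γ 1 1 - j * γ 1 0 := by
      simp [Matrix.SpecialLinearGroup.coe_mul, Matrix.mul_apply, ModularGroup.coe_T_zpow]
      ring
    rw [← e2]
    generalize γ * ModularGroup.T ^ (-j) = g
    have : ((ModularGroup.S⁻¹ : SL(2, ℤ)) : Matrix (Fin 2) (Fin 2) ℤ) = !![0, 1; -1, 0] := by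
      rw [Matrix.SpecialLinearGroup.coe_inv, ModularGroup.coe_S, Matrix.adjugate_fin_two]
      simp
    simp [Matrix.SpecialLinearGroup.coe_mul, Matrix.mul_apply, this]
  rw [this]
  exact (dvd_neg).mpr hj

end RR

namespace RR
open Complex Filter Topology ModularForm
open UpperHalfPlane hiding I
open Matrix (SpecialLinearGroup)
open scoped MatrixGroups CongruenceSubgroup Manifold

local notation "π" => (Real.pi : ℂ)

theorem const_of (G : ℍ → ℂ) (hol : MDiff G)
   (hinv : ∀ γ : SL(2,ℤ), (5:ℤ) ∣ γ 1 0 → γ 0 0 % 5 = 1 → ∀ τ : ℍ, G (γ • τ) = G τ)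
   (hb : ∀ γ : SL(2,ℤ), IsBoundedAtImInfty (fun τ => G (γ • τ))) : ∃ c, ∀ τ, G τ = c := by
  let F : ModularForm ((CongruenceSubgroup.Gamma1 5).map (Matrix.SpecialLinearGroup.mapGL ℝ)) 0 :=
   { toFun := G
     slash_action_eq' := by
       intro g hg
       obtain ⟨γ, hγ, rfl⟩ := hg
       ext τ
       rw [SetLike.mem_coe, CongruenceSubgroup.Gamma1_mem] at hγ
       have := ModularForm.SL_slash_apply (f := G) (k := 0) γ τ
       rw [ModularForm.SL_slash] at this
       refine Eq.trans this ?_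
       rw [hinv γ]
       · simp
       · have := hγ.2.2
         rwa [ZMod.intCast_zmod_eq_zero_iff_dvd] at this
       · have := hγ.1
         have h1 : ((γ 0 0 : ℤ) : ZMod 5) = ((1 : ℤ) : ZMod 5) := by simpa using this
         rw [ZMod.intCast_eq_intCast_iff] at h1
         exact h1
     holo' := hol
     bdd_at_cusps' := by
       intro c hc
       rw [Subgroup.IsArithmetic.isCusp_iff_isCusp_SL2Z] at hc
       rw [OnePoint.isBoundedAt_iff_forall_SL2Z hc]
       intro γ _
       have : (G ∣[(0:ℤ)] γ) = (fun τ => G (γ • τ)) := by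
         ext τ; rw [ModularForm.SL_slash_apply]; simp
       rw [this]
       exact hb γ }
  obtain ⟨c, hc⟩ := ModularForm.eq_const_of_weight_zero F
  exact ⟨c, fun τ => congrFun hc τ⟩

/-- algebraic integers -/
abbrev AA : Subalgebra ℤ ℂ := integralClosure ℤ ℂ

/-- power series with algebraic integer coefficients -/
def ASer (F : ℂ → ℂ) : Prop := ∃ φ : PowerSeries ℂ, (∀ k, PowerSeries.coeff k φ ∈ AA) ∧ Ser φ F

lemma intCast_mem (n : ℤ) : (n : ℂ) ∈ AA := by
  have := AA.algebraMap_mem n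
  simpa using this

lemma IntSer.aser {F : ℂ → ℂ} (h : IntSer F) : ASer F := by
  obtain ⟨φ, hφ⟩ := h
  refine ⟨_, fun k => ?_, hφ⟩
  rw [PowerSeries.coeff_map]
  exact intCast_mem _

lemma ASer.add {F G : ℂ → ℂ} (h : ASer F) (h' : ASer G) : ASer (fun x => F x + G x) := by
  obtain ⟨φ, hφ, h1⟩ := h
  obtain ⟨ψ, hψ, h2⟩ := h'
  exact ⟨φ + ψ, fun k => by rw [map_add]; exact AA.add_mem (hφ k) (hψ k), h1.add h2⟩

lemma ASer.sub {F G : ℂ → ℂ} (h : ASer F) (h' : ASer G) : ASer (fun x => F x - G x) := by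
  obtain ⟨φ, hφ, h1⟩ := h
  obtain ⟨ψ, hψ, h2⟩ := h'
  exact ⟨φ - ψ, fun k => by rw [map_sub]; exact AA.sub_mem (hφ k) (hψ k), h1.sub h2⟩

lemma ASer.mul {F G : ℂ → ℂ} (h : ASer F) (h' : ASer G) : ASer (fun x => F x * G x) := by
  obtain ⟨φ, hφ, h1⟩ := h
  obtain ⟨ψ, hψ, h2⟩ := h'
  refine ⟨φ * ψ, fun k => ?_, h1.mul h2⟩
  rw [PowerSeries.coeff_mul]
  exact AA.sum_mem fun p _ => AA.mul_mem (hφ _) (hψ _)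

lemma ASer.const {a : ℂ} (ha : a ∈ AA) : ASer (fun _ => a) := by
  refine ⟨PowerSeries.C a, fun k => ?_, Ser.C a⟩
  rw [PowerSeries.coeff_C]
  split_ifs
  · exact ha
  · exact AA.zero_mem

lemma ASer.X_pow (n : ℕ) : ASer (fun x => x ^ n) := by
  refine ⟨PowerSeries.X ^ n, fun k => ?_, Ser.X_pow n⟩
  rw [PowerSeries.coeff_X_pow]
  split_ifs
  · exact AA.one_mem
  · exact AA.zero_mem

lemma ASer.pow {F : ℂ → ℂ} (h : ASer F) (n : ℕ) : ASer (fun x => F x ^ n) := by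
  induction n with
  | zero => simpa using ASer.const AA.one_mem
  | succ n ih => simpa only [pow_succ] using ih.mul h

/-- substitution `x ↦ ζ x^m` -/
lemma ASer.comp_scale {F : ℂ → ℂ} (h : ASer F) {ζ : ℂ} (hζ : ζ ∈ AA) (hζ1 : ‖ζ‖ = 1) {m : ℕ}
    (hm : m ≠ 0) : ASer (fun x => F (ζ * x ^ m)) := by
  obtain ⟨φ, hφ, h1⟩ := h
  refine ⟨PowerSeries.mk fun k => if m ∣ k then PowerSeries.coeff (k / m) φ * ζ ^ (k / m) else 0,
    fun k => ?_, fun x hx => ?_⟩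
  · rw [PowerSeries.coeff_mk]
    split_ifs
    · exact AA.mul_mem (hφ _) (AA.pow_mem hζ _)
    · exact AA.zero_mem
  · have hx' : ‖ζ * x ^ m‖ < 1 := by
      rw [norm_mul, hζ1, one_mul, norm_pow]
      exact pow_lt_one₀ (norm_nonneg _) hx hm
    have h2 := h1 _ hx'
    have hinj : Function.Injective (fun k : ℕ => m * k) := fun a b hab =>
      Nat.eq_of_mul_eq_mul_left (Nat.pos_of_ne_zero hm) hab
    rw [← hinj.hasSum_iff]
    · refine h2.congr_fun fun k => ?_
      simp only [Function.comp, PowerSeries.coeff_mk, dvd_mul_right, if_true,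
        Nat.mul_div_cancel_left k (Nat.pos_of_ne_zero hm)]
      rw [mul_pow, ← pow_mul]; ring
    · intro k hk
      rw [PowerSeries.coeff_mk, if_neg, zero_mul]
      rintro ⟨j, rfl⟩
      exact hk ⟨j, rfl⟩

lemma ASer.apply_zero_mem {F : ℂ → ℂ} (h : ASer F) : F 0 ∈ AA := by
  obtain ⟨φ, hφ, h1⟩ := h
  rw [h1.apply_zero]
  rw [← PowerSeries.coeff_zero_eq_constantCoeff_apply]
  exact hφ 0

/-- division by `x` -/
lemma ASer.div_X {F : ℂ → ℂ} (h : ASer F) (h0 : F 0 = 0) :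
    ∃ G, ASer G ∧ ∀ x : ℂ, ‖x‖ < 1 → F x = x * G x := by
  obtain ⟨φ, hφ, h1⟩ := h
  have hc : PowerSeries.coeff 0 φ = 0 := by
    rw [PowerSeries.coeff_zero_eq_constantCoeff_apply, ← h1.apply_zero, h0]
  have key : ∀ x : ℂ, ‖x‖ < 1 → HasSum (fun k => PowerSeries.coeff (k + 1) φ * x ^ k)
      (∑' k, PowerSeries.coeff (k + 1) φ * x ^ k) := by
    intro x hx
    refine Summable.hasSum ?_
    by_cases hx0 : x = 0
    · subst hx0
      refine summable_of_ne_finset_zero (s := {0}) fun k hk => ?_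
      rw [zero_pow (by simpa using hk), mul_zero]
    · have := ((h1 x hx).summable.comp_injective (Nat.succ_injective)).mul_left x⁻¹
      refine this.congr fun k => ?_
      simp only [Function.comp, Nat.succ_eq_add_one, pow_succ]
      field_simp
  refine ⟨fun x => ∑' k, PowerSeries.coeff (k + 1) φ * x ^ k,
    ⟨PowerSeries.mk fun k => PowerSeries.coeff (k + 1) φ, fun k => ?_, fun x hx => ?_⟩, fun x hx => ?_⟩
  · rw [PowerSeries.coeff_mk]; exact hφ _
  · simpa only [PowerSeries.coeff_mk] using key x hx
  · have e1 := (key x hx).mul_left x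
    have e2 := (hasSum_nat_add_iff' 1).mpr (h1 x hx)
    simp only [Finset.range_one, Finset.sum_singleton, hc, zero_mul, sub_zero] at e2
    refine e2.unique (e1.congr_fun fun k => ?_)
    rw [pow_succ]; ring

/-- The local parameter `e^{2πiτ/n}`. -/
noncomputable def tq (n : ℕ) (τ : ℍ) : ℂ := cexp (2 * π * I * τ / n)

lemma tq_ne_zero (n : ℕ) (τ : ℍ) : tq n τ ≠ 0 := exp_ne_zero _

lemma norm_tq (n : ℕ) (τ : ℍ) : ‖tq n τ‖ = Real.exp (-2 * Real.pi * τ.im / n) := by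
  unfold tq
  rw [Complex.norm_exp]
  congr 1
  rw [show 2 * π * I * (τ : ℂ) / n = ((1 / n : ℝ) : ℂ) * (2 * π * I * τ) by push_cast; ring,
    Complex.re_ofReal_mul]
  simp
  ring

lemma norm_tq_lt {n : ℕ} (hn : n ≠ 0) (τ : ℍ) : ‖tq n τ‖ < 1 := by
  rw [norm_tq, Real.exp_lt_one_iff]
  have h1 : 0 < Real.pi * τ.im := mul_pos Real.pi_pos τ.im_pos
  have h2 : (0 : ℝ) < n := by exact_mod_cast Nat.pos_of_ne_zero hn
  apply div_neg_of_neg_of_pos _ h2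
  nlinarith

lemma tq_one (τ : ℍ) : tq 1 τ = qq τ := by simp [tq, qq]

lemma tq_pow {n : ℕ} (hn : n ≠ 0) (τ : ℍ) : tq n τ ^ n = qq τ := by
  rw [tq, qq, ← exp_nat_mul]
  congr 1
  have : (n : ℂ) ≠ 0 := by exact_mod_cast hn
  field_simp

lemma tq_surj {n : ℕ} (hn : n ≠ 0) {x : ℂ} (hx : ‖x‖ < 1) (hx0 : x ≠ 0) : ∃ τ, tq n τ = x := by
  have hn' : (n : ℂ) ≠ 0 := by exact_mod_cast hn
  have hpi : π ≠ 0 := by exact_mod_cast Real.pi_ne_zero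
  have him : 0 < (n * log x / (2 * π * I)).im := by
    rw [show n * log x / (2 * π * I) = ((n / (2 * Real.pi) : ℝ) : ℂ) * (-(log x * I)) by
      push_cast; field_simp; rw [I_sq]; ring]
    rw [Complex.im_ofReal_mul]
    have h1 : (-(log x * I)).im = - Real.log ‖x‖ := by simp [log_re]
    rw [h1]
    have h2 := Real.log_neg (norm_pos_iff.mpr hx0) hx
    have h3 : (0 : ℝ) < n := by exact_mod_cast Nat.pos_of_ne_zero hn
    have := Real.pi_pos
    apply mul_pos (by positivity) (by linarith)
  refine ⟨⟨_, him⟩, ?_⟩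
  unfold tq
  rw [UpperHalfPlane.coe_mk, ← exp_log hx0]
  congr 1
  rw [exp_log hx0]
  field_simp

/-- Meromorphic expansions at infinity with algebraic integer coefficients. -/
def Exp (n m : ℕ) (c : ℂ) (G : ℍ → ℂ) : Prop :=
  ∃ F, ASer F ∧ F 0 = c ∧ ∀ τ, tq n τ ^ m * G τ = F (tq n τ)

lemma Exp.mono {n m : ℕ} {c : ℂ} {G : ℍ → ℂ} (h : Exp n m c G) (k : ℕ) :
    ∃ c', Exp n (m + k) c' G := by
  obtain ⟨F, hF, -, h⟩ := h
  refine ⟨_, fun x => x ^ k * F x, (ASer.X_pow k).mul hF, rfl, fun τ => ?_⟩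
  simp only
  rw [← h, pow_add]; ring

lemma Exp.mul {n m m' : ℕ} {c c' : ℂ} {G G' : ℍ → ℂ} (h : Exp n m c G) (h' : Exp n m' c' G') :
    Exp n (m + m') (c * c') (G * G') := by
  obtain ⟨F, hF, h0, h⟩ := h
  obtain ⟨F', hF', h0', h'⟩ := h'
  refine ⟨_, hF.mul hF', by rw [h0, h0'], fun τ => ?_⟩
  rw [← h, ← h', pow_add, Pi.mul_apply]; ring

lemma Exp.add {n m : ℕ} {c c' : ℂ} {G G' : ℍ → ℂ} (h : Exp n m c G) (h' : Exp n m c' G') :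
    Exp n m (c + c') (G + G') := by
  obtain ⟨F, hF, h0, h⟩ := h
  obtain ⟨F', hF', h0', h'⟩ := h'
  refine ⟨_, hF.add hF', by rw [h0, h0'], fun τ => ?_⟩
  rw [← h, ← h', Pi.add_apply]; ring

lemma Exp.sub {n m : ℕ} {c c' : ℂ} {G G' : ℍ → ℂ} (h : Exp n m c G) (h' : Exp n m c' G') :
    Exp n m (c - c') (G - G') := by
  obtain ⟨F, hF, h0, h⟩ := h
  obtain ⟨F', hF', h0', h'⟩ := h'
  refine ⟨_, hF.sub hF', by rw [h0, h0'], fun τ => ?_⟩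
  rw [← h, ← h', Pi.sub_apply]; ring

lemma Exp.const (n : ℕ) {c : ℂ} (hc : c ∈ AA) : Exp n 0 c (fun _ => c) :=
  ⟨_, ASer.const hc, rfl, fun τ => by simp⟩

lemma Exp.mem {n m : ℕ} {c : ℂ} {G : ℍ → ℂ} (h : Exp n m c G) : c ∈ AA := by
  obtain ⟨F, hF, rfl, -⟩ := h
  exact hF.apply_zero_mem

/-- if the leading coefficient vanishes the order drops -/
lemma Exp.drop {n m : ℕ} (hn : n ≠ 0) {G : ℍ → ℂ} (h : Exp n (m + 1) 0 G) : ∃ c, Exp n m c G := by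
  obtain ⟨F, hF, h0, h⟩ := h
  obtain ⟨F', hF', h'⟩ := hF.div_X h0
  refine ⟨_, F', hF', rfl, fun τ => ?_⟩
  have := h τ
  rw [h' _ (norm_tq_lt hn τ), pow_succ] at this
  apply mul_left_cancel₀ (tq_ne_zero n τ)
  rw [← this]; ring

/-- Uniqueness. -/
lemma eq_of_tq {n : ℕ} (hn : n ≠ 0) {φ ψ : PowerSeries ℂ} {F F' : ℂ → ℂ} (h : Ser φ F) (h' : Ser ψ F')
    (he : ∀ τ, F (tq n τ) = F' (tq n τ)) : φ = ψ := by
  refine h.unique (h'.congr ?_)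
  have hc1 := h.differentiableOn.continuousOn
  have hc2 := h'.differentiableOn.continuousOn
  have h1 : ∀ x : ℂ, ‖x‖ < 1 → x ≠ 0 → F' x = F x := by
    intro x hx hx0
    obtain ⟨τ, rfl⟩ := tq_surj hn hx hx0
    exact (he τ).symm
  intro x hx
  by_cases hx0 : x = 0
  · subst hx0
    have m0 : Metric.ball (0 : ℂ) 1 ∈ 𝓝 (0 : ℂ) := Metric.ball_mem_nhds _ one_pos
    have t1 := ((hc1.continuousAt m0).tendsto).mono_left (nhdsWithin_le_nhds (s := {0}ᶜ))
    have t2 := ((hc2.continuousAt m0).tendsto).mono_left (nhdsWithin_le_nhds (s := {0}ᶜ))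
    refine tendsto_nhds_unique (t2.congr' ?_) t1
    filter_upwards [self_mem_nhdsWithin, mem_nhdsWithin_of_mem_nhds m0] with y hy hy1
    exact h1 y (by simpa using hy1) hy
  · exact h1 x hx hx0

lemma Exp.isBounded {n : ℕ} (hn : n ≠ 0) {c : ℂ} {G : ℍ → ℂ} (h : Exp n 0 c G) :
    IsBoundedAtImInfty G := by
  obtain ⟨F, ⟨φ, -, hF⟩, -, h⟩ := h
  have hc1 := hF.differentiableOn.continuousOn
  have m0 : Metric.ball (0 : ℂ) 1 ∈ 𝓝 (0 : ℂ) := Metric.ball_mem_nhds _ one_pos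
  have h2 := (hc1.continuousAt m0)
  have h3 : ∀ᶠ x in 𝓝 (0 : ℂ), ‖F x‖ < ‖F 0‖ + 1 :=
    h2.norm.eventually (gt_mem_nhds (by linarith))
  rw [Metric.eventually_nhds_iff] at h3
  obtain ⟨ε, hε, h3⟩ := h3
  rw [UpperHalfPlane.isBoundedAtImInfty_iff]
  have hn' : (0 : ℝ) < n := by exact_mod_cast Nat.pos_of_ne_zero hn
  refine ⟨‖F 0‖ + 1, (-Real.log ε + 1) * n / (2 * Real.pi), fun τ hτ => ?_⟩
  have h4 : G τ = F (tq n τ) := by simpa using h τ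
  rw [h4]
  refine (h3 ?_).le
  rw [dist_zero_right, norm_tq, ← Real.lt_log_iff_exp_lt hε]
  have := Real.pi_pos
  rw [div_le_iff₀ (by positivity)] at hτ
  rw [div_lt_iff₀ hn']
  nlinarith

lemma Exp.mdiff {n m : ℕ} (hn : n ≠ 0) {c : ℂ} {G : ℍ → ℂ} (h : Exp n m c G) : MDiff G := by
  obtain ⟨F, ⟨φ, -, hF⟩, -, h⟩ := h
  rw [UpperHalfPlane.mdifferentiable_iff]
  have hd := hF.differentiableOn
  have : DifferentiableOn ℂ (fun z : ℂ => F (cexp (2 * π * I * z / n)) * (cexp (2 * π * I * z / n) ^ m)⁻¹)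
      {z | 0 < z.im} := by
    refine DifferentiableOn.mul ?_ ?_
    · refine hd.comp (t := Metric.ball 0 1) (f := fun z : ℂ => cexp (2 * π * I * z / n)) ?_ ?_
      · fun_prop
      · intro z hz
        have := norm_tq_lt hn ⟨z, hz⟩
        simpa [tq] using this
    · refine DifferentiableOn.inv ?_ ?_
      · fun_prop
      · intro z _; exact pow_ne_zero _ (exp_ne_zero _)
  refine this.congr fun z hz => ?_
  simp only [Function.comp]
  rw [ofComplex_apply_of_im_pos hz]
  have h2 := h ⟨z, hz⟩
  have h3 := pow_ne_zero m (tq_ne_zero n ⟨z, hz⟩)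
  rw [eq_mul_inv_iff_mul_eq₀ (by simpa [tq] using h3)]
  rw [mul_comm]
  simpa [tq] using h2

end RR

namespace RR
open Complex Filter Topology ModularForm
open UpperHalfPlane hiding I
open Matrix (SpecialLinearGroup)
open scoped MatrixGroups CongruenceSubgroup Manifold

local notation "π" => (Real.pi : ℂ)

lemma Exp.mono' {n m : ℕ} {c : ℂ} {G : ℍ → ℂ} (h : Exp n m c G) (k : ℕ) :
    Exp n (m + k) (if k = 0 then c else 0) G := by
  obtain ⟨F, hF, h0, h⟩ := h
  refine ⟨fun x => x ^ k * F x, (ASer.X_pow k).mul hF, ?_, fun τ => ?_⟩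
  · split_ifs with hk
    · simp [hk, h0]
    · simp [hk]
  simp only
  rw [← h, pow_add]; ring

lemma Exp.congr {n m : ℕ} {c : ℂ} {G G' : ℍ → ℂ} (h : Exp n m c G) (he : ∀ τ, G' τ = G τ) :
    Exp n m c G' := by
  have : G' = G := funext he
  rwa [this]

lemma Exp.level {m : ℕ} {c : ℂ} {G : ℍ → ℂ} (h : Exp 1 m c G) {n : ℕ} (hn : n ≠ 0) :
    Exp n (n * m) c G := by
  obtain ⟨F, hF, h0, h⟩ := h
  refine ⟨_, hF.comp_scale AA.one_mem (by simp) hn, by simp [hn, h0], fun τ => ?_⟩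
  rw [one_mul, tq_pow hn, ← tq_one, ← h, pow_mul, tq_pow hn, tq_one]

lemma coe_T_smul (τ : ℍ) : ((ModularGroup.T • τ : ℍ) : ℂ) = τ + 1 := by
  rw [coe_smul]
  simp [ModularGroup.T]

lemma Exp.descend {n m : ℕ} (hn : n ≠ 0) {c : ℂ} {G : ℍ → ℂ} (h : Exp n m c G)
    (hT : ∀ τ : ℍ, G (ModularGroup.T • τ) = G τ) :
    (c ≠ 0 → n ∣ m) ∧ ∀ m', m = n * m' → Exp 1 m' c G := by
  obtain ⟨F, ⟨φ, hφ, hF⟩, h0, h⟩ := h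
  set ζ : ℂ := cexp (2 * π * I / n) with hζ
  have hprim : IsPrimitiveRoot ζ n := Complex.isPrimitiveRoot_exp n hn
  have hζn : ‖ζ‖ = 1 := hprim.norm'_eq_one hn
  have htT : ∀ τ : ℍ, tq n (ModularGroup.T • τ) = ζ * tq n τ := by
    intro τ
    rw [tq, coe_T_smul, tq, hζ, ← exp_add]; congr 1; ring
  have s1 : Ser (PowerSeries.mk fun k => PowerSeries.coeff k φ * ζ ^ k) (fun x => F (ζ * x)) := by
    intro x hx
    have := hF (ζ * x) (by rw [norm_mul, hζn, one_mul]; exact hx)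
    refine this.congr_fun fun k => ?_
    rw [PowerSeries.coeff_mk, mul_pow]; ring
  have s2 : Ser (PowerSeries.C (ζ ^ m) * φ) (fun x => ζ ^ m * F x) := (Ser.C _).mul hF
  have heq := eq_of_tq hn s1 s2 (fun τ => by
    rw [← htT, ← h, ← h, hT, htT]; ring)
  have hco : ∀ k, PowerSeries.coeff k φ * ζ ^ k = ζ ^ m * PowerSeries.coeff k φ := by
    intro k
    have := congrArg (PowerSeries.coeff k) heq
    rwa [PowerSeries.coeff_mk, PowerSeries.coeff_C_mul] at this
  constructor
  · intro hc
    have h1 := hco 0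
    rw [PowerSeries.coeff_zero_eq_constantCoeff_apply, ← hF.apply_zero, h0, pow_zero, mul_one] at h1
    apply hprim.dvd_of_pow_eq_one
    apply mul_right_cancel₀ hc
    rw [← h1, one_mul]
  · rintro m' rfl
    have hz : ∀ k, ¬ n ∣ k → PowerSeries.coeff k φ = 0 := by
      intro k hk
      by_contra hne
      apply hk
      apply hprim.dvd_of_pow_eq_one
      have h1 := hco k
      rw [pow_mul, hprim.pow_eq_one, one_pow, one_mul] at h1
      exact mul_left_cancel₀ hne (by rw [h1, mul_one])
    have hinj : Function.Injective (fun k : ℕ => n * k) := fun a b hab =>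
      Nat.eq_of_mul_eq_mul_left (Nat.pos_of_ne_zero hn) hab
    have key : ∀ t : ℂ, ‖t‖ < 1 → HasSum (fun k => PowerSeries.coeff (n * k) φ * (t ^ n) ^ k) (F t) := by
      intro t ht
      have h1 := hF t ht
      rw [← hinj.hasSum_iff] at h1
      · refine h1.congr_fun fun k => ?_
        simp only [Function.comp]
        rw [pow_mul]
      · intro k hk
        rw [hz, zero_mul]
        rintro ⟨j, rfl⟩
        exact hk ⟨j, rfl⟩
    have hsum : ∀ x : ℂ, ‖x‖ < 1 → HasSum (fun k => PowerSeries.coeff (n * k) φ * x ^ k)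
        (∑' k, PowerSeries.coeff (n * k) φ * x ^ k) := by
      intro x hx
      obtain ⟨t, ht⟩ := IsAlgClosed.exists_pow_nat_eq x (Nat.pos_of_ne_zero hn)
      have ht1 : ‖t‖ < 1 := by
        by_contra hcon
        push Not at hcon
        have : 1 ≤ ‖t‖ ^ n := one_le_pow₀ hcon
        rw [← norm_pow, ht] at this
        linarith
      rw [← ht]
      exact (key t ht1).summable.hasSum
    refine ⟨fun x => ∑' k, PowerSeries.coeff (n * k) φ * x ^ k,
      ⟨PowerSeries.mk fun k => PowerSeries.coeff (n * k) φ, fun k => ?_, fun x hx => ?_⟩, ?_, fun τ => ?_⟩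
    · rw [PowerSeries.coeff_mk]; exact hφ _
    · simpa only [PowerSeries.coeff_mk] using hsum x hx
    · have h1 := key 0 (by simp)
      rw [zero_pow hn] at h1
      simp only
      rw [h1.tsum_eq, h0]
    · have h1 := key (tq n τ) (norm_tq_lt hn τ)
      rw [tq_pow hn] at h1
      simp only [tq_one]
      rw [h1.tsum_eq, ← h, pow_mul, tq_pow hn]

lemma Exp.const_eq {c c₀ : ℂ} {G : ℍ → ℂ} (h : Exp 1 0 c G) (hG : ∀ τ, G τ = c₀) : c = c₀ := by
  obtain ⟨F, ⟨φ, hφ, hF⟩, h0, h⟩ := h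
  have := eq_of_tq one_ne_zero hF (Ser.C c₀) (fun τ => by rw [← h, hG]; simp)
  rw [← h0, hF.apply_zero, this]
  simp

/-- A diamond representative. -/
def sig : SL(2, ℤ) := mkSL 2 1 5 3 (by norm_num)

lemma f_sig (τ : ℍ) : f (sig • τ) = -(f τ)⁻¹ := by
  rw [f_smul _ (by simp [sig])]
  simp [dia, sig]

lemma f_exp : Exp 1 0 0 f := by
  refine ⟨_, (ASer.X_pow 1).mul U_intSer.aser, by simp, fun τ => ?_⟩
  rw [tq_one]; simp [f]

lemma finv_exp : Exp 1 1 1 (fun τ => (f τ)⁻¹) := by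
  refine ⟨_, Uinv_intSer.aser, by simp [U_zero], fun τ => ?_⟩
  have := qq_ne_zero τ
  rw [tq_one]; simp only [f]; field_simp

lemma Exp.pow {n m : ℕ} {c : ℂ} {G : ℍ → ℂ} (h : Exp n m c G) (k : ℕ) :
    Exp n (k * m) (c ^ k) (fun τ => G τ ^ k) := by
  induction k with
  | zero => simpa using Exp.const n AA.one_mem
  | succ k ih =>
    have := ih.mul h
    rw [← Nat.succ_mul] at this
    rw [pow_succ]
    exact this.congr fun τ => by simp [pow_succ]

lemma Exp.smul {n m : ℕ} {c a : ℂ} {G : ℍ → ℂ} (ha : a ∈ AA) (h : Exp n m c G) :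
    Exp n m (a * c) (fun τ => a * G τ) := by
  have := (Exp.const n ha).mul h
  rw [zero_add] at this
  exact this.congr fun τ => rfl

lemma bounded_iff_comp {G : ℍ → ℂ} {γ : SL(2, ℤ)} :
    IsBoundedAtImInfty (fun τ => G (γ • τ)) ↔ ∃ M A : ℝ, ∀ τ : ℍ, A ≤ τ.im → ‖G (γ • τ)‖ ≤ M :=
  UpperHalfPlane.isBoundedAtImInfty_iff

lemma bounded_f_S : ∃ A : ℝ, ∀ τ : ℍ, A ≤ τ.im →
    (11 / 100000 : ℝ) ≤ ‖f (ModularGroup.S • τ)‖ ∧ ‖f (ModularGroup.S • τ)‖ ≤ 9000 := by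
  refine ⟨2, fun τ hτ => f_S_bounds τ ?_⟩
  have h := norm_tq 5 τ
  rw [tq] at h
  rw [show 2 * π * I * ((τ : ℂ) / 5) = 2 * π * I * τ / (5 : ℕ) by push_cast; ring, h]
  have h3 := Real.pi_gt_three
  have : -2 * Real.pi * τ.im / (5 : ℕ) ≤ -2 := by
    rw [div_le_iff₀ (by norm_num)]
    push_cast
    nlinarith
  calc Real.exp (-2 * Real.pi * τ.im / (5 : ℕ)) ≤ Real.exp (-2) := Real.exp_le_exp.mpr this
    _ ≤ 337 / 1000 := by
      rw [Real.exp_neg, inv_le_comm₀ (Real.exp_pos _) (by norm_num)]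
      have h1 := Real.add_one_le_exp 2
      have h2 := Real.exp_one_gt_d9
      rw [show (2 : ℝ) = 1 + 1 by norm_num, Real.exp_add]
      nlinarith

lemma im_T_zpow (j : ℤ) (τ : ℍ) : (ModularGroup.T ^ j • τ).im = τ.im := by
  rw [UpperHalfPlane.modular_T_zpow_smul]; simp

lemma det_eq (γ : SL(2, ℤ)) : γ 0 0 * γ 1 1 - γ 0 1 * γ 1 0 = 1 := by
  have hd := Matrix.SpecialLinearGroup.det_coe γ
  rwa [Matrix.det_fin_two] at hd

lemma norm_dia_bounds {x : ℂ} (α : ℤ) (h : (11 / 100000 : ℝ) ≤ ‖x‖ ∧ ‖x‖ ≤ 9000) :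
    (11 / 100000 : ℝ) ≤ ‖dia α x‖ ∧ ‖dia α x‖ ≤ 100000 / 11 := by
  unfold dia
  split_ifs
  · exact ⟨h.1, h.2.trans (by norm_num)⟩
  · have h0 : 0 < ‖x‖ := lt_of_lt_of_le (by norm_num) h.1
    rw [norm_neg, norm_inv]
    constructor
    · rw [le_inv_comm₀ (by norm_num) h0]; exact h.2.trans (by norm_num)
    · rw [inv_le_comm₀ h0 (by norm_num)]; refine le_trans (by norm_num) h.1

/-- bounds for `f` at the cusps equivalent to `0` -/
lemma f_cusp (γ : SL(2, ℤ)) (h : ¬ (5 : ℤ) ∣ γ 1 0) : ∃ A : ℝ, ∀ τ : ℍ, A ≤ τ.im →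
    (11 / 100000 : ℝ) ≤ ‖f (γ • τ)‖ ∧ ‖f (γ • τ)‖ ≤ 100000 / 11 := by
  obtain ⟨γ₀, j, h0, rfl⟩ := coset γ h
  obtain ⟨A, hA⟩ := bounded_f_S
  refine ⟨A, fun τ hτ => ?_⟩
  rw [mul_smul, f_smul _ h0, mul_smul]
  exact norm_dia_bounds _ (hA _ (by rwa [im_T_zpow]))

end RR

namespace RR
open Complex Filter Topology ModularForm
open UpperHalfPlane hiding I
open Matrix (SpecialLinearGroup)
open scoped MatrixGroups CongruenceSubgroup Manifold

local notation "π" => (Real.pi : ℂ)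

/-- invariance under Gamma1(5) -/
def Inv1 (G : ℍ → ℂ) : Prop :=
  ∀ γ : SL(2,ℤ), (5:ℤ) ∣ γ 1 0 → γ 0 0 % 5 = 1 → ∀ τ : ℍ, G (γ • τ) = G τ

/-- boundedness at the cusps equivalent to zero -/
def Bd0 (G : ℍ → ℂ) : Prop :=
  ∀ γ : SL(2,ℤ), ¬ (5:ℤ) ∣ γ 1 0 → IsBoundedAtImInfty (fun τ => G (γ • τ))

lemma mul_00 (γ δ : SL(2,ℤ)) : (γ * δ) 0 0 = γ 0 0 * δ 0 0 + γ 0 1 * δ 1 0 := by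
  rw [Matrix.SpecialLinearGroup.coe_mul, Matrix.mul_apply, Fin.sum_univ_two]
lemma mul_10 (γ δ : SL(2,ℤ)) : (γ * δ) 1 0 = γ 1 0 * δ 0 0 + γ 1 1 * δ 1 0 := by
  rw [Matrix.SpecialLinearGroup.coe_mul, Matrix.mul_apply, Fin.sum_univ_two]
lemma mul_01 (γ δ : SL(2,ℤ)) : (γ * δ) 0 1 = γ 0 0 * δ 0 1 + γ 0 1 * δ 1 1 := by
  rw [Matrix.SpecialLinearGroup.coe_mul, Matrix.mul_apply, Fin.sum_univ_two]
lemma mul_11 (γ δ : SL(2,ℤ)) : (γ * δ) 1 1 = γ 1 0 * δ 0 1 + γ 1 1 * δ 1 1 := by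
  rw [Matrix.SpecialLinearGroup.coe_mul, Matrix.mul_apply, Fin.sum_univ_two]

lemma unit_mod5 (γ : SL(2,ℤ)) (h : (5:ℤ) ∣ γ 1 0) : γ 0 0 % 5 = 1 ∨ γ 0 0 % 5 = 2 ∨ γ 0 0 % 5 = 3 ∨ γ 0 0 % 5 = 4 := by
  have hd := det_eq γ
  obtain ⟨k, hk⟩ := h
  have h0 : γ 0 0 % 5 ≠ 0 := by
    intro h0
    have : (5:ℤ) ∣ 1 := by
      rw [← hd, hk]
      exact dvd_sub (Dvd.dvd.mul_right (Int.dvd_of_emod_eq_zero h0) _) ⟨γ 0 1 * k, by ring⟩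
    norm_num at this
  omega

lemma neg_Gamma (γ : SL(2,ℤ)) (h : (5:ℤ) ∣ γ 1 0) (h' : γ 0 0 % 5 = 1 ∨ γ 0 0 % 5 = 4) :
    ∃ δ : SL(2,ℤ), (5:ℤ) ∣ δ 1 0 ∧ δ 0 0 % 5 = 1 ∧ ∀ τ : ℍ, γ • τ = δ • τ := by
  rcases h' with h' | h'
  · exact ⟨γ, h, h', fun _ => rfl⟩
  · refine ⟨-γ, ?_, ?_, fun τ => (ModularGroup.SL_neg_smul γ τ).symm⟩
    · simpa using h
    · simp only [Matrix.SpecialLinearGroup.coe_neg, Matrix.neg_apply]; omega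

lemma red (γ : SL(2,ℤ)) (h : (5:ℤ) ∣ γ 1 0) :
    ∃ δ : SL(2,ℤ), (5:ℤ) ∣ δ 1 0 ∧ δ 0 0 % 5 = 1 ∧
      ((∀ τ : ℍ, γ • τ = δ • τ) ∨ (∀ τ : ℍ, γ • τ = δ • sig • τ)) := by
  by_cases h' : γ 0 0 % 5 = 1 ∨ γ 0 0 % 5 = 4
  · obtain ⟨δ, h1, h2, h3⟩ := neg_Gamma γ h h'
    exact ⟨δ, h1, h2, Or.inl h3⟩
  · have hu := unit_mod5 γ h
    have hs : γ * sig⁻¹ = γ * mkSL 3 (-1) (-5) 2 (by norm_num) := by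
      congr 1
      rw [inv_eq_iff_mul_eq_one]
      apply Subtype.ext
      rw [Matrix.SpecialLinearGroup.coe_mul]
      ext i j; fin_cases i <;> fin_cases j <;> simp [sig, Matrix.mul_apply, Fin.sum_univ_two]
    obtain ⟨δ, h1, h2, h3⟩ := neg_Gamma (γ * sig⁻¹) (by
        rw [hs, mul_10]; simp only [mkSL_00, mkSL_10]; omega) (by
        rw [hs, mul_00]; simp only [mkSL_00, mkSL_10]; omega)
    refine ⟨δ, h1, h2, Or.inr fun τ => ?_⟩
    rw [← h3, smul_smul]; simp

lemma Inv1.f : Inv1 f := by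
  intro γ h h' τ
  rw [f_smul γ h, dia, if_pos (Or.inl h')]

lemma Bd0.const (c : ℂ) : Bd0 (fun _ => c) := fun _ _ => Filter.const_boundedAtFilter _ c

lemma Bd0.add {G H : ℍ → ℂ} (h : Bd0 G) (h' : Bd0 H) : Bd0 (G + H) := fun γ hγ => (h γ hγ).add (h' γ hγ)
lemma Bd0.mul {G H : ℍ → ℂ} (h : Bd0 G) (h' : Bd0 H) : Bd0 (G * H) := fun γ hγ => (h γ hγ).mul (h' γ hγ)
lemma Bd0.smul {G : ℍ → ℂ} (c : ℂ) (h : Bd0 G) : Bd0 (fun τ => c * G τ) := (Bd0.const c).mul h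
lemma Bd0.sub {G H : ℍ → ℂ} (h : Bd0 G) (h' : Bd0 H) : Bd0 (G - H) := by
  have := h.add (h'.smul (-1))
  convert this using 1
  ext; simp; ring
lemma Bd0.pow {G : ℍ → ℂ} (h : Bd0 G) (k : ℕ) : Bd0 (fun τ => G τ ^ k) := by
  induction k with
  | zero => simpa using Bd0.const 1
  | succ k ih =>
    have := ih.mul h
    convert this using 1
    ext; simp [pow_succ]

lemma Bd0.f : Bd0 f := by
  intro γ h
  obtain ⟨A, hA⟩ := f_cusp γ h
  exact bounded_iff_comp.mpr ⟨_, A, fun τ hτ => (hA τ hτ).2⟩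

lemma Bd0.finv : Bd0 (fun τ => (RR.f τ)⁻¹) := by
  intro γ h
  obtain ⟨A, hA⟩ := f_cusp γ h
  refine (bounded_iff_comp (G := fun τ => (RR.f τ)⁻¹)).mpr ⟨100000 / 11, A, fun τ hτ => ?_⟩
  have h1 := (hA τ hτ).1
  rw [norm_inv, inv_le_comm₀ (lt_of_lt_of_le (by norm_num) h1) (by norm_num)]
  exact le_trans (by norm_num) h1

lemma negf_exp (k : ℕ) (m : ℕ) : Exp 1 m 0 (fun τ => (-f τ) ^ (k + 1)) := by
  have h : Exp 1 0 0 (fun τ => - f τ) := by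
    have := Exp.smul (a := -1) (AA.neg_mem AA.one_mem) f_exp
    simp only [mul_zero] at this
    exact this.congr fun τ => by ring
  have h2 := (h.pow (k + 1)).mono' m
  simpa using h2

theorem principle_aux (m : ℕ) : ∀ (m' : ℕ) (c c' : ℂ) (G : ℍ → ℂ), Inv1 G → Bd0 G → Exp 1 m c G →
    Exp 1 m' c' (fun τ => G (sig • τ)) →
    ∃ p : Polynomial AA, (∀ τ, f τ ^ m * G τ = Polynomial.aeval (f τ) p) ∧ p.natDegree ≤ m + m' ∧
      (1 ≤ m → (p.coeff 0 : ℂ) = c) ∧ (1 ≤ m' → (p.coeff (m + m') : ℂ) = (-1) ^ m' * c') := by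
  induction m with
  | zero =>
    intro m'
    induction m' with
    | zero =>
      intro c c' G hi hb h h'
      obtain ⟨c₀, hc₀⟩ := const_of G (h.mdiff one_ne_zero) hi (by
        intro γ
        by_cases hγ : (5:ℤ) ∣ γ 1 0
        · obtain ⟨δ, h1, h2, h3 | h3⟩ := red γ hγ
          · simp only [h3, hi δ h1 h2]; exact h.isBounded one_ne_zero
          · simp only [h3, hi δ h1 h2]; exact h'.isBounded one_ne_zero
        · exact hb γ hγ)
      have hc := h.const_eq hc₀
      refine ⟨Polynomial.C ⟨c, h.mem⟩, fun τ => ?_, by simp, by simp, by simp⟩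
      rw [Polynomial.aeval_C, hc₀, ← hc]; simp
    | succ k ih =>
      intro c c' G hi hb h h'
      have e1 : Exp 1 0 c (G - fun τ => c' * (-f τ) ^ (k + 1)) := by
        have := h.sub ((negf_exp k 0).smul h'.mem)
        simpa using this
      have e2 : Exp 1 (k + 1) 0 (fun τ => (G - fun τ => c' * (-f τ) ^ (k + 1)) (sig • τ)) := by
        have h5 := (finv_exp.pow (k + 1)).smul h'.mem
        simp only [mul_one, one_pow] at h5
        have := h'.sub h5
        rw [sub_self] at this
        refine this.congr fun τ => ?_
        simp only [Pi.sub_apply]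
        rw [f_sig, neg_neg]
      obtain ⟨c'', e3⟩ := e2.drop one_ne_zero
      obtain ⟨p, hp, hd, -, -⟩ := ih _ _ _ (by
          intro γ h1 h2 τ
          simp only [Pi.sub_apply]
          rw [hi γ h1 h2, Inv1.f γ h1 h2]) (hb.sub (Bd0.smul c' (by
            have := (Bd0.f.smul (-1)).pow (k + 1)
            simpa using this))) e1 e3
      refine ⟨p + Polynomial.C (⟨(-1) ^ (k + 1) * c', AA.mul_mem (AA.pow_mem (AA.neg_mem AA.one_mem) _) h'.mem⟩) *
        Polynomial.X ^ (k + 1), fun τ => ?_, ?_, by simp, fun _ => ?_⟩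
      · have := hp τ
        rw [map_add, ← this, map_mul, Polynomial.aeval_C, map_pow, Polynomial.aeval_X]
        have h6 : (algebraMap AA ℂ) ⟨(-1) ^ (k + 1) * c', AA.mul_mem (AA.pow_mem (AA.neg_mem AA.one_mem) _) h'.mem⟩ = (-1) ^ (k + 1) * c' := rfl
        rw [h6]
        simp only [Pi.sub_apply]
        rw [neg_pow (f τ)]; ring
      · refine (Polynomial.natDegree_add_le _ _).trans (max_le (hd.trans (by omega)) ?_)
        refine (Polynomial.natDegree_C_mul_X_pow_le _ _).trans (by omega)
      · rw [Polynomial.coeff_add, Polynomial.coeff_eq_zero_of_natDegree_lt (by omega), zero_add,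
          zero_add, Polynomial.coeff_C_mul, Polynomial.coeff_X_pow_self, mul_one]
  | succ m ih =>
    intro m' c c' G hi hb h h'
    have e1 : Exp 1 (m + 1) 0 (G - fun τ => c * (f τ)⁻¹ ^ (m + 1)) := by
      have h5 := (finv_exp.pow (m + 1)).smul h.mem
      simp only [mul_one, one_pow] at h5
      have := h.sub h5
      rwa [sub_self] at this
    have e2 : Exp 1 m' c' (fun τ => (G - fun τ => c * (f τ)⁻¹ ^ (m + 1)) (sig • τ)) := by
      have := h'.sub ((negf_exp m m').smul h.mem)
      simp only [mul_zero, sub_zero] at this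
      refine this.congr fun τ => ?_
      simp only [Pi.sub_apply]
      rw [f_sig, inv_neg, inv_inv]
    obtain ⟨c'', e3⟩ := e1.drop one_ne_zero
    obtain ⟨p, hp, hd, -, h4⟩ := ih _ _ _ _ (by
          intro γ h1 h2 τ
          simp only [Pi.sub_apply]
          rw [hi γ h1 h2, Inv1.f γ h1 h2]) (hb.sub (Bd0.smul c (Bd0.finv.pow (m + 1)))) e3 e2
    refine ⟨Polynomial.X * p + Polynomial.C ⟨c, h.mem⟩, fun τ => ?_, ?_, fun _ => by simp, fun hm => ?_⟩
    · have := hp τ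
      rw [map_add, map_mul, ← this, Polynomial.aeval_C, Polynomial.aeval_X]
      have h6 : (algebraMap AA ℂ) ⟨c, h.mem⟩ = c := rfl
      rw [h6]
      simp only [Pi.sub_apply]
      have := f_ne_zero τ
      rw [inv_pow]
      field_simp; ring
    · refine (Polynomial.natDegree_add_le _ _).trans (max_le ?_ (by simp))
      refine (Polynomial.natDegree_mul_le).trans ?_
      have := Polynomial.natDegree_X_le (R := AA)
      omega
    · rw [show m + 1 + m' = (m + m') + 1 by ring, Polynomial.coeff_add, Polynomial.coeff_X_mul, Polynomial.coeff_C_succ, add_zero, h4 hm]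

end RR

namespace RR
open Complex Filter Topology ModularForm
open UpperHalfPlane hiding I
open Matrix (SpecialLinearGroup)
open scoped MatrixGroups CongruenceSubgroup Manifold

local notation "π" => (Real.pi : ℂ)

lemma Exp.add' {n m m' : ℕ} {c c' : ℂ} {G G' : ℍ → ℂ} (h : Exp n m c G) (h' : Exp n m' c' G') :
    ∃ m'' c'', Exp n m'' c'' (G + G') := by
  obtain ⟨d, h1⟩ := h.mono m'
  obtain ⟨d', h1'⟩ := h'.mono m
  rw [add_comm m' m] at h1'
  exact ⟨_, _, h1.add h1'⟩

/-- functions with algebraic integer expansions at the cusps over infinity, bounded at the other cusps -/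
noncomputable def Good (n : ℕ) : Subalgebra AA (ℍ → ℂ) where
  carrier := {G | (∀ γ : SL(2,ℤ), (5:ℤ) ∣ γ 1 0 → ∃ m c, Exp n m c (fun τ => G (γ • τ))) ∧ Bd0 G}
  add_mem' := by
    rintro G H ⟨h1, h2⟩ ⟨h1', h2'⟩
    refine ⟨fun γ hγ => ?_, h2.add h2'⟩
    obtain ⟨m, c, h⟩ := h1 γ hγ
    obtain ⟨m', c', h'⟩ := h1' γ hγ
    exact h.add' h'
  mul_mem' := by
    rintro G H ⟨h1, h2⟩ ⟨h1', h2'⟩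
    refine ⟨fun γ hγ => ?_, h2.mul h2'⟩
    obtain ⟨m, c, h⟩ := h1 γ hγ
    obtain ⟨m', c', h'⟩ := h1' γ hγ
    exact ⟨_, _, h.mul h'⟩
  algebraMap_mem' := by
    intro r
    exact ⟨fun γ hγ => ⟨0, _, Exp.const n r.2⟩, Bd0.const _⟩

lemma Exp.descend' {n m : ℕ} (hn : n ≠ 0) {c : ℂ} {G : ℍ → ℂ} (h : Exp n m c G)
    (hT : ∀ τ : ℍ, G (ModularGroup.T • τ) = G τ) : ∃ m' c', Exp 1 m' c' G := by
  obtain ⟨c', h'⟩ := h.mono ((n - 1) * m)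
  refine ⟨m, c', (h'.descend hn hT).2 m ?_⟩
  obtain ⟨k, rfl⟩ := Nat.exists_eq_succ_of_ne_zero hn
  simp; ring

lemma Inv1.T {G : ℍ → ℂ} (h : Inv1 G) (τ : ℍ) : G (ModularGroup.T • τ) = G τ :=
  h _ (by simp [ModularGroup.T]) (by simp [ModularGroup.T]) τ

lemma sig_T (τ : ℍ) : sig • ModularGroup.T • τ = mkSL (-9) 4 (-25) 11 (by norm_num) • sig • τ := by
  rw [smul_smul, smul_smul]
  congr 1
  apply Subtype.ext
  rw [Matrix.SpecialLinearGroup.coe_mul, Matrix.SpecialLinearGroup.coe_mul]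
  ext i j; fin_cases i <;> fin_cases j <;> simp [sig, Matrix.mul_apply, Fin.sum_univ_two, ModularGroup.T]

lemma Inv1.sigT {G : ℍ → ℂ} (h : Inv1 G) (τ : ℍ) : G (sig • ModularGroup.T • τ) = G (sig • τ) := by
  rw [sig_T]
  exact h _ (by simp) (by simp) _

theorem good_inv {n : ℕ} (hn : n ≠ 0) {G : ℍ → ℂ} (hG : G ∈ Good n) (hi : Inv1 G) {τ : ℍ}
    (h1 : f τ ∈ AA) (h2 : (f τ)⁻¹ ∈ AA) : G τ ∈ AA := by
  obtain ⟨m, c, h⟩ := hG.1 1 (by simp)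
  simp only [one_smul] at h
  obtain ⟨m', c', h'⟩ := hG.1 sig (by simp [sig])
  obtain ⟨m, c, h⟩ := h.descend' hn hi.T
  obtain ⟨m', c', h'⟩ := h'.descend' hn hi.sigT
  obtain ⟨p, hp, -⟩ := principle_aux m m' c c' G hi hG.2 h h'
  have h3 : G τ = ((f τ)⁻¹) ^ m * Polynomial.aeval (f τ) p := by
    rw [← hp, inv_pow]
    have := f_ne_zero τ
    field_simp
  rw [h3]
  refine AA.mul_mem (AA.pow_mem h2 _) ?_
  have h4 : Polynomial.aeval (f τ) p = ((Polynomial.aeval (⟨f τ, h1⟩ : AA) p : AA) : ℂ) :=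
    Polynomial.aeval_algebraMap_apply ℂ (⟨f τ, h1⟩ : AA) p
  rw [h4]
  exact Subtype.mem _

lemma mem_AA_of_root {p : Polynomial ℂ} (hp : p.Monic) (hc : ∀ k, p.coeff k ∈ AA) {x : ℂ} (hx : p.IsRoot x) :
    x ∈ AA := by
  have hl : p ∈ Polynomial.lifts (algebraMap AA ℂ) := by
    rw [Polynomial.lifts_iff_coeff_lifts]
    intro k
    exact ⟨⟨_, hc k⟩, rfl⟩
  obtain ⟨q, hq, -, hm⟩ := Polynomial.lifts_and_natDegree_eq_and_monic hl hp
  have h1 : IsIntegral AA x := ⟨q, hm, by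
    rw [← Polynomial.eval_map, hq]; exact hx⟩
  exact isIntegral_trans (R := ℤ) (A := AA) x h1

theorem lemmaH {n : ℕ} (hn : n ≠ 0) {ι : Type*} [Fintype ι] (F : ι → ℍ → ℂ) (hF : ∀ i, F i ∈ Good n)
    (hperm : ∀ γ : SL(2,ℤ), (5:ℤ) ∣ γ 1 0 → γ 0 0 % 5 = 1 → ∃ σ : Equiv.Perm ι, ∀ i, ∀ τ : ℍ, F i (γ • τ) = F (σ i) τ)
    {τ : ℍ} (h1 : f τ ∈ AA) (h2 : (f τ)⁻¹ ∈ AA) (i : ι) : F i τ ∈ AA := by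
  let P : Polynomial (Good n) := ∏ i, (Polynomial.X - Polynomial.C ⟨F i, hF i⟩)
  let ev : ℍ → (Good n →+* ℂ) := fun τ => (Pi.evalRingHom (fun _ : ℍ => ℂ) τ).comp (Good n).val.toRingHom
  have hP : ∀ τ, P.map (ev τ) = ∏ i, (Polynomial.X - Polynomial.C (F i τ)) := by
    intro τ
    rw [Polynomial.map_prod]
    simp only [Polynomial.map_sub, Polynomial.map_X, Polynomial.map_C]
    rfl
  have hc : ∀ k τ, (P.map (ev τ)).coeff k = (P.coeff k : ℍ → ℂ) τ := by
    intro k τ; rw [Polynomial.coeff_map]; rfl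
  apply mem_AA_of_root (p := P.map (ev τ))
  · rw [hP]; exact Polynomial.monic_prod_of_monic _ _ fun i _ => Polynomial.monic_X_sub_C _
  · intro k
    rw [hc]
    refine good_inv hn (P.coeff k).2 ?_ h1 h2
    intro γ hγ hγ' τ
    rw [← hc, ← hc, hP, hP]
    congr 1
    obtain ⟨σ, hσ⟩ := hperm γ hγ hγ'
    exact Fintype.prod_equiv σ _ _ fun i => by rw [hσ]
  · rw [hP, Polynomial.IsRoot, Polynomial.eval_prod]
    exact Finset.prod_eq_zero (Finset.mem_univ i) (by simp)

end RR

namespace RR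
open Complex Filter Topology ModularForm
open UpperHalfPlane hiding I
open Matrix (SpecialLinearGroup)
open scoped MatrixGroups CongruenceSubgroup Manifold

local notation "π" => (Real.pi : ℂ)

lemma im_smul (γ : SL(2,ℤ)) (τ : ℍ) : (γ • τ).im = τ.im / ‖(γ 1 0 * τ + γ 1 1 : ℂ)‖ ^ 2 := by
  rw [ModularGroup.im_smul_eq_div_normSq, Complex.normSq_eq_norm_sq, ModularGroup.denom_apply]

/-- the invariant norm of `EE` -/
noncomputable def HN (τ : ℍ) : ℝ := ‖EE τ‖ * τ.im ^ 24

lemma HN_pos (τ : ℍ) : 0 < HN τ := mul_pos (norm_pos_iff.mpr (EE_ne_zero τ)) (pow_pos τ.im_pos _)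

lemma den_ne_zero (γ : SL(2,ℤ)) (τ : ℍ) : (γ 1 0 * τ + γ 1 1 : ℂ) ≠ 0 := by
  have := UpperHalfPlane.denom_ne_zero (γ : GL (Fin 2) ℝ) τ
  rwa [ModularGroup.denom_apply] at this

lemma HN_smul (γ : SL(2,ℤ)) (h : (5:ℤ) ∣ γ 1 0) (τ : ℍ) : HN (γ • τ) = HN τ := by
  have h0 := norm_pos_iff.mpr (den_ne_zero γ τ)
  rw [HN, HN, EE_smul γ h, im_smul, norm_mul, norm_pow, div_pow]
  field_simp

/-- the factor at the cusp zero -/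
noncomputable def QQ (τ : ℍ) : ℂ := PS Set.univ (qq (fifth τ)) ^ 120 * (PS Set.univ (qq (fifth τ) ^ 5) ^ 24)⁻¹

lemma qq_fifth (τ : ℍ) : qq (fifth τ) = tq 5 τ := by
  rw [qq, tq, fifth]; congr 1; push_cast; ring

lemma QQ_exp : Exp 5 0 1 QQ := by
  refine ⟨_, (((PS_intSer Set.univ).pow 120).mul
    ((((PS_intSer Set.univ).comp_pow (n := 5) (by simp)).pow 24).inv (by simp [PS_zero])
    (fun x hx => pow_ne_zero _ (PS_ne_zero _ (pow5_lt hx))))).aser, by simp [PS_zero], fun τ => ?_⟩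
  simp [QQ, qq_fifth]

lemma QQinv_exp : Exp 5 0 1 (fun τ => (QQ τ)⁻¹) := by
  refine ⟨_, ((((PS_intSer Set.univ).pow 120).inv (by simp [PS_zero])
    (fun x hx => pow_ne_zero _ (PS_ne_zero _ hx))).mul
    (((PS_intSer Set.univ).comp_pow (n := 5) (by simp)).pow 24)).aser, by simp [PS_zero], fun τ => ?_⟩
  simp [QQ, qq_fifth, mul_comm]

lemma QQ_ne_zero (τ : ℍ) : QQ τ ≠ 0 :=
  mul_ne_zero (pow_ne_zero _ (PS_ne_zero _ (norm_qq_lt _)))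
    (inv_ne_zero (pow_ne_zero _ (PS_ne_zero _ (pow5_lt (norm_qq_lt _)))))

lemma HN_S (τ : ℍ) : HN (ModularGroup.S • τ) = ((5:ℝ) ^ 60)⁻¹ * ‖QQ τ‖ * τ.im ^ 24 := by
  have h0 : 0 < ‖(τ : ℂ)‖ := norm_pos_iff.mpr τ.ne_zero
  rw [HN, EE_S, im_smul, ← QQ]
  simp only [norm_mul, norm_pow, norm_inv]
  simp [ModularGroup.S]
  field_simp

lemma HN_cusp (γ : SL(2,ℤ)) (h : ¬ (5:ℤ) ∣ γ 1 0) : ∃ A c₁ c₂ : ℝ, 0 < c₁ ∧ 0 < c₂ ∧ ∀ τ : ℍ, A ≤ τ.im →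
    c₁ * τ.im ^ 24 ≤ HN (γ • τ) ∧ HN (γ • τ) ≤ c₂ * τ.im ^ 24 := by
  obtain ⟨γ₀, j, h0, rfl⟩ := coset γ h
  obtain ⟨M₁, A₁, h₁⟩ := UpperHalfPlane.isBoundedAtImInfty_iff.mp (QQ_exp.isBounded (by norm_num))
  obtain ⟨M₂, A₂, h₂⟩ := UpperHalfPlane.isBoundedAtImInfty_iff.mp (QQinv_exp.isBounded (by norm_num))
  refine ⟨max A₁ A₂, ((5:ℝ) ^ 60)⁻¹ * (|M₂| + 1)⁻¹, ((5:ℝ) ^ 60)⁻¹ * (|M₁| + 1), by positivity, by positivity, fun τ hτ => ?_⟩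
  rw [mul_smul, HN_smul _ h0, mul_smul, HN_S, im_T_zpow]
  have hi : 0 ≤ τ.im ^ 24 := pow_nonneg τ.im_pos.le _
  have e1 := h₁ (ModularGroup.T ^ j • τ) (by rw [im_T_zpow]; exact (le_max_left _ _).trans hτ)
  have e2 := h₂ (ModularGroup.T ^ j • τ) (by rw [im_T_zpow]; exact (le_max_right _ _).trans hτ)
  rw [norm_inv] at e2
  have hq := norm_pos_iff.mpr (QQ_ne_zero (ModularGroup.T ^ j • τ))
  have e1' : ‖QQ (ModularGroup.T ^ j • τ)‖ ≤ |M₁| + 1 := e1.trans ((le_abs_self _).trans (by linarith))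
  have e2' : (|M₂| + 1)⁻¹ ≤ ‖QQ (ModularGroup.T ^ j • τ)‖ := by
    rw [inv_le_comm₀ (by positivity) hq]
    exact e2.trans ((le_abs_self _).trans (by linarith))
  constructor <;> gcongr

/-- index set of Hecke representatives -/
def Idx (n : ℕ) : Type := {x : ℕ × ℕ × ℕ // x.1 * x.2.2 = n ∧ x.2.1 < x.2.2}

namespace Idx
variable {n : ℕ}
def a (i : Idx n) : ℕ := i.1.1
def b (i : Idx n) : ℕ := i.1.2.1
def d (i : Idx n) : ℕ := i.1.2.2
lemma had (i : Idx n) : i.a * i.d = n := i.2.1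
lemma hbd (i : Idx n) : i.b < i.d := i.2.2
lemma d_pos (i : Idx n) : 0 < i.d := lt_of_le_of_lt (Nat.zero_le _) i.hbd
lemma a_pos (hn : n ≠ 0) (i : Idx n) : 0 < i.a := Nat.pos_of_ne_zero fun h => hn (by rw [← i.had, h, zero_mul])

lemma ext' {i j : Idx n} (h1 : i.a = j.a) (h2 : i.b = j.b) (h3 : i.d = j.d) : i = j :=
  Subtype.ext (Prod.ext h1 (Prod.ext h2 h3))

lemma finite (hn : n ≠ 0) : Finite (Idx n) := by
  have : Set.Finite {x : ℕ × ℕ × ℕ | x.1 * x.2.2 = n ∧ x.2.1 < x.2.2} := by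
    refine Set.Finite.subset (s := (Set.Iic n) ×ˢ (Set.Iic n) ×ˢ (Set.Iic n))
      ((Set.finite_Iic n).prod ((Set.finite_Iic n).prod (Set.finite_Iic n))) ?_
    rintro ⟨a, b, d⟩ ⟨h1, h2⟩
    simp only at h1 h2
    have ha : a ≠ 0 := by rintro rfl; simp at h1; omega
    have hd : d ≤ n := by rw [← h1]; exact Nat.le_mul_of_pos_left _ (Nat.pos_of_ne_zero ha)
    have hd0 : 0 < d := by omega
    have ha' : a ≤ n := by rw [← h1]; exact Nat.le_mul_of_pos_right _ hd0
    simp only [Set.mem_prod, Set.mem_Iic]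
    omega
  exact this

/-- the point `(aτ+b)/d` -/
noncomputable def mv (hn : n ≠ 0) (i : Idx n) (τ : ℍ) : ℍ := ⟨(i.a * τ + i.b) / i.d, by
  have h1 : (0:ℝ) < i.a := by exact_mod_cast i.a_pos hn
  have h2 : (0:ℝ) < i.d := by exact_mod_cast i.d_pos
  have h3 : 0 < (τ : ℂ).im := τ.im_pos
  rw [show ((i.a * τ + i.b) / i.d : ℂ) = ((1 / i.d : ℝ) : ℂ) * (((i.a : ℝ) : ℂ) * τ + ((i.b : ℝ) : ℂ)) by push_cast; ring,
    Complex.im_ofReal_mul, Complex.add_im, Complex.im_ofReal_mul, Complex.ofReal_im]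
  positivity⟩

lemma coe_mv (hn : n ≠ 0) (i : Idx n) (τ : ℍ) : (mv hn i τ : ℂ) = (i.a * τ + i.b) / i.d := rfl

lemma im_mv (hn : n ≠ 0) (i : Idx n) (τ : ℍ) : (mv hn i τ).im = i.a / i.d * τ.im := by
  rw [← UpperHalfPlane.coe_im, coe_mv,
   show ((i.a * τ + i.b) / i.d : ℂ) = ((1 / i.d : ℝ) : ℂ) * (((i.a : ℝ) : ℂ) * τ + ((i.b : ℝ) : ℂ)) by push_cast; ring,
    Complex.im_ofReal_mul, Complex.add_im, Complex.im_ofReal_mul, Complex.ofReal_im, UpperHalfPlane.coe_im]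
  ring
end Idx

/-- `M_i γ = γ' M_j` -/
structure Rel {n : ℕ} (i : Idx n) (γ γ' : SL(2,ℤ)) (j : Idx n) : Prop where
  h00 : i.a * γ 0 0 + i.b * γ 1 0 = γ' 0 0 * j.a
  h01 : i.a * γ 0 1 + i.b * γ 1 1 = γ' 0 0 * j.b + γ' 0 1 * j.d
  h10 : i.d * γ 1 0 = γ' 1 0 * j.a
  h11 : i.d * γ 1 1 = γ' 1 0 * j.b + γ' 1 1 * j.d

theorem hnf {n : ℕ} (hn : n ≠ 0) (A B C D : ℤ) (h : A * D - B * C = n) : ∃ (γ : SL(2,ℤ)) (j : Idx n),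
    A = γ 0 0 * j.a ∧ B = γ 0 0 * j.b + γ 0 1 * j.d ∧ C = γ 1 0 * j.a ∧ D = γ 1 0 * j.b + γ 1 1 * j.d := by
  have hg : 0 < Int.gcd A C := by
    rw [Int.gcd_pos_iff]
    by_contra hcon
    push Not at hcon
    rw [hcon.1, hcon.2] at h
    simp at h
    exact hn (by exact_mod_cast h.symm)
  obtain ⟨A', hA⟩ := Int.gcd_dvd_left A C
  obtain ⟨C', hC⟩ := Int.gcd_dvd_right A C
  set g : ℕ := Int.gcd A C with hgdef
  have hg' : (g : ℤ) ≠ 0 := by exact_mod_cast hg.ne'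
  have hbez := Int.gcd_eq_gcd_ab A C
  rw [← hgdef] at hbez
  set v := Int.gcdA A C
  set u := Int.gcdB A C
  have hdet : A' * v - (-u) * C' = 1 := by
    apply mul_left_cancel₀ hg'
    linear_combination -hbez + v * (-hA) + u * (-hC)
  have ht : (g : ℤ) * (A' * D - C' * B) = n := by
    rw [← h]; linear_combination -(D * hA) + B * hC
  have htpos : 0 < A' * D - C' * B := by
    have : (0:ℤ) < n := by exact_mod_cast Nat.pos_of_ne_zero hn
    rw [← ht] at this
    exact pos_of_mul_pos_right this (by positivity)
  set t := A' * D - C' * B with htdef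
  set s := v * B + u * D with hs
  have hm1 := Int.emod_nonneg s htpos.ne'
  have hm2 := Int.emod_lt_of_pos s htpos
  have hm3 := Int.emod_add_mul_ediv s t
  refine ⟨mkSL A' (-u + A' * (s / t)) C' (v + C' * (s / t)) (by linear_combination hdet),
    ⟨(g, (s % t).toNat, t.toNat), ?_, ?_⟩, ?_⟩
  · simp only
    zify
    rw [Int.toNat_of_nonneg htpos.le, ht]
  · simp only
    omega
  · have e1 : ((t.toNat : ℕ) : ℤ) = t := Int.toNat_of_nonneg htpos.le
    have e2 : (((s % t).toNat : ℕ) : ℤ) = s % t := Int.toNat_of_nonneg hm1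
    simp only [mkSL_00, mkSL_01, mkSL_10, mkSL_11, Idx.a, Idx.b, Idx.d, e1, e2]
    have e3 : s % t = s - t * (s / t) := by linarith
    rw [e3]
    refine ⟨by rw [hA]; ring, ?_, by rw [hC]; ring, ?_⟩
    · rw [hs, htdef]; linear_combination -B * hdet
    · rw [hs, htdef]; linear_combination -D * hdet

theorem rel_exists {n : ℕ} (hn : n ≠ 0) (i : Idx n) (γ : SL(2,ℤ)) : ∃ γ' j, Rel i γ γ' j := by
  have hd := det_eq γ
  have had : (i.a : ℤ) * i.d = n := by exact_mod_cast i.had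
  obtain ⟨γ', j, h1, h2, h3, h4⟩ := hnf hn (i.a * γ 0 0 + i.b * γ 1 0) (i.a * γ 0 1 + i.b * γ 1 1)
    (i.d * γ 1 0) (i.d * γ 1 1) (by rw [← had]; linear_combination (i.a * i.d : ℤ) * hd)
  exact ⟨γ', j, h1, h2, h3, h4⟩

theorem rel_unique {n : ℕ} (hn : n ≠ 0) {i i' : Idx n} {γ γ' γ'' : SL(2,ℤ)} {j : Idx n} (h : Rel i γ γ' j)
    (h' : Rel i' γ γ'' j) : i = i' := by
  obtain ⟨h00, h01, h10, h11⟩ := h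
  obtain ⟨k00, k01, k10, k11⟩ := h'
  have hd := det_eq γ
  have hd' := det_eq γ'
  have hd'' := det_eq γ''
  have ha := i.a_pos hn
  have ha' := i'.a_pos hn
  have hdp := i.d_pos
  have hdp' := i'.d_pos
  have hb := i.hbd
  have hb' := i'.hbd
  have hj := j.a_pos hn
  have hjd := j.d_pos
  set p := γ' 0 0 * γ'' 1 1 - γ' 0 1 * γ'' 1 0 with hp
  set q := -γ' 0 0 * γ'' 0 1 + γ' 0 1 * γ'' 0 0 with hq
  set r := γ' 1 0 * γ'' 1 1 - γ' 1 1 * γ'' 1 0 with hr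
  set s := -γ' 1 0 * γ'' 0 1 + γ' 1 1 * γ'' 0 0 with hs
  have e1 : (i.a : ℤ) = p * i'.a := by
    have : (i.a : ℤ) * (γ 0 0 * γ 1 1 - γ 0 1 * γ 1 0) = p * i'.a * (γ 0 0 * γ 1 1 - γ 0 1 * γ 1 0) := by
      rw [hp]
      linear_combination γ 1 1 * h00 - γ 1 0 * h01 - (γ' 0 0 * γ'' 1 1 - γ' 0 1 * γ'' 1 0) * (γ 1 1 * k00 - γ 1 0 * k01) + (γ' 0 0 * γ 1 1 * j.a - γ 1 0 * γ' 0 0 * j.b - γ 1 0 * γ' 0 1 * j.d) * (-hd'') + (γ' 0 0 * γ'' 0 1 - γ' 0 1 * γ'' 0 0) * (γ 1 1 * k10 - γ 1 0 * k11)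
    rwa [hd, mul_one, mul_one] at this
  have e2 : (0 : ℤ) = r * i'.a := by
    have : (0 : ℤ) * (γ 0 0 * γ 1 1 - γ 0 1 * γ 1 0) = r * i'.a * (γ 0 0 * γ 1 1 - γ 0 1 * γ 1 0) := by
      rw [hr]
      linear_combination γ 1 1 * h10 - γ 1 0 * h11 - (γ' 1 0 * γ'' 1 1 - γ' 1 1 * γ'' 1 0) * (γ 1 1 * k00 - γ 1 0 * k01) + (γ' 1 0 * γ 1 1 * j.a - γ 1 0 * γ' 1 0 * j.b - γ 1 0 * γ' 1 1 * j.d) * (-hd'') + (γ' 1 0 * γ'' 0 1 - γ' 1 1 * γ'' 0 0) * (γ 1 1 * k10 - γ 1 0 * k11)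
    rwa [hd, mul_one, mul_one] at this
  have e3 : (i.b : ℤ) = p * i'.b + q * i'.d := by
    have : (i.b : ℤ) * (γ 0 0 * γ 1 1 - γ 0 1 * γ 1 0) = (p * i'.b + q * i'.d) * (γ 0 0 * γ 1 1 - γ 0 1 * γ 1 0) := by
      rw [hp, hq]
      linear_combination -γ 0 1 * h00 + γ 0 0 * h01 - (γ' 0 0 * γ'' 1 1 - γ' 0 1 * γ'' 1 0) * (-γ 0 1 * k00 + γ 0 0 * k01) + (-γ' 0 0 * γ 0 1 * j.a + γ 0 0 * γ' 0 0 * j.b + γ 0 0 * γ' 0 1 * j.d) * (-hd'') + (γ' 0 0 * γ'' 0 1 - γ' 0 1 * γ'' 0 0) * (-γ 0 1 * k10 + γ 0 0 * k11)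
    rwa [hd, mul_one, mul_one] at this
  have e4 : (i.d : ℤ) = r * i'.b + s * i'.d := by
    have : (i.d : ℤ) * (γ 0 0 * γ 1 1 - γ 0 1 * γ 1 0) = (r * i'.b + s * i'.d) * (γ 0 0 * γ 1 1 - γ 0 1 * γ 1 0) := by
      rw [hr, hs]
      linear_combination -γ 0 1 * h10 + γ 0 0 * h11 - (γ' 1 0 * γ'' 1 1 - γ' 1 1 * γ'' 1 0) * (-γ 0 1 * k00 + γ 0 0 * k01) + (-γ' 1 0 * γ 0 1 * j.a + γ 0 0 * γ' 1 0 * j.b + γ 0 0 * γ' 1 1 * j.d) * (-hd'') + (γ' 1 0 * γ'' 0 1 - γ' 1 1 * γ'' 0 0) * (-γ 0 1 * k10 + γ 0 0 * k11)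
    rwa [hd, mul_one, mul_one] at this
  have hr0 : r = 0 := by
    rcases mul_eq_zero.mp e2.symm with h | h
    · exact h
    · omega
  have hps : p * s - q * r = 1 := by
    rw [hp, hq, hr, hs]; linear_combination (γ'' 0 0 * γ'' 1 1 - γ'' 0 1 * γ'' 1 0) * hd' + hd''
  rw [hr0, mul_zero, sub_zero] at hps
  have hp1 : p = 1 := by
    rcases Int.eq_one_or_neg_one_of_mul_eq_one hps with h | h
    · exact h
    · rw [h] at e1; omega
  have hs1 : s = 1 := by rw [hp1, one_mul] at hps; exact hps
  rw [hp1, one_mul] at e1 e3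
  rw [hr0, hs1, zero_mul, zero_add, one_mul] at e4
  have hq0 : q = 0 := by
    by_contra hne
    rcases lt_or_gt_of_ne hne with hlt | hgt
    · have : q * i'.d ≤ -1 * i'.d := by gcongr; omega
      omega
    · have : 1 * (i'.d : ℤ) ≤ q * i'.d := by gcongr; omega
      omega
  rw [hq0, zero_mul, add_zero] at e3
  exact Idx.ext' (by exact_mod_cast e1) (by exact_mod_cast e3) (by exact_mod_cast e4)

theorem rel_perm {n : ℕ} (hn : n ≠ 0) (γ : SL(2,ℤ)) : ∃ σ : Equiv.Perm (Idx n), ∀ i, ∃ γ', Rel i γ γ' (σ i) := by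
  have := Idx.finite hn
  choose γ' j hj using fun i => rel_exists hn i γ
  have hinj : Function.Injective j := by
    intro i i' h
    have h1 := hj i
    rw [h] at h1
    exact rel_unique hn h1 (hj i')
  exact ⟨Equiv.ofBijective j (Finite.injective_iff_bijective.mp hinj), fun i => ⟨γ' i, hj i⟩⟩

end RR

namespace RR
open Complex Filter Topology ModularForm
open UpperHalfPlane hiding I
open Matrix (SpecialLinearGroup)
open scoped MatrixGroups CongruenceSubgroup Manifold

local notation "π" => (Real.pi : ℂ)

lemma dia_congr {α β : ℤ} (h : α % 5 = β % 5) (x : ℂ) : dia α x = dia β x := by simp [dia, h]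

lemma dia_mul {α β : ℤ} (hα : α % 5 ≠ 0) (hβ : β % 5 ≠ 0) (x : ℂ) : dia α (dia β x) = dia (α * β) x := by
  have h := Int.mul_emod α β 5
  have hα' : α % 5 = 1 ∨ α % 5 = 2 ∨ α % 5 = 3 ∨ α % 5 = 4 := by omega
  have hβ' : β % 5 = 1 ∨ β % 5 = 2 ∨ β % 5 = 3 ∨ β % 5 = 4 := by omega
  rcases hα' with e | e | e | e <;> rcases hβ' with e' | e' | e' | e' <;> rw [e, e'] at h <;>
    simp [dia, e, e', h, inv_neg]

lemma dia_inv (α : ℤ) (x : ℂ) : dia α x⁻¹ = (dia α x)⁻¹ := by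
  unfold dia; split_ifs <;> simp [inv_neg]

lemma dia_ne_zero (α : ℤ) {x : ℂ} (h : x ≠ 0) : dia α x ≠ 0 := by
  unfold dia; split_ifs
  · exact h
  · simpa using h

variable {n : ℕ}

lemma Idx.a_ndvd (h5 : ¬ 5 ∣ n) (i : Idx n) : (i.a : ℤ) % 5 ≠ 0 := by
  intro h
  apply h5
  rw [← i.had]
  exact Dvd.dvd.mul_right (by omega) _

lemma Idx.d_ndvd (h5 : ¬ 5 ∣ n) (i : Idx n) : ¬ (5 : ℤ) ∣ i.d := by
  intro h
  apply h5
  rw [← i.had]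
  exact Dvd.dvd.mul_left (by omega) _

lemma Rel.dvd (h5 : ¬ 5 ∣ n) {i j : Idx n} {γ γ' : SL(2,ℤ)} (h : Rel i γ γ' j) :
    (5:ℤ) ∣ γ 1 0 ↔ (5:ℤ) ∣ γ' 1 0 := by
  have hp : Prime (5:ℤ) := Int.prime_iff_natAbs_prime.mpr (by norm_num)
  have hi := i.d_ndvd h5
  have hj := j.a_ndvd h5
  constructor
  · intro hd
    have := hp.dvd_or_dvd (h.h10 ▸ Dvd.dvd.mul_left hd _)
    rcases this with h | h
    · exact h
    · omega
  · intro hd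
    have := hp.dvd_or_dvd (h.h10.symm ▸ Dvd.dvd.mul_right hd _)
    rcases this with h | h
    · exact absurd h hi
    · exact h

lemma Rel.den (hn : n ≠ 0) {i j : Idx n} {γ γ' : SL(2,ℤ)} (h : Rel i γ γ' j) (τ : ℍ) :
    (γ' 1 0 * (j.mv hn τ) + γ' 1 1 : ℂ) = i.d * (γ 1 0 * τ + γ 1 1) / j.d := by
  have hjd : (j.d : ℂ) ≠ 0 := by exact_mod_cast j.d_pos.ne'
  have e3 : (i.d * γ 1 0 : ℂ) = γ' 1 0 * j.a := by exact_mod_cast h.h10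
  have e4 : (i.d * γ 1 1 : ℂ) = γ' 1 0 * j.b + γ' 1 1 * j.d := by exact_mod_cast h.h11
  rw [Idx.coe_mv]
  field_simp
  linear_combination -(τ : ℂ) * e3 - e4

lemma Rel.mv (hn : n ≠ 0) {i j : Idx n} {γ γ' : SL(2,ℤ)} (h : Rel i γ γ' j) (τ : ℍ) :
    i.mv hn (γ • τ) = γ' • j.mv hn τ := by
  apply UpperHalfPlane.ext
  rw [coe_smul, h.den hn, Idx.coe_mv, coe_smul, Idx.coe_mv]
  have hjd : (j.d : ℂ) ≠ 0 := by exact_mod_cast j.d_pos.ne'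
  have hid : (i.d : ℂ) ≠ 0 := by exact_mod_cast i.d_pos.ne'
  have e1 : (i.a * γ 0 0 + i.b * γ 1 0 : ℂ) = γ' 0 0 * j.a := by exact_mod_cast h.h00
  have e2 : (i.a * γ 0 1 + i.b * γ 1 1 : ℂ) = γ' 0 0 * j.b + γ' 0 1 * j.d := by exact_mod_cast h.h01
  have h0 := den_ne_zero γ τ
  have e5 : (i.a * ((γ 0 0 * τ + γ 0 1) / (γ 1 0 * τ + γ 1 1)) + i.b : ℂ) =
      (γ' 0 0 * (j.a * τ + j.b) + γ' 0 1 * j.d) / (γ 1 0 * τ + γ 1 1) := by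
    rw [eq_div_iff h0, add_mul, mul_assoc, div_mul_cancel₀ _ h0]
    linear_combination (τ : ℂ) * e1 + e2
  rw [e5]
  generalize (γ 1 0 * τ + γ 1 1 : ℂ) = D at *
  field_simp

/-- Hecke translates of `f` -/
noncomputable def fM (hn : n ≠ 0) (i : Idx n) (τ : ℍ) : ℂ := dia i.a (f (i.mv hn τ))

/-- Hecke quotients of `EE` -/
noncomputable def phi (hn : n ≠ 0) (i : Idx n) (τ : ℍ) : ℂ := i.a ^ 48 * EE (i.mv hn τ) / EE τ

lemma fM_ne_zero (hn : n ≠ 0) (i : Idx n) (τ : ℍ) : fM hn i τ ≠ 0 := dia_ne_zero _ (f_ne_zero _)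

lemma fM_smul (hn : n ≠ 0) (h5 : ¬ 5 ∣ n) {i j : Idx n} {γ γ' : SL(2,ℤ)} (h : Rel i γ γ' j) (hγ : (5:ℤ) ∣ γ 1 0) (τ : ℍ) :
    fM hn i (γ • τ) = dia (γ 0 0) (fM hn j τ) := by
  have hγ' := (h.dvd h5).mp hγ
  have u := unit_mod5 γ hγ
  have u' := unit_mod5 γ' hγ'
  rw [fM, fM, h.mv hn, f_smul _ hγ', dia_mul (i.a_ndvd h5) (by omega), dia_mul (by omega) (j.a_ndvd h5)]
  have e := h.h00
  obtain ⟨k, hk⟩ := hγ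
  have i1 := i.a_ndvd h5
  have j1 := j.a_ndvd h5
  have e1 : (i.a * γ 0 0 : ℤ) % 5 = (γ' 0 0 * j.a) % 5 := by
    rw [← e, hk]
    rw [show (i.b : ℤ) * (5 * k) = 5 * (i.b * k) by ring]
    omega
  generalize (i.a : ℤ) = A at *
  generalize (j.a : ℤ) = J at *
  generalize γ 0 0 = g at *
  generalize γ' 0 0 = g' at *
  rw [Int.mul_emod, Int.mul_emod g' J] at e1
  have h1 := Int.mul_emod A g' 5
  have h2 := Int.mul_emod g J 5
  have i1' : A % 5 = 1 ∨ A % 5 = 2 ∨ A % 5 = 3 ∨ A % 5 = 4 := by omega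
  have j1' : J % 5 = 1 ∨ J % 5 = 2 ∨ J % 5 = 3 ∨ J % 5 = 4 := by omega
  clear i1 j1 e hk
  rcases i1' with i1 | i1 | i1 | i1 <;> rcases u with u | u | u | u <;>
  rcases u' with u' | u' | u' | u' <;> rcases j1' with j1 | j1 | j1 | j1 <;>
    rw [i1, u, u', j1] at e1 <;> first | (exfalso; revert e1; norm_num; done) | (rw [i1, u'] at h1; rw [u, j1] at h2; simp [dia, h1, h2])

lemma phi_smul (hn : n ≠ 0) (h5 : ¬ 5 ∣ n) {i j : Idx n} {γ γ' : SL(2,ℤ)} (h : Rel i γ γ' j) (hγ : (5:ℤ) ∣ γ 1 0) (τ : ℍ) :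
    phi hn i (γ • τ) = phi hn j τ := by
  have hγ' := (h.dvd h5).mp hγ
  have h0 := den_ne_zero γ τ
  have hE := EE_ne_zero τ
  have hjd : (j.d : ℂ) ≠ 0 := by exact_mod_cast j.d_pos.ne'
  have e : (i.a * i.d : ℂ) = j.a * j.d := by exact_mod_cast i.had.trans j.had.symm
  rw [phi, phi, h.mv hn, EE_smul _ hγ', EE_smul _ hγ, h.den hn, div_pow, mul_pow]
  have e2 : (i.a : ℂ) ^ 48 * i.d ^ 48 = j.a ^ 48 * j.d ^ 48 := by rw [← mul_pow, e, mul_pow]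
  generalize (γ 1 0 * τ + γ 1 1 : ℂ) = D at *
  field_simp
  linear_combination EE (j.mv hn τ) * e2

/-- the root of unity attached to a representative -/
noncomputable def zt (i : Idx n) : ℂ := cexp (2 * π * I * i.b / i.d)

lemma zt_pow (i : Idx n) : zt i ^ i.d = 1 := by
  have hjd : (i.d : ℂ) ≠ 0 := by exact_mod_cast i.d_pos.ne'
  rw [zt, ← exp_nat_mul, show (i.d : ℂ) * (2 * π * I * i.b / i.d) = i.b * (2 * π * I) by field_simp]
  exact Complex.exp_nat_mul_two_pi_mul_I _

lemma zt_norm (i : Idx n) : ‖zt i‖ = 1 := Complex.norm_eq_one_of_pow_eq_one (zt_pow i) i.d_pos.ne'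

lemma zt_ne_zero (i : Idx n) : zt i ≠ 0 := exp_ne_zero _

lemma mem_AA_of_pow {z : ℂ} {k : ℕ} (hk : 0 < k) (h : z ^ k ∈ AA) : z ∈ AA := IsIntegral.of_pow hk h

lemma zt_mem (i : Idx n) : zt i ∈ AA := mem_AA_of_pow i.d_pos (by rw [zt_pow]; exact AA.one_mem)
lemma ztinv_mem (i : Idx n) : (zt i)⁻¹ ∈ AA := mem_AA_of_pow i.d_pos (by rw [inv_pow, zt_pow, inv_one]; exact AA.one_mem)

lemma qq_mv (hn : n ≠ 0) (i : Idx n) (τ : ℍ) : qq (i.mv hn τ) = zt i * tq n τ ^ (i.a ^ 2) := by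
  have hjd : (i.d : ℂ) ≠ 0 := by exact_mod_cast i.d_pos.ne'
  have hja : (i.a : ℂ) ≠ 0 := by exact_mod_cast (i.a_pos hn).ne'
  rw [qq, Idx.coe_mv, zt, tq, ← exp_nat_mul, ← exp_add]
  congr 1
  have : (n : ℂ) = i.a * i.d := by exact_mod_cast i.had.symm
  rw [this]
  push_cast
  field_simp
  ring

lemma fmv_exp (hn : n ≠ 0) (i : Idx n) : Exp n 0 0 (fun τ => f (i.mv hn τ)) := by
  have ha := (i.a_pos hn).ne'
  refine ⟨_, ((ASer.const (zt_mem i)).mul (ASer.X_pow (i.a ^ 2))).mul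
    (U_intSer.aser.comp_scale (zt_mem i) (zt_norm i) (pow_ne_zero 2 ha)), by simp [ha], fun τ => ?_⟩
  simp only [f, qq_mv hn]; ring

lemma fmvinv_exp (hn : n ≠ 0) (i : Idx n) : Exp n (i.a ^ 2) (zt i)⁻¹ (fun τ => (f (i.mv hn τ))⁻¹) := by
  have ha := (i.a_pos hn).ne'
  refine ⟨_, (ASer.const (ztinv_mem i)).mul
    (Uinv_intSer.aser.comp_scale (zt_mem i) (zt_norm i) (pow_ne_zero 2 ha)), by simp [ha, U_zero], fun τ => ?_⟩
  simp only [f, qq_mv hn]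
  have := tq_ne_zero n τ
  have := zt_ne_zero i
  field_simp

lemma Exp.neg {m : ℕ} {c : ℂ} {G : ℍ → ℂ} (h : Exp n m c G) : Exp n m (-c) (fun τ => -G τ) := by
  have := Exp.smul (AA.neg_mem AA.one_mem) h
  rw [neg_one_mul] at this
  exact this.congr fun τ => by ring

lemma dia_exp {G : ℍ → ℂ} (h1 : ∃ m c, Exp n m c G) (h2 : ∃ m c, Exp n m c (fun τ => (G τ)⁻¹)) (α : ℤ) :
    ∃ m c, Exp n m c (fun τ => dia α (G τ)) := by
  unfold dia
  split_ifs
  · exact h1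
  · obtain ⟨m, c, h⟩ := h2
    exact ⟨m, _, h.neg⟩

lemma dia_fM_exp (hn : n ≠ 0) (i : Idx n) (α : ℤ) : ∃ m c, Exp n m c (fun τ => dia α (fM hn i τ)) := by
  apply dia_exp
  · exact dia_exp ⟨_, _, fmv_exp hn i⟩ ⟨_, _, fmvinv_exp hn i⟩ _
  · simp only [fM, ← dia_inv]
    exact dia_exp ⟨_, _, fmvinv_exp hn i⟩ ⟨_, _, by simpa only [inv_inv] using fmv_exp hn i⟩ _

lemma phi_exp (hn : n ≠ 0) (i : Idx n) : ∃ c, Exp n (24 * n) c (phi hn i) := by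
  have ha := (i.a_pos hn).ne'
  refine ⟨_, _, (((ASer.const (AA.pow_mem (intCast_mem i.a) 48)).mul (((ASer.const (zt_mem i)).mul (ASer.X_pow (i.a ^ 2))).pow 24)).mul
    (V_intSer.aser.comp_scale (zt_mem i) (zt_norm i) (pow_ne_zero 2 ha))).mul
      (Vinv_intSer.aser.comp_scale AA.one_mem (by simp) hn), rfl, fun τ => ?_⟩
  have h0 := qq_ne_zero τ
  have h1 := V_ne_zero (norm_qq_lt τ)
  simp only [phi, EE_eq, qq_mv hn, one_mul, tq_pow hn]
  rw [mul_comm 24 n, pow_mul, tq_pow hn]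
  push_cast
  field_simp

/-- bounds at the other cusps -/
lemma fM_cusp (hn : n ≠ 0) (h5 : ¬ 5 ∣ n) (i : Idx n) (γ : SL(2,ℤ)) (hγ : ¬ (5:ℤ) ∣ γ 1 0) : ∃ A : ℝ, ∀ τ : ℍ, A ≤ τ.im →
    (11 / 100000 : ℝ) ≤ ‖fM hn i (γ • τ)‖ ∧ ‖fM hn i (γ • τ)‖ ≤ 100000 / 11 := by
  obtain ⟨γ', j, h⟩ := rel_exists hn i γ
  obtain ⟨A, hA⟩ := f_cusp γ' (fun hd => hγ ((h.dvd h5).mpr hd))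
  have hja : (0:ℝ) < j.a := by exact_mod_cast j.a_pos hn
  have hjd : (0:ℝ) < j.d := by exact_mod_cast j.d_pos
  refine ⟨A * (j.d / j.a), fun τ hτ => ?_⟩
  have h1 := hA (j.mv hn τ) (by
    rw [Idx.im_mv]
    rw [← div_le_iff₀' (by positivity)]
    refine le_trans (le_of_eq ?_) hτ
    field_simp)
  rw [fM, h.mv hn]
  unfold dia
  split_ifs
  · exact h1
  · have h0 : 0 < ‖f (γ' • j.mv hn τ)‖ := lt_of_lt_of_le (by norm_num) h1.1
    rw [norm_neg, norm_inv]
    constructor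
    · rw [le_inv_comm₀ (by norm_num) h0]; exact h1.2.trans (by norm_num)
    · rw [inv_le_comm₀ h0 (by norm_num)]; refine le_trans (by norm_num) h1.1

lemma fM_good (hn : n ≠ 0) (h5 : ¬ 5 ∣ n) (i : Idx n) : fM hn i ∈ Good n := by
  refine ⟨fun γ hγ => ?_, fun γ hγ => ?_⟩
  · obtain ⟨γ', j, h⟩ := rel_exists hn i γ
    simp only [fM_smul hn h5 h hγ]
    exact dia_fM_exp hn j _
  · obtain ⟨A, hA⟩ := fM_cusp hn h5 i γ hγ
    exact bounded_iff_comp.mpr ⟨_, A, fun τ hτ => (hA τ hτ).2⟩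

lemma fMinv_good (hn : n ≠ 0) (h5 : ¬ 5 ∣ n) (i : Idx n) : (fun τ => (fM hn i τ)⁻¹) ∈ Good n := by
  refine ⟨fun γ hγ => ?_, fun γ hγ => ?_⟩
  · obtain ⟨γ', j, h⟩ := rel_exists hn i γ
    simp only [fM_smul hn h5 h hγ, ← dia_inv]
    apply dia_exp
    · simp only [fM, ← dia_inv]
      exact dia_exp ⟨_, _, fmvinv_exp hn j⟩ ⟨_, _, by simpa only [inv_inv] using fmv_exp hn j⟩ _
    · simp only [inv_inv]
      exact dia_exp ⟨_, _, fmv_exp hn j⟩ ⟨_, _, fmvinv_exp hn j⟩ _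
  · obtain ⟨A, hA⟩ := fM_cusp hn h5 i γ hγ
    refine (bounded_iff_comp (G := fun τ => (fM hn i τ)⁻¹)).mpr ⟨100000 / 11, A, fun τ hτ => ?_⟩
    have h1 := (hA τ hτ).1
    rw [norm_inv, inv_le_comm₀ (lt_of_lt_of_le (by norm_num) h1) (by norm_num)]
    exact le_trans (by norm_num) h1

lemma norm_EE (τ : ℍ) : ‖EE τ‖ = HN τ / τ.im ^ 24 := by
  have := τ.im_pos
  rw [HN]; field_simp

lemma phi_good (hn : n ≠ 0) (h5 : ¬ 5 ∣ n) (i : Idx n) : phi hn i ∈ Good n := by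
  refine ⟨fun γ hγ => ?_, fun γ hγ => ?_⟩
  · obtain ⟨γ', j, h⟩ := rel_exists hn i γ
    simp only [phi_smul hn h5 h hγ]
    exact ⟨_, phi_exp hn j⟩
  · obtain ⟨γ', j, h⟩ := rel_exists hn i γ
    obtain ⟨A, c₁, c₂, hc₁, hc₂, hA⟩ := HN_cusp γ hγ
    obtain ⟨A', c₁', c₂', hc₁', hc₂', hA'⟩ := HN_cusp γ' (fun hd => hγ ((h.dvd h5).mpr hd))
    have hja : (0:ℝ) < j.a := by exact_mod_cast j.a_pos hn
    have hjd : (0:ℝ) < j.d := by exact_mod_cast j.d_pos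
    have hia : (0:ℝ) < i.a := by exact_mod_cast i.a_pos hn
    have hid : (0:ℝ) < i.d := by exact_mod_cast i.d_pos
    refine bounded_iff_comp.mpr ⟨i.a ^ 48 * (i.d / i.a) ^ 24 * (c₂' * (j.a / j.d) ^ 24) / c₁, max A (A' * (j.d / j.a)), fun τ hτ => ?_⟩
    have h1 := (hA τ ((le_max_left _ _).trans hτ)).1
    have h2 := (hA' (j.mv hn τ) (by
      rw [Idx.im_mv]
      rw [← div_le_iff₀' (by positivity)]
      refine le_trans (le_of_eq ?_) ((le_max_right _ _).trans hτ)
      field_simp)).2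
    have hi := τ.im_pos
    have hi' := (γ • τ).im_pos
    have hp := HN_pos (γ • τ)
    rw [phi, norm_div, norm_mul, norm_EE, norm_EE, Idx.im_mv, h.mv hn, norm_pow, Complex.norm_natCast]
    rw [Idx.im_mv] at h2
    generalize (γ • τ).im = y at *
    generalize HN (γ • τ) = u at *
    generalize HN (γ' • j.mv hn τ) = v at *
    have e : (i.a : ℝ) ^ 48 * (v / (i.a / i.d * y) ^ 24) / (u / y ^ 24) = i.a ^ 48 * (i.d / i.a) ^ 24 * (v / u) := by
      field_simp
    rw [e, mul_div_assoc]
    refine mul_le_mul_of_nonneg_left ?_ (by positivity)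
    rw [div_le_div_iff₀ hp hc₁]
    calc v * c₁ ≤ c₂' * (j.a / j.d * τ.im) ^ 24 * c₁ := by gcongr
      _ = c₂' * (j.a / j.d) ^ 24 * (c₁ * τ.im ^ 24) := by ring
      _ ≤ _ := by gcongr

lemma f_good (hn : n ≠ 0) : f ∈ Good n := by
  refine ⟨fun γ hγ => ?_, Bd0.f⟩
  simp only [f_smul γ hγ]
  exact dia_exp ⟨_, _, f_exp.level hn⟩ ⟨_, _, finv_exp.level hn⟩ _

lemma finv_good (hn : n ≠ 0) : (fun τ => (f τ)⁻¹) ∈ Good n := by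
  refine ⟨fun γ hγ => ?_, Bd0.finv⟩
  simp only [f_smul γ hγ, ← dia_inv]
  exact dia_exp ⟨_, _, finv_exp.level hn⟩ ⟨_, _, by simpa only [inv_inv] using f_exp.level hn⟩ _

/-- the Hecke quotients are integral at points where `f` is a unit -/
theorem phi_mem (hn : n ≠ 0) (h5 : ¬ 5 ∣ n) (i : Idx n) {τ : ℍ} (h1 : f τ ∈ AA) (h2 : (f τ)⁻¹ ∈ AA) :
    phi hn i τ ∈ AA := by
  have := Idx.finite hn
  have := Fintype.ofFinite (Idx n)
  refine lemmaH hn (phi hn) (phi_good hn h5) (fun γ hγ _ => ?_) h1 h2 i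
  obtain ⟨σ, hσ⟩ := rel_perm hn γ
  refine ⟨σ, fun i τ => ?_⟩
  obtain ⟨γ', h⟩ := hσ i
  exact phi_smul hn h5 h hγ τ

end RR

namespace RR
open Complex Filter Topology ModularForm
open UpperHalfPlane hiding I
open Matrix (SpecialLinearGroup)
open scoped MatrixGroups CongruenceSubgroup Manifold

local notation "π" => (Real.pi : ℂ)

variable {n : ℕ}

/-- nonzero algebraic numbers whose inverse is integral -/
def IU (c : ℂ) : Prop := c ≠ 0 ∧ c⁻¹ ∈ AA

lemma IU.mul {c c' : ℂ} (h : IU c) (h' : IU c') : IU (c * c') :=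
  ⟨mul_ne_zero h.1 h'.1, by rw [mul_inv]; exact AA.mul_mem h.2 h'.2⟩
lemma IU.one : IU 1 := ⟨one_ne_zero, by rw [inv_one]; exact AA.one_mem⟩
lemma IU.neg {c : ℂ} (h : IU c) : IU (-c) := ⟨neg_ne_zero.mpr h.1, by rw [inv_neg]; exact AA.neg_mem h.2⟩
lemma IU.pow {c : ℂ} (h : IU c) (k : ℕ) : IU (c ^ k) := ⟨pow_ne_zero _ h.1, by rw [← inv_pow]; exact AA.pow_mem h.2 _⟩

lemma Exp.prod {ι : Type*} (s : Finset ι) (F : ι → ℍ → ℂ) (h : ∀ i, ∃ m c, Exp n m c (F i) ∧ IU c) :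
    ∃ m c, Exp n m c (∏ i ∈ s, F i) ∧ IU c := by
  classical
  induction s using Finset.induction_on with
  | empty => exact ⟨0, 1, (Exp.const n AA.one_mem).congr fun τ => by simp, IU.one⟩
  | insert a s ha ih =>
    obtain ⟨m, c, h1, h2⟩ := h a
    obtain ⟨m', c', h1', h2'⟩ := ih
    rw [Finset.prod_insert ha]
    exact ⟨_, _, h1.mul h1', h2.mul h2'⟩

lemma Exp.sub_one {m : ℕ} {c : ℂ} {G : ℍ → ℂ} (h : Exp n m c G) :
    Exp n m (c - if m = 0 then 1 else 0) (fun τ => G τ - 1) := by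
  have := (Exp.const n AA.one_mem).mono' m
  rw [zero_add] at this
  exact h.sub this

lemma Exp.sub_one_iu {m : ℕ} {c : ℂ} {G : ℍ → ℂ} (h : Exp n m c G) (h' : (m ≠ 0 ∧ IU c) ∨ (m = 0 ∧ c = 0)) :
    ∃ m c, Exp n m c (fun τ => G τ - 1) ∧ IU c := by
  refine ⟨_, _, h.sub_one, ?_⟩
  rcases h' with ⟨h1, h2⟩ | ⟨h1, h2⟩
  · simpa [h1] using h2
  · simpa [h1, h2] using IU.one.neg

lemma zt_IU (i : Idx n) : IU (zt i) := ⟨zt_ne_zero i, ztinv_mem i⟩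
lemma ztinv_IU (i : Idx n) : IU (zt i)⁻¹ := ⟨inv_ne_zero (zt_ne_zero i), by rw [inv_inv]; exact zt_mem i⟩

lemma Useries (hn : n ≠ 0) (i : Idx n) : ASer (fun x => U (zt i * x ^ (i.a ^ 2)) * (U (1 * x ^ n))⁻¹) :=
  (U_intSer.aser.comp_scale (zt_mem i) (zt_norm i) (pow_ne_zero 2 (i.a_pos hn).ne')).mul
    (Uinv_intSer.aser.comp_scale AA.one_mem (by simp) hn)

lemma Useries' (hn : n ≠ 0) (i : Idx n) : ASer (fun x => (U (zt i * x ^ (i.a ^ 2)))⁻¹ * (U (1 * x ^ n))) :=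
  (Uinv_intSer.aser.comp_scale (zt_mem i) (zt_norm i) (pow_ne_zero 2 (i.a_pos hn).ne')).mul
    (U_intSer.aser.comp_scale AA.one_mem (by simp) hn)

lemma qlt (hn : n ≠ 0) (i : Idx n) (h : i.a ^ 2 < n) : Exp n (n - i.a ^ 2) (zt i) (fun τ => f (i.mv hn τ) * (f τ)⁻¹) := by
  have ha := (i.a_pos hn).ne'
  refine ⟨_, (ASer.const (zt_mem i)).mul (Useries hn i), by simp [U_zero, ha, hn], fun τ => ?_⟩
  have h0 := tq_ne_zero n τ
  obtain ⟨k, hk⟩ := Nat.exists_eq_add_of_le h.le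
  simp only [f, qq_mv hn]
  rw [← tq_pow hn, one_mul]
  have e : tq n τ ^ n = tq n τ ^ (n - i.a ^ 2) * tq n τ ^ (i.a ^ 2) := by
    rw [← pow_add]; congr 1; omega
  generalize U (tq n τ ^ n) = u
  rw [e]
  field_simp

lemma qlt' (hn : n ≠ 0) (i : Idx n) (h : i.a ^ 2 < n) : Exp n 0 0 (fun τ => (f (i.mv hn τ))⁻¹ * f τ) := by
  have ha := (i.a_pos hn).ne'
  refine ⟨_, ((ASer.X_pow (n - i.a ^ 2)).mul (ASer.const (ztinv_mem i))).mul (Useries' hn i), ?_, fun τ => ?_⟩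
  · simp only [zero_pow (Nat.sub_ne_zero_of_lt h), zero_mul]
  have h0 := tq_ne_zero n τ
  simp only [f, qq_mv hn]
  rw [← tq_pow hn, one_mul]
  have e : tq n τ ^ n = tq n τ ^ (n - i.a ^ 2) * tq n τ ^ (i.a ^ 2) := by
    rw [← pow_add]; congr 1; omega
  generalize U (tq n τ ^ n) = u
  rw [e]
  field_simp

lemma qgt (hn : n ≠ 0) (i : Idx n) (h : n < i.a ^ 2) : Exp n 0 0 (fun τ => f (i.mv hn τ) * (f τ)⁻¹) := by
  have ha := (i.a_pos hn).ne'
  refine ⟨_, ((ASer.X_pow (i.a ^ 2 - n)).mul (ASer.const (zt_mem i))).mul (Useries hn i), ?_, fun τ => ?_⟩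
  · simp only [zero_pow (Nat.sub_ne_zero_of_lt h), zero_mul]
  have h0 := tq_ne_zero n τ
  simp only [f, qq_mv hn]
  rw [← tq_pow hn, one_mul]
  have e : tq n τ ^ (i.a ^ 2) = tq n τ ^ (i.a ^ 2 - n) * tq n τ ^ n := by
    rw [← pow_add]; congr 1; omega
  generalize U (zt i * tq n τ ^ i.a ^ 2) = u
  rw [e]
  field_simp

lemma qgt' (hn : n ≠ 0) (i : Idx n) (h : n < i.a ^ 2) : Exp n (i.a ^ 2 - n) (zt i)⁻¹ (fun τ => (f (i.mv hn τ))⁻¹ * f τ) := by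
  have ha := (i.a_pos hn).ne'
  refine ⟨_, (ASer.const (ztinv_mem i)).mul (Useries' hn i), by simp [U_zero, ha, hn], fun τ => ?_⟩
  have h0 := tq_ne_zero n τ
  simp only [f, qq_mv hn]
  rw [← tq_pow hn, one_mul]
  have e : tq n τ ^ (i.a ^ 2) = tq n τ ^ (i.a ^ 2 - n) * tq n τ ^ n := by
    rw [← pow_add]; congr 1; omega
  generalize U (zt i * tq n τ ^ i.a ^ 2) = u
  rw [e]
  field_simp

lemma h_exp (hn : n ≠ 0) (hsq : ¬ IsSquare n) (i : Idx n) :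
    ∃ m c, Exp n m c (fun τ => fM hn i τ * (f τ)⁻¹ - 1) ∧ IU c := by
  have hne : i.a ^ 2 ≠ n := fun h => hsq ⟨i.a, h.symm.trans (sq _)⟩
  simp only [fM, dia]
  split_ifs
  · rcases lt_or_gt_of_ne hne with h | h
    · exact (qlt hn i h).sub_one_iu (Or.inl ⟨by omega, zt_IU i⟩)
    · exact (qgt hn i h).sub_one_iu (Or.inr ⟨rfl, rfl⟩)
  · have h1 := ((fmvinv_exp hn i).mul (finv_exp.level hn)).neg
    have h2 := (h1.congr (G' := fun τ => -(f (i.mv hn τ))⁻¹ * (f τ)⁻¹) (fun τ => by simp))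
    exact h2.sub_one_iu (Or.inl ⟨by have := i.a_pos hn; positivity, ((ztinv_IU i).mul IU.one).neg⟩)

lemma h_exp' (hn : n ≠ 0) (hsq : ¬ IsSquare n) (i : Idx n) :
    ∃ m c, Exp n m c (fun τ => (fM hn i τ)⁻¹ * f τ - 1) ∧ IU c := by
  have hne : i.a ^ 2 ≠ n := fun h => hsq ⟨i.a, h.symm.trans (sq _)⟩
  simp only [fM, dia]
  split_ifs
  · rcases lt_or_gt_of_ne hne with h | h
    · exact (qlt' hn i h).sub_one_iu (Or.inr ⟨rfl, rfl⟩)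
    · exact (qgt' hn i h).sub_one_iu (Or.inl ⟨by omega, ztinv_IU i⟩)
  · have h1 := ((fmv_exp hn i).mul (f_exp.level hn)).neg
    have h2 := (h1.congr (G' := fun τ => (-(f (i.mv hn τ))⁻¹)⁻¹ * f τ) (fun τ => by simp [inv_neg]))
    exact h2.sub_one_iu (Or.inr ⟨by simp, by simp⟩)

lemma root_mem {P : Polynomial ℂ} (hc : ∀ k, P.coeff k ∈ AA) {M : ℕ} (hM : P.natDegree ≤ M) (hu : IU (P.coeff M))
    {x : ℂ} (hx : P.eval x = 0) : x ∈ AA := by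
  apply mem_AA_of_root (p := Polynomial.C (P.coeff M)⁻¹ * P)
  · have hd : P.natDegree = M := le_antisymm hM (Polynomial.le_natDegree_of_ne_zero hu.1)
    rw [Polynomial.Monic, Polynomial.leadingCoeff_mul, Polynomial.leadingCoeff_C, Polynomial.leadingCoeff, hd]
    exact inv_mul_cancel₀ hu.1
  · intro k; rw [Polynomial.coeff_C_mul]; exact AA.mul_mem hu.2 (hc k)
  · rw [Polynomial.IsRoot, Polynomial.eval_mul, hx, mul_zero]

lemma root_mem' {P : Polynomial ℂ} (hc : ∀ k, P.coeff k ∈ AA) (hu : IU (P.coeff 0))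
    {x : ℂ} (hx0 : x ≠ 0) (hx : P.eval x = 0) : x⁻¹ ∈ AA := by
  apply root_mem (P := P.reflect P.natDegree) (M := P.natDegree)
  · intro k; rw [Polynomial.coeff_reflect]; exact hc _
  · refine (Polynomial.natDegree_reflect_le).trans (by simp)
  · rw [Polynomial.coeff_reflect]; simpa using hu
  · letI := invertibleOfNonzero hx0
    have := (Polynomial.eval₂_reflect_eq_zero_iff (RingHom.id ℂ) x P.natDegree P le_rfl).mpr hx
    rwa [invOf_eq_inv] at this

/-- integrality at fixed points of a correspondence -/
theorem unit_of_closing (hn : n ≠ 0) (h5 : ¬ 5 ∣ n) (hsq : ¬ IsSquare n) (i : Idx n) (τ : ℍ) (h : fM hn i τ = f τ) :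
    f τ ∈ AA ∧ (f τ)⁻¹ ∈ AA := by
  have := Idx.finite hn
  have := Fintype.ofFinite (Idx n)
  set F : Idx n → ℍ → ℂ := fun i τ => fM hn i τ * (f τ)⁻¹ - 1 with hF
  have hgood : ∀ i, F i ∈ Good n := fun i =>
    (Good n).sub_mem ((Good n).mul_mem (fM_good hn h5 i) (finv_good hn)) (Good n).one_mem
  set D : ℍ → ℂ := ∏ i, F i with hD
  have hDg : D ∈ Good n := (Good n).prod_mem fun i _ => hgood i
  have hDa : ∀ τ, D τ = ∏ i, F i τ := fun τ => by rw [hD, Finset.prod_apply]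
  have hinv : Inv1 D := by
    intro γ hγ hγ' τ
    obtain ⟨σ, hσ⟩ := rel_perm hn γ
    rw [hDa, hDa]
    refine Fintype.prod_equiv σ _ _ fun i => ?_
    obtain ⟨γ', hr⟩ := hσ i
    simp only [hF]
    rw [fM_smul hn h5 hr hγ, Inv1.f γ hγ hγ', dia, if_pos (Or.inl hγ')]
  obtain ⟨m, c, e1, hc⟩ := Exp.prod (n := n) Finset.univ F (fun i => h_exp hn hsq i)
  obtain ⟨m', c', e2, hc'⟩ := Exp.prod (n := n) Finset.univ (fun i τ => (fM hn i τ)⁻¹ * f τ - 1) (fun i => h_exp' hn hsq i)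
  have e2' : Exp n m' c' (fun τ => D (sig • τ)) := by
    refine e2.congr fun τ => ?_
    obtain ⟨σ, hσ⟩ := rel_perm hn sig
    rw [hDa, Finset.prod_apply]
    refine Fintype.prod_equiv σ _ _ fun i => ?_
    obtain ⟨γ', hr⟩ := hσ i
    simp only [hF]
    rw [fM_smul hn h5 hr (by simp [sig]), f_sig, dia, if_neg (by simp [sig]), inv_neg, inv_inv]
    ring
  rw [← hD] at e1
  have d1 := e1.descend hn hinv.T
  have d2 := e2'.descend hn hinv.sigT
  obtain ⟨k, hk⟩ := d1.1 hc.1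
  obtain ⟨k', hk'⟩ := d2.1 hc'.1
  have g1 := d1.2 k hk
  have g2 := d2.2 k' hk'
  have s1 : Exp 1 1 1 (f + fun τ => (f τ)⁻¹) := by
    have := (f_exp.mono' 1).add finv_exp
    simpa using this
  have s2 : Exp 1 1 (-1) (fun τ => (f + fun τ => (f τ)⁻¹) (sig • τ)) := by
    refine s1.neg.congr fun τ => ?_
    simp only [Pi.add_apply]
    rw [f_sig, inv_neg, inv_inv]; ring
  have hDg2 : D * (f + fun τ => (f τ)⁻¹) ∈ Good n :=
    (Good n).mul_mem hDg ((Good n).add_mem (f_good hn) (finv_good hn))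
  obtain ⟨p, hp, hdeg, hp0, hpM⟩ := principle_aux _ _ _ _ (D * (f + fun τ => (f τ)⁻¹)) (by
      intro γ h1 h2 τ
      simp only [Pi.mul_apply, Pi.add_apply]
      rw [hinv γ h1 h2, Inv1.f γ h1 h2]) hDg2.2 (g1.mul s1) ((g2.mul s2).congr fun τ => rfl)
  have hDτ : D τ = 0 := by
    rw [hDa]
    refine Finset.prod_eq_zero (Finset.mem_univ i) ?_
    simp only [hF]
    rw [h, mul_inv_cancel₀ (f_ne_zero τ), sub_self]
  have hx : (p.map (algebraMap AA ℂ)).eval (f τ) = 0 := by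
    rw [Polynomial.eval_map_algebraMap, ← hp, Pi.mul_apply, hDτ, zero_mul, mul_zero]
  have hco : ∀ k, (p.map (algebraMap AA ℂ)).coeff k = (p.coeff k : ℂ) := fun k => by
    rw [Polynomial.coeff_map]; rfl
  have hco' : ∀ k, (p.map (algebraMap AA ℂ)).coeff k ∈ AA := fun k => by
    rw [hco]; exact Subtype.mem _
  constructor
  · refine root_mem hco' (M := k + 1 + (k' + 1)) (Polynomial.natDegree_map_le.trans hdeg) ?_ hx
    rw [hco, hpM (by omega)]
    exact (IU.one.neg.pow _).mul (hc'.mul IU.one.neg)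
  · refine root_mem' hco' ?_ (f_ne_zero τ) hx
    rw [hco, hp0 (by omega)]
    exact hc.mul IU.one

lemma qq_eq_of_sub {w w' : ℍ} (m : ℤ) (h : (w : ℂ) = w' + m) : qq w = qq w' := by
  rw [qq, qq, h, show 2 * π * I * ((w' : ℂ) + m) = 2 * π * I * w' + m * (2 * π * I) by ring, exp_add,
    Complex.exp_int_mul_two_pi_mul_I, mul_one]

lemma f_eq_of_sub {w w' : ℍ} (m : ℤ) (h : (w : ℂ) = w' + m) : f w = f w' := by
  simp only [f, qq_eq_of_sub m h]
lemma EE_eq_of_sub {w w' : ℍ} (m : ℤ) (h : (w : ℂ) = w' + m) : EE w = EE w' := by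
  simp only [EE_eq, qq_eq_of_sub m h]

/-- the representative `(τ+k)/n` -/
def Idx.mk1 (hn : n ≠ 0) (k : ℤ) : Idx n := ⟨(1, (k % n).toNat, n), by
  have h1 := Int.emod_nonneg k (b := n) (by exact_mod_cast hn)
  have h2 := Int.emod_lt_of_pos k (b := n) (by omega)
  constructor
  · simp
  · simp only; omega⟩

lemma Idx.mk1_a (hn : n ≠ 0) (k : ℤ) : (Idx.mk1 hn k).a = 1 := rfl
lemma Idx.mk1_d (hn : n ≠ 0) (k : ℤ) : (Idx.mk1 hn k).d = n := rfl

lemma Idx.mk1_sub (hn : n ≠ 0) (k : ℤ) (τ w : ℍ) (hw : (w : ℂ) = (τ + k) / n) :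
    (w : ℂ) = (Idx.mk1 hn k).mv hn τ + (k / n : ℤ) := by
  have hn' : (n : ℂ) ≠ 0 := by exact_mod_cast hn
  rw [Idx.coe_mv, hw, Idx.mk1_a, Idx.mk1_d]
  have h1 := Int.emod_nonneg k (b := n) (by exact_mod_cast hn)
  have h3 := Int.emod_add_mul_ediv k n
  have e : ((Idx.mk1 hn k).b : ℤ) = k % n := Int.toNat_of_nonneg h1
  have e' : ((Idx.mk1 hn k).b : ℂ) = ((k % n : ℤ) : ℂ) := by exact_mod_cast e
  have h3' : ((k % n : ℤ) : ℂ) + n * ((k / n : ℤ) : ℂ) = k := by exact_mod_cast h3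
  rw [e']
  field_simp
  push_cast
  linear_combination -h3'

lemma fM_mk1 (hn : n ≠ 0) (k : ℤ) (τ w : ℍ) (hw : (w : ℂ) = (τ + k) / n) : fM hn (Idx.mk1 hn k) τ = f w := by
  rw [fM, Idx.mk1_a, dia, if_pos (by norm_num), f_eq_of_sub _ (Idx.mk1_sub hn k τ w hw)]

lemma phi_mk1 (hn : n ≠ 0) (k : ℤ) (τ w : ℍ) (hw : (w : ℂ) = (τ + k) / n) :
    phi hn (Idx.mk1 hn k) τ = EE w / EE τ := by
  rw [phi, Idx.mk1_a, EE_eq_of_sub _ (Idx.mk1_sub hn k τ w hw)]; simp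

end RR

namespace RR
open Complex Filter Topology ModularForm
open UpperHalfPlane hiding I
open Matrix (SpecialLinearGroup)
open scoped MatrixGroups CongruenceSubgroup Manifold

local notation "π" => (Real.pi : ℂ)

/-- `sqrt (-5 l)` -/
noncomputable def om (l : ℕ) : ℂ := I * (Real.sqrt (5 * l) : ℂ)

lemma om_sq (l : ℕ) : om l ^ 2 = -(5 * l) := by
  rw [om, mul_pow, I_sq, ← ofReal_pow, Real.sq_sqrt (by positivity)]; push_cast; ring

lemma om_im (l : ℕ) : (om l).im = Real.sqrt (5 * l) := by simp [om]
lemma om_re (l : ℕ) : (om l).re = 0 := by simp [om]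

lemma om_im_pos {l : ℕ} (hl : 0 < l) : 0 < (om l).im := by
  rw [om_im]; positivity

lemma tau_im {l a : ℕ} (hl : 0 < l) (ha : 0 < a) (b : ℤ) : 0 < ((om l - 5 * b) / (5 * a)).im := by
  have : ((om l - 5 * b) / (5 * a)).im = (om l).im / (5 * a) := by
    rw [show (5 * (a : ℂ)) = ((5 * a : ℝ) : ℂ) by push_cast; rfl, div_ofReal_im, sub_im,
      show (5 * (b : ℂ)) = ((5 * b : ℝ) : ℂ) by push_cast; rfl, ofReal_im, sub_zero]
  rw [this]
  have := om_im_pos hl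
  positivity

open Classical in
/-- CM points -/
noncomputable def tau (l a : ℕ) (b : ℤ) : ℍ :=
  if h : 0 < ((om l - 5 * b) / (5 * a)).im then ⟨(om l - 5 * b) / (5 * a), h⟩ else UpperHalfPlane.I

lemma coe_tau {l a : ℕ} (hl : 0 < l) (ha : 0 < a) (b : ℤ) : (tau l a b : ℂ) = (om l - 5 * b) / (5 * a) := by
  rw [tau, dif_pos (tau_im hl ha b)]

lemma tau_quad {l a : ℕ} (hl : 0 < l) (ha : 0 < a) {b C : ℤ} (hC : a * C = 5 * b ^ 2 + l) :
    5 * a * (tau l a b : ℂ) ^ 2 + 10 * b * tau l a b + C = 0 := by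
  have ha' : (a : ℂ) ≠ 0 := by exact_mod_cast ha.ne'
  have hC' : (a : ℂ) * C = 5 * b ^ 2 + l := by exact_mod_cast hC
  rw [coe_tau hl ha]
  field_simp
  linear_combination om_sq l + 5 * hC'

theorem closing {l a : ℕ} (hl : 0 < l) (ha : 0 < a) {b C : ℤ} (hC : a * C = 5 * b ^ 2 + l)
    {d : ℕ} (hd : d.Prime) (hd5 : d ≠ 5) (hbig : 5 * a * C < d) :
    ∃ (N : ℕ) (k : ℤ) (γ : SL(2,ℤ)), (N : ℤ) = (d - 5 * b) ^ 2 + 5 * l ∧ N ≠ 0 ∧ ¬ 5 ∣ N ∧ (N : ℤ) ∣ C + k * d ∧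
      γ 1 0 = 5 * a ∧ γ 1 1 = d ∧ ((γ • tau l a b : ℍ) : ℂ) = (tau l a b - k) / N := by
  have hlz : (0 : ℤ) < l := by exact_mod_cast hl
  have haz : (0 : ℤ) < a := by exact_mod_cast ha
  obtain ⟨N, hN⟩ : ∃ N : ℕ, (N : ℤ) = (d - 5 * b) ^ 2 + 5 * l :=
    ⟨((d - 5 * b) ^ 2 + 5 * l : ℤ).toNat, Int.toNat_of_nonneg (by positivity)⟩
  have hNpos : (0 : ℤ) < N := by rw [hN]; positivity
  have hN0 : N ≠ 0 := by rintro rfl; simp at hNpos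
  have hNe : (N : ℤ) = d * (d - 10 * b) + 5 * a * C := by rw [hN]; linear_combination -5 * hC
  have hCpos : 0 < C := by
    by_contra h
    push Not at h
    have : (a : ℤ) * C ≤ 0 := mul_nonpos_of_nonneg_of_nonpos haz.le h
    nlinarith
  have hdp : Prime (d : ℤ) := Nat.prime_iff_prime_int.mp hd
  have hcop : IsCoprime (d : ℤ) N := by
    rw [hdp.coprime_iff_not_dvd, hNe]
    intro h
    have h1 : (d : ℤ) ∣ 5 * a * C := (Int.dvd_add_right (Dvd.intro _ rfl)).mp h
    have := Int.le_of_dvd (by positivity) h1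
    omega
  have h5d : ¬ (5 : ℤ) ∣ d := by
    intro h
    have h : 5 ∣ d := by exact_mod_cast h
    exact hd5 ((Nat.prime_dvd_prime_iff_eq Nat.prime_five hd).mp h).symm
  have h5 : ¬ 5 ∣ N := by
    intro h
    have h : (5 : ℤ) ∣ N := by exact_mod_cast h
    rw [hNe] at h
    have h : (5 : ℤ) ∣ d * (d - 10 * b) := (Int.dvd_add_left ⟨a * C, by ring⟩).mp h
    rcases (Nat.prime_iff_prime_int.mp Nat.prime_five).dvd_mul.mp (by exact_mod_cast h) with h | h
    · exact h5d (by exact_mod_cast h)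
    · apply h5d; have := dvd_add (by exact_mod_cast h : (5:ℤ) ∣ d - 10 * b) (⟨2 * b, by ring⟩ : (5:ℤ) ∣ 10 * b); simpa using this
  obtain ⟨u, v, huv⟩ := hcop
  have hk : (N : ℤ) ∣ C + (-C * u) * d := ⟨v * C, by linear_combination (-C) * huv⟩
  set k := -C * u
  have hα : (N : ℤ) ∣ d - 10 * b - 5 * a * k := by
    have : (N : ℤ) ∣ d * (d - 10 * b - 5 * a * k) := by
      obtain ⟨e, he⟩ := hk
      exact ⟨1 - 5 * a * e, by linear_combination (-5 * a) * he - hNe⟩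
    exact (IsCoprime.symm ⟨u, v, huv⟩).dvd_of_dvd_mul_left this
  have hk0 := hk
  obtain ⟨e, he⟩ := hk
  obtain ⟨α, hα⟩ := hα
  have hdet : α * d - (-e) * (5 * a) = 1 := by
    have : (N : ℤ) * (α * d - (-e) * (5 * a)) = N * 1 := by
      linear_combination (-(d:ℤ)) * hα - 5 * a * he - hNe
    exact mul_left_cancel₀ hNpos.ne' this
  refine ⟨N, k, mkSL α (-e) (5 * a) d hdet, hN, hN0, h5, hk0, by simp, by simp, ?_⟩
  have hden := den_ne_zero (mkSL α (-e) (5 * a) d hdet) (tau l a b)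
  rw [coe_smul]
  simp only [mkSL_00, mkSL_01, mkSL_10, mkSL_11] at hden ⊢
  have hNc : (N : ℂ) ≠ 0 := by exact_mod_cast hN0
  rw [div_eq_div_iff hden hNc]
  have hq := tau_quad hl ha hC
  have he' : (C : ℂ) + k * d = N * e := by exact_mod_cast he
  have hα' : (d : ℂ) - 10 * b - 5 * a * k = N * α := by exact_mod_cast hα
  push_cast
  linear_combination (-1 : ℂ) * hq - (tau l a b : ℂ) * hα' + he'

lemma not_sq {m l : ℤ} (hl : 0 < l) (hm : 5 * l < m) {N : ℕ} (hN : (N : ℤ) = m ^ 2 + 5 * l) : ¬ IsSquare N := by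
  rintro ⟨r, hr⟩
  have hr' : (r : ℤ) * r = m ^ 2 + 5 * l := by rw [← hN, hr]; push_cast; ring
  rcases le_or_gt (r : ℤ) m with h | h
  · nlinarith
  · nlinarith

/-- the values `f(τ)` at CM points are units -/
theorem unit_tau {l a : ℕ} (hl : 0 < l) (ha : 0 < a) {b C : ℤ} (hC : a * C = 5 * b ^ 2 + l) :
    f (tau l a b) ∈ AA ∧ (f (tau l a b))⁻¹ ∈ AA := by
  obtain ⟨d, hdgt, hd, hd5⟩ := Nat.forall_exists_prime_gt_and_zmodEq (q := 5) (a := 1) (5 + (5 * a * C).natAbs + (5 * b).natAbs + 5 * l)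
    (by norm_num) isCoprime_one_left
  obtain ⟨N, k, γ, hN, hN0, h5, -, h10, h11, hw⟩ := closing hl ha hC hd (by omega) (by omega)
  have hsq : ¬ IsSquare N := not_sq (m := d - 5 * b) (l := l) (by exact_mod_cast hl) (by omega) hN
  refine unit_of_closing hN0 h5 hsq (Idx.mk1 hN0 (-k)) _ ?_
  rw [fM_mk1 hN0 (-k) _ (γ • tau l a b) (by rw [hw]; push_cast; ring), f_smul γ (by rw [h10]; exact Dvd.intro _ rfl), dia, if_pos]
  left
  have hdet := det_eq γ
  rw [h10, h11] at hdet
  have hd5' : (d : ℤ) % 5 = 1 := hd5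
  have : (γ 0 0 * d) % 5 = 1 := by
    rw [show γ 0 0 * (d:ℤ) = 1 + 5 * (γ 0 1 * a) by linear_combination hdet]; omega
  rwa [Int.mul_emod, hd5', mul_one, Int.emod_emod] at this

end RR

namespace RR
open Complex Filter Topology ModularForm
open UpperHalfPlane hiding I
open Matrix (SpecialLinearGroup)
open scoped MatrixGroups CongruenceSubgroup Manifold

local notation "π" => (Real.pi : ℂ)

lemma zmod_series_pow (p : ℕ) [Fact p.Prime] (φ : PowerSeries (ZMod p)) (k : ℕ) :
    PowerSeries.coeff k (φ ^ p) = if p ∣ k then PowerSeries.coeff (k / p) φ else 0 := by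
  have hp := (Fact.out : p.Prime).pos
  have h1 : PowerSeries.coeff k (φ ^ p) = ((PowerSeries.trunc (k + 1) φ) ^ p).coeff k := by
    have := PowerSeries.trunc_trunc_pow φ (k + 1) p
    have h2 := congrArg (fun q => Polynomial.coeff q k) this
    simp only [PowerSeries.coeff_trunc, Nat.lt_succ_self, if_true] at h2
    rw [← h2, ← Polynomial.coe_pow, Polynomial.coeff_coe]
  rw [h1, ← ZMod.expand_card, Polynomial.coeff_expand hp]
  split_ifs with h
  · rw [PowerSeries.coeff_trunc, if_pos (Nat.lt_succ_of_le (Nat.div_le_self _ _))]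
  · rfl

lemma IntSer.frob {F : ℂ → ℂ} (h : IntSer F) {p : ℕ} (hp : p.Prime) :
    ∃ W, IntSer W ∧ ∀ x : ℂ, ‖x‖ < 1 → F x ^ p - F (x ^ p) = p * W x := by
  obtain ⟨φ, hφ⟩ := h
  have := Fact.mk hp
  set ψ : PowerSeries ℤ := PowerSeries.mk fun k => if p ∣ k then PowerSeries.coeff (k / p) φ else 0 with hψ
  have hs : Ser (ψ.map (Int.castRingHom ℂ)) (fun x => F (x ^ p)) := by
    intro x hx
    have h1 := hφ (x ^ p) (by rw [norm_pow]; exact pow_lt_one₀ (norm_nonneg _) hx hp.ne_zero)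
    have hinj : Function.Injective (fun k : ℕ => p * k) := fun a b hab =>
      Nat.eq_of_mul_eq_mul_left hp.pos hab
    rw [← hinj.hasSum_iff]
    · refine h1.congr_fun ?_ |> fun h => h
      intro k
      simp [hψ, Nat.mul_div_cancel_left _ hp.pos, pow_mul]
    · intro k hk
      have : ¬ p ∣ k := fun ⟨j, hj⟩ => hk ⟨j, hj.symm⟩
      simp [hψ, this]
  have hdvd : ∀ k, (p : ℤ) ∣ PowerSeries.coeff k (φ ^ p - ψ) := by
    intro k
    rw [← ZMod.intCast_zmod_eq_zero_iff_dvd]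
    have h1 : ((PowerSeries.coeff k (φ ^ p) : ℤ) : ZMod p) = PowerSeries.coeff k ((φ.map (Int.castRingHom (ZMod p))) ^ p) := by
      rw [← map_pow, PowerSeries.coeff_map]; rfl
    rw [map_sub, Int.cast_sub, h1, zmod_series_pow, hψ, PowerSeries.coeff_mk]
    split_ifs <;> simp
  choose w hw using hdvd
  have e : φ ^ p - ψ = PowerSeries.C (p : ℤ) * PowerSeries.mk w := by
    ext k; rw [hw, PowerSeries.coeff_C_mul, PowerSeries.coeff_mk]
  have hp0 : (p : ℂ) ≠ 0 := by exact_mod_cast hp.ne_zero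
  refine ⟨fun x => (p : ℂ)⁻¹ * (F x ^ p - F (x ^ p)), ⟨PowerSeries.mk w, ?_⟩, fun x _ => by field_simp⟩
  have h2 := (hφ.pow p).sub hs
  rw [← map_pow, ← map_sub, e, map_mul] at h2
  intro x hx
  have h3 := (h2 x hx).mul_left (p : ℂ)⁻¹
  refine h3.congr_fun ?_ |> fun h => h
  intro k
  rw [PowerSeries.map_C, PowerSeries.coeff_C_mul]
  simp
  field_simp

section
variable {p : ℕ}

/-- the congruence functions -/
noncomputable def chi (hn : p ≠ 0) (i : Idx p) : ℍ → ℂ := fun τ => (p : ℂ)⁻¹ * ((fM hn i τ ^ p - f τ) * phi hn i τ)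

lemma quot_exp (hn : p ≠ 0) (i : Idx p) : ∃ c, Exp p (24 * p) c (fun τ => EE (i.mv hn τ) / EE τ) := by
  have ha := (i.a_pos hn).ne'
  refine ⟨_, _, ((((ASer.const (zt_mem i)).mul (ASer.X_pow (i.a ^ 2))).pow 24).mul
    (V_intSer.aser.comp_scale (zt_mem i) (zt_norm i) (pow_ne_zero 2 ha))).mul
      (Vinv_intSer.aser.comp_scale AA.one_mem (by simp) hn), rfl, fun τ => ?_⟩
  have h0 := qq_ne_zero τ
  have h1 := V_ne_zero (norm_qq_lt τ)
  simp only [EE_eq, qq_mv hn, one_mul, tq_pow hn]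
  rw [mul_comm 24 p, pow_mul, tq_pow hn]
  field_simp

lemma pm_good (hn : p ≠ 0) (h5 : ¬ 5 ∣ p) (i : Idx p) : (fun τ => fM hn i τ ^ p - f τ) ∈ Good p :=
  (Good p).sub_mem ((Good p).pow_mem (fM_good hn h5 i) p) (f_good hn)

lemma Good.exp {n : ℕ} {G : ℍ → ℂ} (h : G ∈ Good n) : ∃ m c, Exp n m c G := by
  have := h.1 1 (by simp)
  simpa using this

lemma chi_exp (hp : p.Prime) (h5 : ¬ 5 ∣ p) (i : Idx p) : ∃ m c, Exp p m c (chi hp.ne_zero i) := by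
  have hn := hp.ne_zero
  have hp0 : (p : ℂ) ≠ 0 := by exact_mod_cast hn
  rcases (Nat.dvd_prime hp).mp (Dvd.intro _ i.had : i.a ∣ p) with ha | ha
  · have hd : i.d = p := by simpa [ha] using i.had
    obtain ⟨W, hW, hWe⟩ := U_intSer.frob hp
    obtain ⟨c, hc⟩ := phi_exp hn i
    obtain ⟨c', e⟩ : ∃ c', Exp p 0 c' (fun τ => (p : ℂ)⁻¹ * (fM hn i τ ^ p - f τ)) := by
      refine ⟨_, _, (ASer.X_pow p).mul (hW.aser.comp_scale (zt_mem i) (zt_norm i) one_ne_zero), rfl, fun τ => ?_⟩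
      have hz : zt i ^ p = 1 := by have := zt_pow i; rwa [hd] at this
      have hx : ‖zt i * tq p τ ^ 1‖ < 1 := by
        rw [norm_mul, zt_norm, one_mul, pow_one]; exact norm_tq_lt hn τ
      have h1 := hWe _ hx
      rw [pow_one, mul_pow, hz, one_mul] at h1
      beta_reduce
      rw [fM, ha, dia, if_pos (by norm_num), f, f, qq_mv, ha, one_pow, pow_one, pow_zero, one_mul, ← tq_pow hn, mul_pow, mul_pow, hz]
      field_simp
      linear_combination tq p τ ^ p * h1
    refine ⟨_, _, (e.mul hc).congr fun τ => ?_⟩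
    simp only [chi, Pi.mul_apply]; ring
  · obtain ⟨c, hc⟩ := quot_exp hn i
    obtain ⟨m, c', hc'⟩ := Good.exp (pm_good hn h5 i)
    refine ⟨_, _, ((Exp.smul (AA.pow_mem (intCast_mem p) 47) hc).mul hc').congr fun τ => ?_⟩
    simp only [chi, Pi.mul_apply, phi, ha]
    push_cast
    field_simp

lemma chi_smul (hp : p.Prime) (hp2 : p ≠ 2) (h5 : ¬ 5 ∣ p) {i j : Idx p} {γ γ' : SL(2,ℤ)} (h : Rel i γ γ' j) (hγ : (5:ℤ) ∣ γ 1 0) (τ : ℍ) :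
    chi hp.ne_zero i (γ • τ) = chi hp.ne_zero j τ * (if γ 0 0 % 5 = 1 ∨ γ 0 0 % 5 = 4 then 1 else (fM hp.ne_zero j τ)⁻¹ ^ p * (f τ)⁻¹) := by
  have hodd := hp.odd_of_ne_two hp2
  rw [chi, chi, fM_smul hp.ne_zero h5 h hγ, f_smul γ hγ, phi_smul hp.ne_zero h5 h hγ]
  have h1 := fM_ne_zero hp.ne_zero j τ
  have h2 := f_ne_zero τ
  simp only [dia]
  split_ifs with h
  · ring
  · rw [hodd.neg_pow]
    have h3 := pow_ne_zero p h1
    rw [inv_pow]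
    field_simp
    ring

lemma chi_good (hp : p.Prime) (hp2 : p ≠ 2) (h5 : ¬ 5 ∣ p) (i : Idx p) : chi hp.ne_zero i ∈ Good p := by
  have hn := hp.ne_zero
  refine ⟨fun γ hγ => ?_, ?_⟩
  · obtain ⟨γ', j, h⟩ := rel_exists hn i γ
    simp only [chi_smul hp hp2 h5 h hγ]
    obtain ⟨m, c, hc⟩ := chi_exp hp h5 j
    split_ifs with hh
    · exact ⟨m, c, by simpa using hc⟩
    · obtain ⟨m', c', hc'⟩ := Good.exp ((Good p).mul_mem ((Good p).pow_mem (fMinv_good hn h5 j) p) (finv_good hn))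
      exact ⟨_, _, hc.mul hc'⟩
  · exact Bd0.smul _ ((pm_good hn h5 i).2.mul (phi_good hn h5 i).2)

theorem chi_mem (hp : p.Prime) (hp2 : p ≠ 2) (h5 : ¬ 5 ∣ p) (i : Idx p) {τ : ℍ} (h1 : f τ ∈ AA) (h2 : (f τ)⁻¹ ∈ AA) :
    chi hp.ne_zero i τ ∈ AA := by
  have hn := hp.ne_zero
  have := Idx.finite hn
  have := Fintype.ofFinite (Idx p)
  refine lemmaH hn (chi hn) (chi_good hp hp2 h5) (fun γ hγ hγ1 => ?_) h1 h2 i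
  obtain ⟨σ, hσ⟩ := rel_perm hn γ
  refine ⟨σ, fun i τ => ?_⟩
  obtain ⟨γ', h⟩ := hσ i
  rw [chi_smul hp hp2 h5 h hγ τ, if_pos (Or.inl hγ1), mul_one]
end

/-- the core congruence -/
theorem core {l a p : ℕ} (hl : 0 < l) (ha : 0 < a) (hp : p.Prime) (hp10 : ¬ p ∣ 10 * l) {b : ℤ}
    (hdvd : ((p * a : ℕ) : ℤ) ∣ 5 * b ^ 2 + l) :
    ∃ z ∈ AA, ∃ d : ℤ, (p : ℤ) ∣ d - 10 * b ∧ (f (tau l (p * a) b) ^ p - f (tau l a b)) * (om l - 5 * b + d) ^ 48 = p * z := by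
  obtain ⟨C', hC'⟩ := hdvd
  have hn := hp.ne_zero
  have hpa : 0 < p * a := Nat.mul_pos hp.pos ha
  have hpp : Prime (p : ℤ) := Nat.prime_iff_prime_int.mp hp
  have hp2 : p ≠ 2 := by rintro rfl; exact hp10 ⟨5 * l, by ring⟩
  have hp5 : p ≠ 5 := by rintro rfl; exact hp10 ⟨2 * l, by ring⟩
  have h5 : ¬ 5 ∣ p := fun h => hp5 ((Nat.prime_dvd_prime_iff_eq Nat.prime_five hp).mp h).symm
  have hC1 : (a : ℤ) * (p * C') = 5 * b ^ 2 + l := by rw [hC']; push_cast; ring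
  have hC2 : ((p * a : ℕ) : ℤ) * C' = 5 * b ^ 2 + l := hC'.symm
  have hpb : ¬ (p : ℤ) ∣ 10 * b := by
    intro h
    apply hp10
    rcases hpp.dvd_mul.mp h with h | h
    · exact Dvd.dvd.mul_right (by exact_mod_cast h) l
    · have : (p : ℤ) ∣ l := by
        have h1 : (p : ℤ) ∣ 5 * b ^ 2 + l := ⟨a * C', by rw [hC']; push_cast; ring⟩
        exact (Int.dvd_add_right (Dvd.dvd.mul_left (h.trans (Dvd.intro_left _ (by ring : b * b = b ^ 2))) 5)).mp h1
      exact Dvd.dvd.mul_left (by exact_mod_cast this) 10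
  obtain ⟨d, hdgt, hd, hdm⟩ := Nat.forall_exists_prime_gt_and_zmodEq (q := p) (a := 10 * b) (5 + p + (5 * a * (p * C')).natAbs)
    hn ((Prime.coprime_iff_not_dvd hpp).mpr hpb).symm
  have hdm' : (p : ℤ) ∣ d - 10 * b := hdm.symm.dvd
  obtain ⟨N, k, γ, hN, hN0, hN5, hNk, h10, h11, hw⟩ := closing hl ha hC1 hd (by omega) (by omega)
  have hNe : (N : ℤ) = d * (d - 10 * b) + p * (5 * a * C') := by rw [hN]; linear_combination -5 * hC1
  have hpN : (p : ℤ) ∣ N := by rw [hNe]; exact dvd_add (Dvd.dvd.mul_left hdm' _) (Dvd.intro _ rfl)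
  have hpd : ¬ (p : ℤ) ∣ d := by
    intro h
    have h : p ∣ d := by exact_mod_cast h
    have := (Nat.prime_dvd_prime_iff_eq hp hd).mp h
    omega
  have hpk : (p : ℤ) ∣ k := by
    have h1 : (p : ℤ) ∣ k * d := (Int.dvd_add_right (Dvd.intro _ rfl)).mp (hpN.trans hNk)
    exact (hpp.dvd_mul.mp h1).resolve_right hpd
  obtain ⟨k', rfl⟩ := hpk
  obtain ⟨N', rfl⟩ : p ∣ N := by exact_mod_cast hpN
  have hN'0 : N' ≠ 0 := by rintro rfl; simp at hN0
  have hN'5 : ¬ 5 ∣ N' := fun h => hN5 (h.mul_left p)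
  have hpc : (p : ℂ) ≠ 0 := by exact_mod_cast hn
  have hac : (a : ℂ) ≠ 0 := by exact_mod_cast ha.ne'
  have hN'c : (N' : ℂ) ≠ 0 := by exact_mod_cast hN'0
  set τ := tau l a b with hτ
  set w := tau l (p * a) b with hwd
  have hwτ : (w : ℂ) = (τ + (0 : ℤ)) / p := by
    rw [hwd, hτ, coe_tau hl hpa, coe_tau hl ha]; push_cast; field_simp; ring
  have hγw : ((γ • τ : ℍ) : ℂ) = (w + (-k' : ℤ)) / N' := by
    rw [hw, hwτ]; push_cast; field_simp; ring
  have u1 := unit_tau hl ha hC1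
  have u2 := unit_tau hl hpa hC2
  have m1 := chi_mem hp hp2 h5 (Idx.mk1 hn 0) u1.1 u1.2
  have m2 := phi_mem hN'0 hN'5 (Idx.mk1 hN'0 (-k')) u2.1 u2.2
  rw [← hτ] at m1
  rw [← hwd, phi_mk1 hN'0 _ _ _ hγw] at m2
  refine ⟨_, AA.mul_mem m1 m2, d, hdm', ?_⟩
  rw [chi, fM_mk1 hn _ _ _ hwτ, phi_mk1 hn _ _ _ hwτ, EE_smul γ (by rw [h10]; exact Dvd.intro _ rfl), h10, h11]
  have e1 := EE_ne_zero τ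
  have e2 := EE_ne_zero w
  have e3 : (((5 * (a : ℤ) : ℤ) : ℂ) * τ + ((d : ℤ) : ℂ)) = om l - 5 * b + (d : ℤ) := by
    rw [hτ, coe_tau hl ha]; push_cast; field_simp
  rw [e3]
  field_simp

end RR

namespace RR
open Complex Filter Topology ModularForm
open UpperHalfPlane hiding I
open Matrix (SpecialLinearGroup)
open scoped MatrixGroups CongruenceSubgroup Manifold

local notation "π" => (Real.pi : ℂ)

lemma PS_near (S : Set ℕ) {x : ℂ} (hx : ‖x‖ ≤ 1 / 8) : ‖PS S x - 1‖ ≤ 2 / 13 := by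
  have hx1 : ‖x‖ < 1 := by linarith
  have h := tprod_near_one (PS_summable S hx1).hasSum
  have hs : ∑' n, ‖S.indicator (fun n => -x ^ (n + 1)) n‖ ≤ 1 / 7 := by
    have h1 : HasSum (fun n => ‖x‖ ^ (n + 1)) (‖x‖ / (1 - ‖x‖)) := by
      have := (hasSum_geometric_of_lt_one (norm_nonneg x) hx1).mul_left ‖x‖
      rw [← div_eq_mul_inv] at this
      exact this.congr_fun (fun n => by ring) |> fun h => h
    refine ((PS_summable S hx1).tsum_le_tsum (fun n => PS_term_norm S x n) h1.summable).trans ?_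
    rw [h1.tsum_eq, div_le_div_iff₀ (by linarith) (by norm_num)]
    linarith
  refine h.trans ?_
  have h2 : Real.exp (1 / 7) ≤ 15 / 13 := by
    have h3 := Real.one_sub_le_exp_neg (1 / 7)
    have h4 : Real.exp (1 / 7) * Real.exp (-(1 / 7)) = 1 := by rw [← Real.exp_add]; simp
    have h5 := Real.exp_bound_div_one_sub_of_interval' (x := 1 / 7) (by norm_num) (by norm_num)
    have h6 : Real.exp (1/7) = Real.exp (1 / 14) * Real.exp (1 / 14) := by rw [← Real.exp_add]; norm_num
    have h8 := Real.quadratic_le_exp_of_nonneg (x := 1 / 7) (by norm_num)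
    have h7 := Real.exp_bound' (x := 1 / 7) (by norm_num) (by norm_num) (n := 3) (by norm_num)
    norm_num [Finset.sum_range_succ, Nat.factorial] at h7
    linarith
  have h3 := Real.exp_le_exp.mpr hs
  linarith

lemma U_bound {x : ℂ} (hx : ‖x‖ ≤ 1 / 8) : ‖U x‖ ≤ 5 := by
  have hx1 : ‖x‖ < 1 := by linarith
  have h1 := PS_near QR hx
  have h2 := PS_near NR hx
  have h3 : ‖PS QR x‖ ≤ 15 / 13 := by
    have := norm_add_le (PS QR x - 1) 1
    simp only [sub_add_cancel, norm_one] at this; linarith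
  have h4 : 11 / 13 ≤ ‖PS NR x‖ := by
    have := norm_sub_norm_le 1 (1 - PS NR x)
    rw [norm_sub_rev] at h2
    simp only [sub_sub_cancel, norm_one] at this; linarith
  rw [U_eq hx1, norm_mul, norm_inv, norm_pow, norm_pow, ← div_eq_mul_inv, div_le_iff₀ (by positivity)]
  calc ‖PS QR x‖ ^ 5 ≤ (15 / 13) ^ 5 := by gcongr
    _ ≤ 5 * (11 / 13) ^ 5 := by norm_num
    _ ≤ _ := by gcongr

lemma U_lip {x y : ℂ} (hx : ‖x‖ ≤ 1 / 200) (hy : ‖y‖ ≤ 1 / 200) : ‖U y - U x‖ ≤ 125 / 3 * ‖y - x‖ := by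
  obtain ⟨φ, hφ⟩ := U_intSer
  have hd := hφ.differentiableOn
  refine Convex.norm_image_sub_le_of_norm_deriv_le (s := Metric.closedBall 0 (1 / 200)) (f := U) (fun z hz => ?_) (fun z hz => ?_)
    (convex_closedBall _ _) (by simpa using hx) (by simpa using hy)
  · have hz : ‖z‖ ≤ 1 / 200 := by simpa using hz
    exact hd.differentiableAt (Metric.isOpen_ball.mem_nhds (by simp; linarith))
  · have hz : ‖z‖ ≤ 1 / 200 := by simpa using hz
    have h := Complex.norm_deriv_le_of_forall_mem_sphere_norm_le (c := z) (R := 3 / 25) (C := 5) (f := U) (by norm_num) ?_ ?_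
    · refine h.trans (by norm_num)
    · refine DifferentiableOn.diffContOnCl (hd.mono ?_)
      refine (Metric.closure_ball_subset_closedBall).trans ?_
      intro w hw
      rw [Metric.mem_closedBall, dist_eq_norm] at hw
      have := norm_add_le (w - z) z
      rw [sub_add_cancel] at this
      simp; linarith
    · intro w hw
      apply U_bound
      rw [mem_sphere_iff_norm] at hw
      have := norm_add_le (w - z) z
      rw [sub_add_cancel] at this
      linarith

lemma U_near {x : ℂ} (hx : ‖x‖ ≤ 1 / 200) : ‖U x - 1‖ ≤ 5 / 24 := by
  have := U_lip (x := 0) (by simp) hx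
  rw [U_zero, sub_zero] at this
  linarith

lemma xU_inj {x y : ℂ} (hx : ‖x‖ ≤ 1 / 200) (hy : ‖y‖ ≤ 1 / 200) (h : x * U x = y * U y) : x = y := by
  by_contra hne
  have hpos : 0 < ‖y - x‖ := norm_pos_iff.mpr (sub_ne_zero.mpr (Ne.symm hne))
  have e : (y - x) * U x = y * (U x - U y) := by linear_combination -h
  have h1 := congrArg norm e
  rw [norm_mul, norm_mul, norm_sub_rev (U x)] at h1
  have h2 := U_lip hx hy
  have h3 : 19 / 24 ≤ ‖U x‖ := by
    have := norm_sub_norm_le 1 (1 - U x)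
    have h2 := U_near hx
    rw [norm_sub_rev] at h2
    simp only [sub_sub_cancel, norm_one] at this; linarith
  have h4 : ‖y - x‖ * (19 / 24) ≤ ‖y - x‖ * ‖U x‖ := by gcongr
  have h5 : ‖y‖ * ‖U y - U x‖ ≤ 1 / 200 * (125 / 3 * ‖y - x‖) := by gcongr
  linarith

lemma norm_f_le {τ : ℍ} (h : ‖qq τ‖ ≤ 1 / 200) : ‖f τ‖ ≤ ‖qq τ‖ * (29 / 24) := by
  rw [f, norm_mul]
  gcongr
  have := norm_add_le (U (qq τ) - 1) 1
  have h2 := U_near h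
  simp only [sub_add_cancel, norm_one] at this; linarith

lemma qq_eq_imp {τ τ' : ℍ} (h : qq τ = qq τ') : ∃ m : ℤ, τ' = ModularGroup.T ^ m • τ := by
  rw [qq, qq, Complex.exp_eq_exp_iff_exists_int] at h
  obtain ⟨m, hm⟩ := h
  refine ⟨-m, UpperHalfPlane.ext_iff.mpr ?_⟩
  rw [UpperHalfPlane.modular_T_zpow_smul]
  rw [UpperHalfPlane.coe_vadd]
  have hp := Complex.two_pi_I_ne_zero
  have : 2 * π * I * ((τ' : ℂ)) = 2 * π * I * (τ - m) := by linear_combination -hm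
  have := mul_left_cancel₀ hp this
  rw [this]; push_cast; ring

lemma exp_bounds : (200 : ℝ) ≤ Real.exp 5.4 ∧ (20000 : ℝ) ≤ Real.exp 10 ∧ (1000 / 337 : ℝ) ≤ Real.exp 1.088 := by
  have he := Real.exp_one_gt_d9
  refine ⟨?_, ?_, ?_⟩
  · have h1 : Real.exp 5.4 = Real.exp 1 ^ 5 * Real.exp 0.4 := by
      rw [← Real.exp_nat_mul, ← Real.exp_add]; norm_num
    have h2 := Real.add_one_le_exp (0.4 : ℝ)
    rw [h1]
    calc (200 : ℝ) ≤ 2.7182818283 ^ 5 * (0.4 + 1) := by norm_num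
      _ ≤ _ := by gcongr
  · have h1 : Real.exp 10 = Real.exp 1 ^ 10 := by rw [← Real.exp_nat_mul]; norm_num
    rw [h1]
    calc (20000 : ℝ) ≤ 2.7182818283 ^ 10 := by norm_num
      _ ≤ _ := by gcongr
  · have h1 : Real.exp 1.088 = Real.exp 1 * Real.exp 0.088 := by rw [← Real.exp_add]; norm_num
    have h2 := Real.quadratic_le_exp_of_nonneg (x := 0.088) (by norm_num)
    rw [h1]
    calc (1000 / 337 : ℝ) ≤ 2.7182818283 * (1 + 0.088 + 0.088 ^ 2 / 2) := by norm_num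
      _ ≤ _ := by gcongr

lemma exp_neg_le {x y B : ℝ} (hB : 0 < B) (h : B ≤ Real.exp y) (hxy : y ≤ x) : Real.exp (-x) ≤ 1 / B := by
  rw [Real.exp_neg, ← one_div]
  exact one_div_le_one_div_of_le hB (h.trans (Real.exp_le_exp.mpr hxy))

lemma qq_tau0 {l : ℕ} (hl : 13 ≤ l) : ‖qq (tau l 1 0)‖ ≤ 1 / 20000 := by
  have him : (tau l 1 0).im = Real.sqrt (5 * l) / 5 := by
    have h := coe_tau (l := l) (a := 1) (by omega) one_pos 0
    have h2 := congrArg Complex.im h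
    rw [UpperHalfPlane.coe_im] at h2
    rw [h2, ← om_im, show (5 * ((1 : ℕ) : ℂ)) = ((5 : ℝ) : ℂ) by push_cast; ring, Complex.div_ofReal_im]
    simp
  have h1 : 8.05 ≤ Real.sqrt (5 * l) := by
    apply Real.le_sqrt_of_sq_le
    have : (13 : ℝ) ≤ l := by exact_mod_cast hl
    norm_num; linarith
  rw [norm_qq, him]
  have := exp_neg_le (x := 2 * Real.pi * (Real.sqrt (5 * l) / 5)) (by norm_num) exp_bounds.2.1 (by
    have := Real.pi_gt_d4
    nlinarith)
  convert this using 2; ring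

lemma f_tau0 {l : ℕ} (hl : 13 ≤ l) : ‖f (tau l 1 0)‖ < 11 / 100000 := by
  have h := qq_tau0 hl
  have := norm_f_le (h.trans (by norm_num))
  linarith

lemma neg_inv_eq {x y : ℂ} (h : -x⁻¹ = y) : x = -y⁻¹ := by rw [← h, inv_neg, inv_inv, neg_neg]

/-- near the cusp `∞`, the function `f` separates `Γ₀(5)`-orbits up to the diamond involution -/
theorem near_cusp {l : ℕ} (hl : 13 ≤ l) {τ : ℍ} (h : f τ = f (tau l 1 0) ∨ f τ = -(f (tau l 1 0))⁻¹) :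
    ∃ γ : SL(2,ℤ), (5:ℤ) ∣ γ 1 0 ∧ γ • τ = tau l 1 0 := by
  obtain ⟨δ, hδ⟩ := ModularGroup.exists_smul_mem_fd τ
  have h3 := ModularGroup.three_le_four_mul_im_sq_of_mem_fd hδ
  have him : 0.866 ≤ (δ • τ).im := by
    have := (δ • τ).im_pos
    nlinarith
  obtain ⟨s, hs⟩ : ∃ s, s = δ • τ := ⟨_, rfl⟩
  rw [← hs] at him
  have hτ : τ = δ⁻¹ • s := by rw [hs, inv_smul_smul]
  have hpi := Real.pi_gt_d4
  have hx0 := f_tau0 hl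
  have hx0' := f_ne_zero (tau l 1 0)
  have hx0p : 0 < ‖f (tau l 1 0)‖ := norm_pos_iff.mpr hx0'
  by_cases h5 : (5:ℤ) ∣ δ⁻¹ 1 0
  · have hq : ‖qq s‖ ≤ 1 / 200 := by
      rw [norm_qq]
      have := exp_neg_le (x := 2 * Real.pi * s.im) (by norm_num) exp_bounds.1 (by nlinarith)
      convert this using 2; ring
    have hf1 := norm_f_le hq
    have hf : f s = f (tau l 1 0) := by
      have h1 := f_smul δ⁻¹ h5 s
      rw [← hτ] at h1
      have key : f s = f (tau l 1 0) ∨ f s = -(f (tau l 1 0))⁻¹ := by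
        unfold dia at h1
        split_ifs at h1
        · rwa [h1] at h
        · rw [h1] at h
          rcases h with h | h
          · right; exact neg_inv_eq h
          · left; have := neg_inv_eq h; rw [this, inv_neg, inv_inv, neg_neg]
      refine key.resolve_right fun h2 => ?_
      have := congrArg norm h2
      rw [norm_neg, norm_inv] at this
      have h4 : 1 < ‖f (tau l 1 0)‖⁻¹ := by
        rw [one_lt_inv₀ hx0p]; linarith
      linarith
    have hqq := xU_inj hq ((qq_tau0 hl).trans (by norm_num)) hf
    obtain ⟨m, hm⟩ := qq_eq_imp hqq
    refine ⟨ModularGroup.T ^ m * δ, ?_, by rw [mul_smul, ← hs, ← hm]⟩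
    have e1 : δ⁻¹ 1 0 = - δ 1 0 := by
      rw [Matrix.SpecialLinearGroup.SL2_inv_expl]; rfl
    rw [e1, dvd_neg] at h5
    rw [mul_10, ModularGroup.coe_T_zpow]
    simpa using h5
  · exfalso
    obtain ⟨γ₀, j, h0, hj⟩ := coset _ h5
    have hb := f_S_bounds (ModularGroup.T ^ j • s) (by
      have e : ‖cexp (2 * π * I * ((ModularGroup.T ^ j • s : ℍ) / 5))‖ = Real.exp (-(2 * Real.pi * s.im / 5)) := by
        rw [Complex.norm_exp, ← im_T_zpow j s]
        congr 1
        rw [show (2 * π * I * (((ModularGroup.T ^ j • s : ℍ) : ℂ) / 5)) = ((2 * Real.pi / 5 : ℝ) : ℂ) * (I * (ModularGroup.T ^ j • s : ℍ)) by push_cast; ring,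
          re_ofReal_mul, I_mul_re, UpperHalfPlane.coe_im]
        ring
      rw [e]
      have := exp_neg_le (x := 2 * Real.pi * s.im / 5) (by norm_num) exp_bounds.2.2 (by nlinarith)
      refine this.trans (by norm_num))
    have hb := norm_dia_bounds (γ₀ 0 0) hb
    rw [← f_smul γ₀ h0, ← mul_smul, ← mul_smul, mul_assoc, ← hj, ← hτ] at hb
    rcases h with h | h
    · rw [h] at hb; linarith [hb.1]
    · rw [h, norm_neg, norm_inv] at hb
      have := hb.2
      rw [inv_le_comm₀ hx0p (by norm_num)] at this
      norm_num at this
      linarith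

end RR

namespace RR
open Filter Topology Ideal NumberField

section Zeta

variable {K : Type*} [Field K] [NumberField K]

/-- weight of an ideal -/
noncomputable def wt (s : ℝ) (I : Ideal (𝓞 K)) : ENNReal := ENNReal.ofReal ((absNorm I : ℝ) ^ (-s))

lemma wt_mul (s : ℝ) (I J : Ideal (𝓞 K)) : wt s (I * J) = wt s I * wt s J := by
  rw [wt, wt, wt, map_mul, Nat.cast_mul, Real.mul_rpow (Nat.cast_nonneg _) (Nat.cast_nonneg _),
    ENNReal.ofReal_mul (by positivity)]

lemma wt_one (s : ℝ) : wt s (1 : Ideal (𝓞 K)) = 1 := by simp [wt]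

/-- `wt` as a monoid hom -/
noncomputable def wtH (s : ℝ) : Ideal (𝓞 K) →* ENNReal := ⟨⟨wt s, wt_one s⟩, wt_mul s⟩

lemma wt_congr {L : Type*} [Field L] [NumberField L] (s : ℝ) {I : Ideal (𝓞 K)} {J : Ideal (𝓞 L)} (h : absNorm I = absNorm J) :
    wt s I = wt s J := by rw [wt, wt, h]

lemma wt_anti {s : ℝ} (hs : 1 ≤ s) (I : Ideal (𝓞 K)) : wt s I ≤ wt 1 I := by
  rw [wt, wt]
  apply ENNReal.ofReal_le_ofReal
  rcases Nat.eq_zero_or_pos (absNorm I) with h | h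
  · rw [h, Nat.cast_zero, Real.zero_rpow (by linarith), Real.zero_rpow (by norm_num)]
  · exact Real.rpow_le_rpow_of_exponent_le (by exact_mod_cast h) (by linarith)

/-- partial zeta sum -/
noncomputable def ZZ (S : Set (Ideal (𝓞 K))) (s : ℝ) : ENNReal := ∑' I : S, wt s (I : Ideal (𝓞 K))

lemma ZZ_anti (S : Set (Ideal (𝓞 K))) {s : ℝ} (hs : 1 ≤ s) : ZZ S s ≤ ZZ S 1 :=
  ENNReal.tsum_le_tsum fun I => wt_anti hs _

/-- comparison through a surjection -/
lemma ZZ_le {ι : Type*} (S : Set (Ideal (𝓞 K))) (s : ℝ) (g : ι → Ideal (𝓞 K)) (h : ∀ I ∈ S, ∃ i, g i = I) :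
    ZZ S s ≤ ∑' i, wt s (g i) := by
  choose k hk using h
  have : ZZ S s = ∑' I : S, (fun i => wt s (g i)) (k I I.2) := by
    unfold ZZ
    congr 1; ext I
    simp only [hk I I.2]
  rw [this]
  refine ENNReal.tsum_comp_le_tsum_of_injective (f := fun I : S => k I I.2) ?_ (fun i => wt s (g i))
  intro I J hIJ
  apply Subtype.ext
  rw [← hk I I.2, ← hk J J.2]
  exact congrArg g hIJ

lemma ZZ_mono {S T : Set (Ideal (𝓞 K))} (h : S ⊆ T) (s : ℝ) : ZZ S s ≤ ZZ T s :=
  ZZ_le S s (fun I : T => (I : Ideal (𝓞 K))) fun I hI => ⟨⟨I, h hI⟩, rfl⟩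

lemma ZZ_closure_union (S T : Set (Ideal (𝓞 K))) (s : ℝ) :
    ZZ (Submonoid.closure (S ∪ T) : Set (Ideal (𝓞 K))) s ≤
      ZZ (Submonoid.closure S : Set (Ideal (𝓞 K))) s * ZZ (Submonoid.closure T : Set (Ideal (𝓞 K))) s := by
  refine (ZZ_le (ι := Submonoid.closure S × Submonoid.closure T) _ s
    (fun x => (x.1 : Ideal (𝓞 K)) * (x.2 : Ideal (𝓞 K))) fun I hI => ?_).trans (le_of_eq ?_)
  · rw [SetLike.mem_coe, Submonoid.closure_union, Submonoid.mem_sup] at hI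
    obtain ⟨y, hy, z, hz, h⟩ := hI
    exact ⟨(⟨y, hy⟩, ⟨z, hz⟩), h⟩
  · simp only [wt_mul]
    rw [ENNReal.tsum_prod']
    simp only [ENNReal.tsum_mul_left, ENNReal.tsum_mul_right]
    rfl

lemma ZZ_closure_singleton {P : Ideal (𝓞 K)} (h : 2 ≤ absNorm P) :
    ZZ (Submonoid.closure {P} : Set (Ideal (𝓞 K))) 1 ≠ ⊤ := by
  refine ne_top_of_le_ne_top ?_ (ZZ_le (ι := ℕ) _ 1 (fun k => P ^ k) fun I hI => by
    rw [SetLike.mem_coe, Submonoid.mem_closure_singleton] at hI; exact hI)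
  have h2 : (2 : ℝ) ≤ absNorm P := by exact_mod_cast h
  have e : ∀ k : ℕ, wt 1 (P ^ k) = ENNReal.ofReal (((absNorm P : ℝ)⁻¹) ^ k) := fun k => by
    rw [wt, map_pow, Real.rpow_neg_one, Nat.cast_pow, inv_pow]
  simp only [e]
  have hs : Summable fun k : ℕ => ((absNorm P : ℝ)⁻¹) ^ k :=
    summable_geometric_of_lt_one (by positivity) (inv_lt_one_of_one_lt₀ (by linarith))
  rw [← ENNReal.ofReal_tsum_of_nonneg (fun k => by positivity) hs]
  exact ENNReal.ofReal_ne_top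

lemma ZZ_closure_finite {S : Set (Ideal (𝓞 K))} (hS : S.Finite) (h : ∀ P ∈ S, 2 ≤ absNorm P) :
    ZZ (Submonoid.closure S : Set (Ideal (𝓞 K))) 1 ≠ ⊤ := by
  induction S, hS using Set.Finite.induction_on with
  | empty =>
    rw [Submonoid.closure_empty]
    refine ne_top_of_le_ne_top ?_ (ZZ_le (ι := Unit) _ 1 (fun _ => 1) fun I hI => ⟨(), (by simpa using hI : I = 1).symm⟩)
    rw [tsum_fintype]; simp [wt]
  | @insert P S _ _ ih =>
    rw [Set.insert_eq]
    refine ne_top_of_le_ne_top (ENNReal.mul_ne_top ?_ ?_) (ZZ_closure_union _ _ _)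
    · exact ZZ_closure_singleton (h P (Set.mem_insert _ _))
    · exact ih fun Q hQ => h Q (Set.mem_insert_of_mem _ hQ)

/-- primes generated by rational integers contribute a bounded factor -/
lemma ZZ_inert (hK : Module.finrank ℚ K = 2) {S : Set (Ideal (𝓞 K))} (h : ∀ P ∈ S, ∃ m : ℕ, P = span {(m : 𝓞 K)}) :
    ZZ (Submonoid.closure S : Set (Ideal (𝓞 K))) 1 ≠ ⊤ := by
  have hcl : ∀ I ∈ Submonoid.closure S, ∃ m : ℕ, span {(m : 𝓞 K)} = I := by
    intro I hI
    induction hI using Submonoid.closure_induction with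
    | mem P hP => obtain ⟨m, hm⟩ := h P hP; exact ⟨m, hm.symm⟩
    | one => exact ⟨1, by simp⟩
    | mul I J _ _ hI hJ =>
      obtain ⟨m, rfl⟩ := hI
      obtain ⟨k, rfl⟩ := hJ
      exact ⟨m * k, by rw [span_singleton_mul_span_singleton]; push_cast; rfl⟩
  refine ne_top_of_le_ne_top ?_ (ZZ_le (ι := ℕ) _ 1 _ hcl)
  have e : ∀ m : ℕ, wt 1 (span {(m : 𝓞 K)}) = ENNReal.ofReal (1 / (m : ℝ) ^ 2) := fun m => by
    have : absNorm (span {(m : 𝓞 K)}) = m ^ 2 := by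
      rw [absNorm_span_natCast, NumberField.RingOfIntegers.rank, hK]
    rw [wt, this, Real.rpow_neg_one, Nat.cast_pow, one_div]
  simp only [e]
  rw [← ENNReal.ofReal_tsum_of_nonneg (fun k => by positivity) (Real.summable_one_div_nat_pow.mpr (by norm_num))]
  exact ENNReal.ofReal_ne_top

lemma ZZ_univ_eq (s : ℝ) (hs : 1 < s) : ZZ (Set.univ : Set (Ideal (𝓞 K))) s =
    ∑' n : ℕ, ENNReal.ofReal (Nat.card {I : Ideal (𝓞 K) // absNorm I = n} * (n : ℝ) ^ (-s)) := by
  have h1 : ZZ (Set.univ : Set (Ideal (𝓞 K))) s = ∑' I : Ideal (𝓞 K), wt s I := by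
    rw [ZZ, tsum_univ (fun I => wt s I)]
  rw [h1, ← ENNReal.tsum_fiberwise _ (fun I : Ideal (𝓞 K) => absNorm I)]
  congr 1; ext n
  have h2 : ∀ I : ((fun I : Ideal (𝓞 K) => absNorm I) ⁻¹' {n}), wt s (I : Ideal (𝓞 K)) = ENNReal.ofReal ((n : ℝ) ^ (-s)) := by
    rintro ⟨I, hI⟩
    have hI : absNorm I = n := hI
    rw [wt, hI]
  simp only [h2]
  rw [ENNReal.tsum_const, ENNReal.ofReal_mul (Nat.cast_nonneg _), ENNReal.ofReal_natCast]
  congr 1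
  have : Finite ((fun I : Ideal (𝓞 K) => absNorm I) ⁻¹' {n}) := by
    exact Set.Finite.to_subtype (Ideal.finite_setOfPred_absNorm_eq n)
  rw [ENat.card_eq_coe_natCard]
  rfl

lemma ZZ_univ_lim : ∃ (κ : ℝ), 0 < κ ∧ (∀ᶠ s : ℝ in 𝓝[>] 1, ZZ (Set.univ : Set (Ideal (𝓞 K))) s ≠ ⊤) ∧
    Tendsto (fun s : ℝ => (s - 1) * (ZZ (Set.univ : Set (Ideal (𝓞 K))) s).toReal) (𝓝[>] 1) (𝓝 κ) := by
  refine ⟨dedekindZeta_residue K, dedekindZeta_residue_pos K, ?_⟩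
  have ht := tendsto_sub_one_mul_dedekindZeta_nhdsGT K
  set c : ℕ → ℂ := fun n ↦ Nat.card {I : Ideal (𝓞 K) // absNorm I = n} with hc
  have hterm : ∀ s : ℝ, 1 < s → ∀ n, LSeries.term c s n = ((Nat.card {I : Ideal (𝓞 K) // absNorm I = n} * (n : ℝ) ^ (-s) : ℝ) : ℂ) := by
    intro s hs n
    rw [LSeries.term_def]
    split_ifs with h
    · rw [h, Nat.cast_zero, Real.zero_rpow (by linarith)]; simp
    · rw [hc]
      push_cast
      rw [Complex.ofReal_cpow (Nat.cast_nonneg _)]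
      push_cast
      rw [Complex.cpow_neg, div_eq_mul_inv]
  have hsum : ∀ᶠ s : ℝ in 𝓝[>] 1, 1 < s ∧ LSeriesSummable c s := by
    have h1 := ht.eventually_ne (b₂ := 0) (by exact_mod_cast dedekindZeta_residue_ne_zero K)
    filter_upwards [h1, self_mem_nhdsWithin] with s hs hs1
    refine ⟨hs1, ?_⟩
    by_contra hns
    apply hs
    have : dedekindZeta K s = 0 := tsum_eq_zero_of_not_summable hns
    rw [this, mul_zero]
  have key : ∀ s : ℝ, 1 < s → LSeriesSummable c s → ZZ (Set.univ : Set (Ideal (𝓞 K))) s ≠ ⊤ ∧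
      (((ZZ (Set.univ : Set (Ideal (𝓞 K))) s).toReal : ℝ) : ℂ) = dedekindZeta K s := by
    intro s hs h
    have h2 : Summable (fun n : ℕ => (Nat.card {I : Ideal (𝓞 K) // absNorm I = n} * (n : ℝ) ^ (-s) : ℝ)) := by
      have : Summable (LSeries.term c s) := h
      rw [funext (hterm s hs)] at this
      exact Complex.summable_ofReal.mp this
    have hnn : ∀ n : ℕ, 0 ≤ (Nat.card {I : Ideal (𝓞 K) // absNorm I = n} * (n : ℝ) ^ (-s) : ℝ) := fun n => by positivity
    rw [ZZ_univ_eq s hs, ← ENNReal.ofReal_tsum_of_nonneg hnn h2, ENNReal.toReal_ofReal (tsum_nonneg hnn)]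
    refine ⟨ENNReal.ofReal_ne_top, ?_⟩
    rw [Complex.ofReal_tsum, dedekindZeta, LSeries]
    exact tsum_congr fun n => (hterm s hs n).symm
  refine ⟨hsum.mono fun s hs => (key s hs.1 hs.2).1, ?_⟩
  have ht2 := (Complex.continuous_re.tendsto _).comp ht
  rw [Complex.ofReal_re] at ht2
  refine ht2.congr' ?_
  filter_upwards [hsum] with s hs
  rw [Function.comp_apply, ← (key s hs.1 hs.2).2, ← Complex.ofReal_one, ← Complex.ofReal_sub, ← Complex.ofReal_mul,
    Complex.ofReal_re]

end Zeta
end RR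

namespace RR
open Filter Topology Ideal NumberField

section Zeta2

variable {K : Type*} [Field K] [NumberField K] {F : Type*} [Field F] [NumberField F]

lemma ZZ_univ_le_primes {s : ℝ} (hs : 1 < s) (S : Set (Ideal (𝓞 K))) (hS : ∀ P : Ideal (𝓞 K), Prime P → P ∈ S) :
    ZZ (Set.univ : Set (Ideal (𝓞 K))) s ≤ ZZ (Submonoid.closure S : Set (Ideal (𝓞 K))) s := by
  have h1 : ZZ (Set.univ : Set (Ideal (𝓞 K))) s = ∑' I : Ideal (𝓞 K), wt s I := by
    rw [ZZ, tsum_univ (fun I => wt s I)]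
  rw [h1, ZZ]
  refine le_of_eq (tsum_subtype_eq_of_support_subset (f := fun I : Ideal (𝓞 K) => wt s I) ?_).symm
  intro I hI
  have hI0 : I ≠ 0 := by
    rintro rfl
    apply hI
    simp only [wt, Ideal.zero_eq_bot, absNorm_bot, Nat.cast_zero]
    rw [Real.zero_rpow (by linarith), ENNReal.ofReal_zero]
  clear hI
  rw [SetLike.mem_coe]
  induction I using UniqueFactorizationMonoid.induction_on_prime with
  | h₁ => exact absurd rfl hI0
  | h₂ x hx => rw [isUnit_iff_eq_one] at hx; rw [hx]; exact one_mem _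
  | h₃ a p ha hp ih => exact mul_mem (Submonoid.subset_closure (hS p hp)) (ih ha)

lemma good_sq (Pg : Set (Ideal (𝓞 K))) (q₁ q₂ : Pg → Ideal (𝓞 F)) (h₁ : Function.Injective q₁) (h₂ : Function.Injective q₂)
    (h₁₂ : ∀ P P', q₁ P ≠ q₂ P') (hp₁ : ∀ P, Prime (q₁ P)) (hp₂ : ∀ P, Prime (q₂ P))
    (hn₁ : ∀ P, absNorm (q₁ P) = absNorm (P : Ideal (𝓞 K))) (hn₂ : ∀ P, absNorm (q₂ P) = absNorm (P : Ideal (𝓞 K))) (s : ℝ) :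
    (ZZ (Submonoid.closure Pg : Set (Ideal (𝓞 K))) s) ^ 2 ≤ ZZ (Set.univ : Set (Ideal (𝓞 F))) s := by
  classical
  have hG : ZZ (Submonoid.closure Pg : Set (Ideal (𝓞 K))) s ≤
      ∑' m : Multiset Pg, wt s (m.map (fun P : Pg => (P : Ideal (𝓞 K)))).prod := by
    refine ZZ_le _ s (fun m : Multiset Pg => (m.map (fun P : Pg => (P : Ideal (𝓞 K)))).prod) fun I hI => ?_
    obtain ⟨m, hm, hmI⟩ := Submonoid.exists_multiset_of_mem_closure hI
    refine ⟨m.attach.map fun x => ⟨x.1, hm x.1 x.2⟩, ?_⟩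
    rw [Multiset.map_map, ← hmI]
    congr 1
    exact Multiset.attach_map_val m
  have hw : ∀ (q : Pg → Ideal (𝓞 F)), (∀ P, absNorm (q P) = absNorm (P : Ideal (𝓞 K))) → ∀ m : Multiset Pg,
      wt s (m.map (fun P : Pg => (P : Ideal (𝓞 K)))).prod = wt s (m.map q).prod := by
    intro q hq m
    apply wt_congr
    rw [map_multiset_prod, map_multiset_prod, Multiset.map_map, Multiset.map_map]
    congr 1
    exact Multiset.map_congr rfl fun P _ => (hq P).symm
  have hcount : ∀ m m' : Multiset Pg, ∀ P : Pg, (m.map q₁ + m'.map q₂).count (q₁ P) = m.count P := by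
    intro m m' P
    rw [Multiset.count_add, Multiset.count_map_eq_count' _ _ h₁, Multiset.count_eq_zero_of_notMem (s := m'.map q₂), add_zero]
    intro h
    obtain ⟨P', _, h⟩ := Multiset.mem_map.mp h
    exact h₁₂ _ _ h.symm
  have hcount' : ∀ m m' : Multiset Pg, ∀ P : Pg, (m.map q₁ + m'.map q₂).count (q₂ P) = m'.count P := by
    intro m m' P
    rw [Multiset.count_add, Multiset.count_map_eq_count' _ _ h₂, Multiset.count_eq_zero_of_notMem, zero_add]
    intro h
    obtain ⟨P', _, h⟩ := Multiset.mem_map.mp h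
    exact h₁₂ _ _ h
  have hfac : ∀ m m' : Multiset Pg, UniqueFactorizationMonoid.normalizedFactors ((m.map q₁).prod * (m'.map q₂).prod)
      = m.map q₁ + m'.map q₂ := by
    intro m m'
    rw [← Multiset.prod_add]
    apply UniqueFactorizationMonoid.normalizedFactors_prod_of_prime
    intro Q hQ
    rcases Multiset.mem_add.mp hQ with h | h <;> obtain ⟨P, _, rfl⟩ := Multiset.mem_map.mp h
    · exact hp₁ P
    · exact hp₂ P
  calc _ ≤ (∑' m : Multiset Pg, wt s (m.map (fun P : Pg => (P : Ideal (𝓞 K)))).prod) ^ 2 := by gcongr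
    _ = ∑' x : Multiset Pg × Multiset Pg, wt s ((x.1.map q₁).prod * (x.2.map q₂).prod) := by
      rw [sq]
      simp only [wt_mul]
      rw [ENNReal.tsum_prod']
      simp only [ENNReal.tsum_mul_left, ENNReal.tsum_mul_right]
      congr 1
      · exact tsum_congr fun m => hw q₁ hn₁ m
      · exact tsum_congr fun m => hw q₂ hn₂ m
    _ ≤ ∑' I : Ideal (𝓞 F), wt s I := by
      refine ENNReal.tsum_comp_le_tsum_of_injective (f := fun x : Multiset Pg × Multiset Pg =>
        (x.1.map q₁).prod * (x.2.map q₂).prod) ?_ (fun I => wt s I)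
      rintro ⟨m, m'⟩ ⟨k, k'⟩ h
      have h' := congrArg UniqueFactorizationMonoid.normalizedFactors h
      simp only [hfac] at h'
      refine Prod.ext (Multiset.ext.mpr fun P => ?_) (Multiset.ext.mpr fun P => ?_)
      · rw [← hcount m m', h', hcount]
      · rw [← hcount' m m', h', hcount']
    _ = _ := by rw [ZZ, tsum_univ (fun I => wt s I)]

/-- prime ideals of a quadratic field have prime norm or are generated by a rational prime -/
lemma prime_dichotomy (hK : Module.finrank ℚ K = 2) {P : Ideal (𝓞 K)} (hP : Prime P) :
    (absNorm P).Prime ∨ ∃ m : ℕ, P = span {(m : 𝓞 K)} := by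
  have hP' : P.IsPrime := Ideal.isPrime_of_prime hP
  have hne : P ≠ ⊥ := hP.ne_zero
  have : P.IsMaximal := hP'.isMaximal hne
  obtain ⟨p, hp, hpm⟩ : ∃ p : ℕ, p.Prime ∧ (p : 𝓞 K) ∈ P := by
    have h1 : absNorm P ≠ 1 := fun h => hP'.ne_top (absNorm_eq_one_iff.mp h)
    have h0 : absNorm P ≠ 0 := fun h => hne (absNorm_eq_zero_iff.mp h)
    have hm : ((absNorm P : ℕ) : 𝓞 K) ∈ P := absNorm_mem P
    have key : ∀ n : ℕ, n ≠ 0 → (n : 𝓞 K) ∈ P → ∃ p : ℕ, p.Prime ∧ (p : 𝓞 K) ∈ P := by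
      intro n
      induction n using Nat.recOnMul with
      | zero => intro h; exact absurd rfl h
      | one => intro _ h; exact absurd ((Ideal.eq_top_iff_one _).mpr (by simpa using h)) hP'.ne_top
      | prime p hp => intro _ h; exact ⟨p, hp, h⟩
      | mul a b iha ihb =>
        intro h0 h
        rw [Nat.cast_mul] at h
        rcases hP'.mem_or_mem h with h | h
        · exact iha (by rintro rfl; simp at h0) h
        · exact ihb (by rintro rfl; simp at h0) h
    exact key _ h0 hm
  have hdvd : P ∣ span {(p : 𝓞 K)} := by
    rw [Ideal.dvd_iff_le, Ideal.span_singleton_le_iff_mem]; exact hpm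
  have hN : absNorm (span {(p : 𝓞 K)}) = p ^ 2 := by
    rw [absNorm_span_natCast, NumberField.RingOfIntegers.rank, hK]
  obtain ⟨J, hJ⟩ := hdvd
  have hd : absNorm P * absNorm J = p ^ 2 := by rw [← map_mul, ← hJ, hN]
  obtain ⟨k, hk, hk'⟩ := (Nat.dvd_prime_pow hp).mp (Dvd.intro _ hd)
  interval_cases k
  · exact absurd (absNorm_eq_one_iff.mp (by simpa using hk')) hP'.ne_top
  · left; rw [hk', pow_one]; exact hp
  · right
    refine ⟨p, ?_⟩
    have : absNorm J = 1 := by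
      rw [hk'] at hd
      exact Nat.eq_of_mul_eq_mul_left (pow_pos hp.pos 2) (by rw [hd, mul_one])
    rw [hJ, absNorm_eq_one_iff.mp this, Ideal.mul_top]

/-- There cannot be a number field in which almost all degree one primes of a quadratic field have
two degree one primes above. -/
theorem zeta_contra (hK : Module.finrank ℚ K = 2) {B : ℕ} (hB : B ≠ 0) (pr : Ideal (𝓞 F) → Ideal (𝓞 K))
    (h : ∀ P : Ideal (𝓞 K), Prime P → (absNorm P).Prime → ¬ absNorm P ∣ B →
      ∃ Q₁ Q₂ : Ideal (𝓞 F), Q₁ ≠ Q₂ ∧ Prime Q₁ ∧ Prime Q₂ ∧ absNorm Q₁ = absNorm P ∧ absNorm Q₂ = absNorm P ∧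
        pr Q₁ = P ∧ pr Q₂ = P) : False := by
  set Pg : Set (Ideal (𝓞 K)) := {P | Prime P ∧ (absNorm P).Prime ∧ ¬ absNorm P ∣ B} with hPg
  set Pb : Set (Ideal (𝓞 K)) := {P | (absNorm P).Prime ∧ absNorm P ∣ B} with hPb
  set Pi : Set (Ideal (𝓞 K)) := {P | ∃ m : ℕ, P = span {(m : 𝓞 K)}} with hPi
  have hfin : Pb.Finite := by
    have : Pb ⊆ ⋃ n ∈ B.divisors, {P : Ideal (𝓞 K) | absNorm P = n} := by
      intro P hP
      simp only [Set.mem_iUnion]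
      exact ⟨absNorm P, Nat.mem_divisors.mpr ⟨hP.2, hB⟩, rfl⟩
    exact (Set.Finite.biUnion (Finset.finite_toSet _) fun n _ => Ideal.finite_setOfPred_absNorm_eq n).subset this
  have hb := ZZ_closure_finite hfin fun P hP => hP.1.two_le
  have hi := ZZ_inert (K := K) hK (S := Pi) fun P hP => hP
  choose q₁ q₂ h12 hp1 hp2 hn1 hn2 hq1 hq2 using fun P : Pg => h P P.2.1 P.2.2.1 P.2.2.2
  set C := ZZ (Submonoid.closure Pb : Set (Ideal (𝓞 K))) 1 * ZZ (Submonoid.closure Pi : Set (Ideal (𝓞 K))) 1 with hC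
  have hCt : C ≠ ⊤ := ENNReal.mul_ne_top hb hi
  have hmain : ∀ s : ℝ, 1 < s → ZZ (Set.univ : Set (Ideal (𝓞 K))) s ^ 2 ≤
      C ^ 2 * ZZ (Set.univ : Set (Ideal (𝓞 F))) s := by
    intro s hs
    have h1 : ZZ (Set.univ : Set (Ideal (𝓞 K))) s ≤
        ZZ (Submonoid.closure Pg : Set (Ideal (𝓞 K))) s * C := by
      refine (ZZ_univ_le_primes hs (Pg ∪ (Pb ∪ Pi)) fun P hP => ?_).trans ?_
      · rcases prime_dichotomy hK hP with h | h
        · by_cases h' : absNorm P ∣ B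
          · exact Or.inr (Or.inl ⟨h, h'⟩)
          · exact Or.inl ⟨hP, h, h'⟩
        · exact Or.inr (Or.inr h)
      · refine (ZZ_closure_union _ _ _).trans ?_
        gcongr
        refine (ZZ_closure_union _ _ _).trans ?_
        rw [hC]
        gcongr <;> exact ZZ_anti _ hs.le
    calc _ ≤ (ZZ (Submonoid.closure Pg : Set (Ideal (𝓞 K))) s * C) ^ 2 := by gcongr
      _ = C ^ 2 * (ZZ (Submonoid.closure Pg : Set (Ideal (𝓞 K))) s) ^ 2 := by ring
      _ ≤ _ := by
        gcongr
        refine good_sq Pg q₁ q₂ ?_ ?_ ?_ hp1 hp2 hn1 hn2 s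
        · intro P P' hh; apply Subtype.ext; rw [← hq1 P, ← hq1 P', hh]
        · intro P P' hh; apply Subtype.ext; rw [← hq2 P, ← hq2 P', hh]
        · intro P P' hh
          have : P = P' := by apply Subtype.ext; rw [← hq1 P, ← hq2 P', hh]
          subst this
          exact h12 P hh
  obtain ⟨κ, hκ, hfK, hlK⟩ := ZZ_univ_lim (K := K)
  obtain ⟨κ', hκ', hfF, hlF⟩ := ZZ_univ_lim (K := F)
  have hs0 : Tendsto (fun s : ℝ => s - 1) (𝓝[>] 1) (𝓝 0) := by
    have : Tendsto (fun s : ℝ => s - 1) (𝓝 1) (𝓝 (1 - 1)) := (continuous_id.sub continuous_const).tendsto 1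
    rw [sub_self] at this
    exact this.mono_left nhdsWithin_le_nhds
  have hL := hlK.pow 2
  have hR : Tendsto (fun s : ℝ => C.toReal ^ 2 * ((s - 1) * ((s - 1) * (ZZ (Set.univ : Set (Ideal (𝓞 F))) s).toReal)))
      (𝓝[>] 1) (𝓝 (C.toReal ^ 2 * (0 * κ'))) := (hs0.mul hlF).const_mul _
  have := le_of_tendsto_of_tendsto hL hR (by
    filter_upwards [hfK, hfF, self_mem_nhdsWithin] with s h1 h2 hs
    have hs : 1 < s := hs
    have h3 := ENNReal.toReal_mono (ENNReal.mul_ne_top (ENNReal.pow_ne_top hCt) h2) (hmain s hs)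
    rw [ENNReal.toReal_pow, ENNReal.toReal_mul, ENNReal.toReal_pow] at h3
    have h4 : 0 ≤ (s - 1) ^ 2 := sq_nonneg _
    nlinarith [mul_le_mul_of_nonneg_left h3 h4])
  have hpos : 0 < κ ^ 2 := pow_pos hκ 2
  linarith

end Zeta2
end RR

namespace RR
open NumberField Ideal

/-- the arithmetic data -/
structure Dat (l : ℕ) (K : Type) [Field K] [NumberField K] (Θ : 𝓞 K) : Prop where
  hl : l.Prime
  h5 : 5 < l
  h4 : l % 4 = 1
  hΘ : Θ ^ 2 = -(5 * l)
  hK : Module.finrank ℚ K = 2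

section Quad

variable {l : ℕ} {K : Type} [Field K] [NumberField K] {Θ : 𝓞 K}

lemma Dat.emb (D : Dat l K Θ) : ∃ φ : K →+* ℂ, φ Θ = om l := by
  obtain ⟨φ⟩ : Nonempty (K →+* ℂ) := inferInstance
  have h : (φ Θ) ^ 2 = (om l) ^ 2 := by
    rw [om_sq, ← map_pow]
    have : ((Θ : K)) ^ 2 = -(5 * l) := by
      rw [← map_pow, D.hΘ, map_neg, map_mul, map_ofNat, map_natCast]
    rw [this, map_neg, map_mul, map_ofNat, map_natCast]
  rcases sq_eq_sq_iff_eq_or_eq_neg.mp h with h | h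
  · exact ⟨φ, h⟩
  · refine ⟨(starRingEnd ℂ).comp φ, ?_⟩
    rw [RingHom.comp_apply, h, map_neg]
    apply Complex.ext
    · simp [om_re]
    · simp

lemma Dat.indep (D : Dat l K Θ) {s t s' t' : ℚ} (h : (s : K) + t * Θ = s' + t' * Θ) : s = s' ∧ t = t' := by
  obtain ⟨φ, hφ⟩ := D.emb
  have h2 := congrArg φ h
  simp only [map_add, map_mul, hφ, map_ratCast] at h2
  have hp : 0 < (om l).im := om_im_pos D.hl.pos
  have h3 := congrArg Complex.im h2
  have h4 := congrArg Complex.re h2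
  simp [om_re] at h3 h4
  refine ⟨h4, ?_⟩
  rcases h3 with h | h
  · exact h
  · exact absurd h hp.ne'

lemma Dat.indepZ (D : Dat l K Θ) {s t s' t' : ℤ} (h : (s : 𝓞 K) + t * Θ = s' + t' * Θ) : s = s' ∧ t = t' := by
  have h2 := congrArg (algebraMap (𝓞 K) K) h
  simp only [map_add, map_mul, map_intCast] at h2
  have := D.indep (s := s) (t := t) (s' := s') (t' := t') (by exact_mod_cast h2)
  exact_mod_cast this

lemma Dat.reprQ (D : Dat l K Θ) (u : K) : ∃ s t : ℚ, u = s + t * Θ := by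
  have hli : LinearIndependent ℚ ![(1 : K), (Θ : K)] := by
    rw [LinearIndependent.pair_iff]
    intro s t h
    refine D.indep (s' := 0) (t' := 0) ?_
    rw [Rat.smul_def, Rat.smul_def] at h
    simpa using h
  have hsp := hli.span_eq_top_of_card_eq_finrank (by simp [D.hK])
  have hu : u ∈ Submodule.span ℚ (Set.range ![(1 : K), (Θ : K)]) := by rw [hsp]; trivial
  simp only [Matrix.range_cons, Matrix.range_empty, Set.union_empty, Set.singleton_union] at hu
  obtain ⟨s, t, h⟩ := Submodule.mem_span_pair.mp hu
  refine ⟨s, t, ?_⟩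
  rw [← h, Rat.smul_def, Rat.smul_def, mul_one]

lemma rat_mem_AA {r : ℚ} (h : (r : ℂ) ∈ AA) : ∃ n : ℤ, r = n := by
  have h1 : IsIntegral ℤ (algebraMap ℚ ℂ r) := h
  rw [isIntegral_algebraMap_iff (algebraMap ℚ ℂ).injective] at h1
  obtain ⟨n, hn⟩ := IsIntegrallyClosed.isIntegral_iff.mp h1
  exact ⟨n, by rw [← hn]; simp⟩

lemma Dat.reprZ (D : Dat l K Θ) (u : 𝓞 K) : ∃ s t : ℤ, u = s + t * Θ := by
  obtain ⟨φ, hφ⟩ := D.emb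
  obtain ⟨s, t, hst⟩ := D.reprQ u
  have hu : IsIntegral ℤ (u : K) := RingOfIntegers.isIntegral_coe u
  have h1 : φ u ∈ AA := hu.map (φ.toIntAlgHom)
  have h2 : (starRingEnd ℂ) (φ u) ∈ AA := IsIntegral.map ((starRingEnd ℂ).toIntAlgHom) h1
  have e1 : φ u = s + t * om l := by rw [hst, map_add, map_mul, hφ]; simp
  have hc : (starRingEnd ℂ) (om l) = - om l := by
    apply Complex.ext
    · simp [om_re]
    · simp
  have e2 : (starRingEnd ℂ) (φ u) = s - t * om l := by
    rw [e1, map_add, map_mul, hc]; simp [sub_eq_add_neg]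
  have a1 := add_mem h1 h2
  have a2 := mul_mem h1 h2
  rw [e2, e1] at a1 a2
  obtain ⟨S, hS⟩ := rat_mem_AA (r := 2 * s) (by convert a1 using 1; push_cast; ring)
  obtain ⟨N, hN⟩ := rat_mem_AA (r := s ^ 2 + 5 * l * t ^ 2) (by
    convert a2 using 1
    have : ((s : ℂ) + t * om l) * (s - t * om l) = s ^ 2 - t ^ 2 * (om l) ^ 2 := by ring
    rw [this, om_sq]; push_cast; ring)
  have hsq : Squarefree (5 * l) := by
    have hc : Nat.Coprime 5 l := (Nat.coprime_primes (by norm_num) D.hl).mpr (by have := D.h5; omega)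
    rw [Nat.squarefree_mul hc]
    exact ⟨(by norm_num : Nat.Prime 5).squarefree, D.hl.squarefree⟩
  obtain ⟨T, hT⟩ : ∃ T : ℤ, 2 * t = T := by
    set r : ℚ := 2 * t with hr
    have h5 : (5 * l : ℚ) * r ^ 2 = ((4 * N - S ^ 2 : ℤ) : ℚ) := by
      push_cast; rw [← hS, ← hN, hr]; ring
    have h6 : (5 * l : ℤ) * r.num ^ 2 = (4 * N - S ^ 2) * (r.den : ℤ) ^ 2 := by
      have hd : (r.den : ℚ) ≠ 0 := by exact_mod_cast r.den_ne_zero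
      have : (r.num : ℚ) = r * r.den := (Rat.mul_den_eq_num r).symm
      have h7 : ((5 * l : ℤ) : ℚ) * (r.num : ℚ) ^ 2 = ((4 * N - S ^ 2 : ℤ) : ℚ) * (r.den : ℚ) ^ 2 := by
        rw [this, ← h5]; push_cast; ring
      exact_mod_cast h7
    have hcop : IsCoprime ((r.den : ℤ) ^ 2) (r.num ^ 2) := by
      apply IsCoprime.pow
      rw [Int.isCoprime_iff_nat_coprime]
      simpa using r.reduced.symm
    have h8 : ((r.den : ℤ) ^ 2) ∣ (5 * l : ℤ) :=
      hcop.dvd_of_dvd_mul_right (Dvd.intro_left _ h6.symm)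
    have h9 : r.den * r.den ∣ 5 * l := by rw [← sq]; exact_mod_cast h8
    have h10 : r.den = 1 := Nat.isUnit_iff.mp (hsq _ h9)
    exact ⟨r.num, (Rat.den_eq_one_iff r).mp h10 |>.symm⟩
  have h11 : S ^ 2 + 5 * l * T ^ 2 = 4 * N := by
    have : ((S ^ 2 + 5 * l * T ^ 2 : ℤ) : ℚ) = ((4 * N : ℤ) : ℚ) := by
      push_cast; rw [← hS, ← hN, ← hT]; ring
    exact_mod_cast this
  obtain ⟨k, hk⟩ : ∃ k : ℤ, (l : ℤ) = 4 * k + 1 := ⟨l / 4, by have := D.h4; omega⟩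
  have h12 : (S ^ 2 + T ^ 2) % 4 = 0 := by
    have : S ^ 2 + T ^ 2 = 4 * (N - T ^ 2 * (5 * k + 1)) := by rw [hk] at h11; linarith
    rw [this]; simp
  have h13 : S % 2 = 0 ∧ T % 2 = 0 := by
    rcases Int.even_or_odd' S with ⟨a, rfl | rfl⟩ <;> rcases Int.even_or_odd' T with ⟨b, rfl | rfl⟩ <;> ring_nf at h12 <;> omega
  obtain ⟨S', hS'⟩ := Int.dvd_of_emod_eq_zero h13.1
  obtain ⟨T', hT'⟩ := Int.dvd_of_emod_eq_zero h13.2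
  refine ⟨S', T', ?_⟩
  apply RingOfIntegers.ext
  rw [hst]
  have es : s = S' := by have : 2 * s = 2 * S' := by rw [hS, hS']; push_cast; ring
                         linarith
  have et : t = T' := by have : 2 * t = 2 * T' := by rw [hT, hT']; push_cast; ring
                         linarith
  rw [es, et]; simp

end Quad
end RR

namespace RR
open NumberField Ideal
open UpperHalfPlane hiding I
open scoped MatrixGroups

/-- CM points -/
def CM (l a : ℕ) (b : ℤ) : Prop := 0 < a ∧ (a : ℤ) ∣ 5 * b ^ 2 + l

section Quad2

variable {l : ℕ} {K : Type} [Field K] [NumberField K] {Θ : 𝓞 K}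

/-- the ideal of a CM point -/
def IA (Θ : 𝓞 K) (a : ℕ) (b : ℤ) : Ideal (𝓞 K) := span {(a : 𝓞 K), Θ - 5 * b}

lemma Dat.not5 (D : Dat l K Θ) {a : ℕ} {b : ℤ} (h : CM l a b) : ¬ (5 : ℤ) ∣ a := by
  intro h5
  have h1 := h5.trans h.2
  have h2 : (5 : ℤ) ∣ l := (Int.dvd_add_right (Dvd.intro _ rfl)).mp h1
  have h3 : 5 ∣ l := by exact_mod_cast h2
  have := (Nat.prime_dvd_prime_iff_eq (by norm_num) D.hl).mp h3
  have := D.h5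
  omega

lemma Dat.mem_IA (D : Dat l K Θ) {a : ℕ} {b : ℤ} (h : CM l a b) {v : 𝓞 K} (hv : v ∈ IA Θ a b) :
    ∃ m n : ℤ, v = m * a + n * (Θ - 5 * b) := by
  obtain ⟨C, hC⟩ := h.2
  obtain ⟨x, y, rfl⟩ := Ideal.mem_span_pair.mp hv
  obtain ⟨s, t, rfl⟩ := D.reprZ x
  obtain ⟨s', t', rfl⟩ := D.reprZ y
  have hC' : (5 : 𝓞 K) * b ^ 2 + l = a * C := by exact_mod_cast congrArg (Int.cast : ℤ → 𝓞 K) hC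
  refine ⟨s + 5 * b * t - 5 * C * t', t * a + s' - 5 * b * t', ?_⟩
  push_cast
  linear_combination t' * D.hΘ - 5 * t' * hC'

lemma left_mem (a : ℕ) (b : ℤ) : (a : 𝓞 K) ∈ IA Θ a b := subset_span (by simp)
lemma right_mem (a : ℕ) (b : ℤ) : Θ - 5 * b ∈ IA Θ a b := subset_span (by simp)

lemma IA_ne {a : ℕ} (ha : 0 < a) (b : ℤ) : IA Θ a b ≠ 0 := by
  intro h
  have : (a : 𝓞 K) ∈ (0 : Ideal (𝓞 K)) := h ▸ left_mem a b
  simp at this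
  omega

lemma Dat.ne_zero_aux (D : Dat l K Θ) {a : ℕ} (ha : 0 < a) {b m n : ℤ} {m' n' : ℤ}
    (h : (m : 𝓞 K) * a + n * (Θ - 5 * b) = m' * a + n' * (Θ - 5 * b)) : m = m' ∧ n = n' := by
  have := D.indepZ (s := m * a - 5 * b * n) (t := n) (s' := m' * a - 5 * b * n') (t' := n') (by
    push_cast; linear_combination h)
  obtain ⟨h1, rfl⟩ := this
  refine ⟨?_, rfl⟩
  have ha' : (a : ℤ) ≠ 0 := by exact_mod_cast ha.ne'
  have h2 : m * a = m' * a := by linarith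
  exact mul_right_cancel₀ ha' h2

lemma Dat.equiv_of_class (D : Dat l K Θ) {a a' : ℕ} {b b' : ℤ} (h : CM l a b) (h' : CM l a' b') {x y : 𝓞 K}
    (hx : x ≠ 0) (hy : y ≠ 0) (hI : span {x} * IA Θ a b = span {y} * IA Θ a' b') :
    ∃ γ : SL(2, ℤ), 5 ∣ γ 1 0 ∧ γ • tau l a' b' = tau l a b := by
  have key : ∀ {a a' : ℕ} {b b' : ℤ} (_ : CM l a b) (_ : CM l a' b') {x y : 𝓞 K}
    (_ : span {x} * IA Θ a b = span {y} * IA Θ a' b') {v : 𝓞 K} (_ : v ∈ IA Θ a b),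
      ∃ m n : ℤ, x * v = y * (m * a' + n * (Θ - 5 * b')) := by
    intro a a' b b' h h' x y hI v hv
    have : x * v ∈ span {y} * IA Θ a' b' := hI ▸ Ideal.mul_mem_mul (mem_span_singleton_self x) hv
    rw [Ideal.mem_span_singleton_mul] at this
    obtain ⟨z, hz, hzv⟩ := this
    obtain ⟨m, n, rfl⟩ := D.mem_IA h' hz
    exact ⟨m, n, hzv.symm⟩
  obtain ⟨m, n, e1⟩ := key h h' hI (left_mem a b)
  obtain ⟨r, s, e2⟩ := key h h' hI (right_mem a b)
  obtain ⟨m', n', e3⟩ := key h' h hI.symm (left_mem a' b')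
  obtain ⟨r', s', e4⟩ := key h' h hI.symm (right_mem a' b')
  obtain ⟨d1, d2⟩ := D.ne_zero_aux h.1 (b := b) (m := 1) (n := 0) (m' := m * m' + n * r') (n' := m * n' + n * s') (by
    apply mul_left_cancel₀ hx
    push_cast
    linear_combination e1 + m * e3 + n * e4)
  obtain ⟨d3, d4⟩ := D.ne_zero_aux h.1 (b := b) (m := 0) (n := 1) (m' := r * m' + s * r') (n' := r * n' + s * s') (by
    apply mul_left_cancel₀ hx
    push_cast
    linear_combination e2 + r * e3 + s * e4)
  have hdet : (m * s - n * r) * (m' * s' - n' * r') = 1 := by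
    have : (m * s - n * r) * (m' * s' - n' * r') =
      (m * m' + n * r') * (r * n' + s * s') - (m * n' + n * s') * (r * m' + s * r') := by ring
    rw [this, ← d1, ← d2, ← d3, ← d4]; norm_num
  have e5 : (Θ - 5 * b) * (m * a' + n * (Θ - 5 * b')) = a * (r * a' + s * (Θ - 5 * b')) := by
    apply mul_left_cancel₀ hx
    apply mul_left_cancel₀ hy
    linear_combination (-x * (Θ - 5 * b)) * e1 + x * a * e2
  obtain ⟨c1, c2⟩ := D.indepZ (s := -5 * l * n - 5 * b * m * a' + 25 * b * b' * n) (t := m * a' - 5 * n * b' - 5 * b * n)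
    (s' := a * r * a' - 5 * a * s * b') (t' := a * s) (by
      push_cast
      linear_combination e5 - n * D.hΘ)
  have h5r : (5 : ℤ) ∣ r := by
    have hp : Prime (5 : ℤ) := by norm_num
    have : (5 : ℤ) ∣ a * r * a' := ⟨-l * n - b * m * a' + 5 * b * b' * n + a * s * b', by linarith⟩
    rcases hp.dvd_or_dvd this with h1 | h1
    · rcases hp.dvd_or_dvd h1 with h1 | h1
      · exact absurd h1 (D.not5 h)
      · exact h1
    · exact absurd h1 (D.not5 h')
  obtain ⟨r₀, rfl⟩ := h5r
  obtain ⟨φ, hφ⟩ := D.emb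
  have e6 : (om l - 5 * b) * (m * a' + n * (om l - 5 * b')) = a * ((5 * r₀ : ℤ) * a' + s * (om l - 5 * b')) := by
    have := congrArg (fun u : 𝓞 K => φ u) e5
    simp only [map_mul, map_sub, map_add, map_intCast, map_natCast, hφ, map_ofNat] at this
    exact this
  have ha0 : (a : ℂ) ≠ 0 := by exact_mod_cast h.1.ne'
  have ha0' : (a' : ℂ) ≠ 0 := by exact_mod_cast h'.1.ne'
  have hT : (5 * a : ℂ) * tau l a b = om l - 5 * b := by
    rw [coe_tau D.hl.pos h.1]; field_simp
  have hT' : (5 * a' : ℂ) * tau l a' b' = om l - 5 * b' := by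
    rw [coe_tau D.hl.pos h'.1]; field_simp
  rw [← hT, ← hT'] at e6
  have e7 : (tau l a b : ℂ) * (5 * n * tau l a' b' + m) = s * tau l a' b' + r₀ := by
    apply mul_left_cancel₀ (mul_ne_zero (mul_ne_zero (by norm_num : (5 : ℂ) ≠ 0) ha0) ha0')
    push_cast at e6
    linear_combination e6
  have hpos : 0 < m * s - n * (5 * r₀) := by
    have hq := (tau l a b).im_pos
    have hv := (tau l a' b').im_pos
    have i1 := congrArg Complex.re e7
    have i2 := congrArg Complex.im e7
    simp at i1 i2
    set p := (tau l a b).re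
    set q := (tau l a b).im
    set u := (tau l a' b').re
    set v := (tau l a' b').im
    have : q * ((5 * n * u + m) ^ 2 + (5 * n * v) ^ 2) = v * (m * s - n * (5 * r₀)) := by
      linear_combination (5 * n * u + m) * i2 - 5 * n * v * i1
    have h0 : 0 ≤ v * (m * s - n * (5 * r₀) : ℝ) := by rw [← this]; positivity
    have h1 : 0 ≤ (m * s - n * (5 * r₀) : ℝ) := nonneg_of_mul_nonneg_right h0 hv
    have h2 : 0 ≤ m * s - n * (5 * r₀) := by exact_mod_cast h1
    rcases h2.lt_or_eq with h | h
    · exact h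
    · rw [← h] at hdet; simp at hdet
  have hone : m * s - n * (5 * r₀) = 1 := by
    rcases Int.eq_one_or_neg_one_of_mul_eq_one hdet with h | h
    · exact h
    · rw [h] at hpos; norm_num at hpos
  refine ⟨mkSL s r₀ (5 * n) m (by linarith), by simp, ?_⟩
  apply UpperHalfPlane.ext
  have hd : ((5 * n : ℤ) : ℂ) * tau l a' b' + (m : ℤ) ≠ 0 := by
    have := den_ne_zero (mkSL s r₀ (5 * n) m (by linarith)) (tau l a' b')
    simpa using this
  rw [coe_smul]
  simp only [mkSL_00, mkSL_01, mkSL_10, mkSL_11]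
  rw [div_eq_iff hd, ← e7]
  push_cast; ring

lemma Dat.principal_of (D : Dat l K Θ) {a : ℕ} {b : ℤ} (h : CM l a b) {γ : SL(2, ℤ)} (h5 : 5 ∣ γ 1 0)
    (hγ : γ • tau l 1 0 = tau l a b) : ∃ u : 𝓞 K, u ≠ 0 ∧ span {u} * IA Θ a b = span {(a : 𝓞 K)} := by
  obtain ⟨n, hn⟩ := h5
  have hdet := det_eq γ
  have ha0 : (a : ℂ) ≠ 0 := by exact_mod_cast h.1.ne'
  have hc := congrArg (fun z : ℍ => (z : ℂ)) hγ
  simp only [coe_smul] at hc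
  rw [div_eq_iff (den_ne_zero γ _), coe_tau D.hl.pos one_pos, coe_tau D.hl.pos h.1, hn] at hc
  obtain ⟨φ, hφ⟩ := D.emb
  set A := γ 0 0
  set B := γ 0 1
  set d := γ 1 1
  rw [hn] at hdet
  have e : (Θ - 5 * b) * (n * Θ + d) = a * (A * Θ + 5 * B) := by
    apply RingOfIntegers.ext
    apply φ.injective
    simp only [map_mul, map_sub, map_add, map_intCast, map_natCast, hφ, map_ofNat]
    push_cast at hc
    field_simp at hc
    linear_combination -hc
  refine ⟨n * Θ + d, ?_, ?_⟩
  · intro h0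
    have := D.indepZ (s := d) (t := n) (s' := 0) (t' := 0) (by push_cast; linear_combination h0)
    rw [this.1, this.2] at hdet; simp at hdet
  · rw [IA, Ideal.span_mul_span', Set.singleton_mul]
    apply le_antisymm
    · rw [Ideal.span_le]
      rintro _ ⟨z, hz, rfl⟩
      simp only [Set.mem_insert_iff, Set.mem_singleton_iff] at hz
      rcases hz with rfl | rfl
      · exact Ideal.mem_span_singleton'.mpr ⟨n * Θ + d, rfl⟩
      · exact Ideal.mem_span_singleton'.mpr ⟨A * Θ + 5 * B, by linear_combination -e⟩
    · rw [Ideal.span_singleton_le_iff_mem]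
      have hdet' : (A : 𝓞 K) * d - B * (5 * n) = 1 := by exact_mod_cast congrArg (Int.cast : ℤ → 𝓞 K) hdet
      have : (a : 𝓞 K) = A * ((n * Θ + d) * a) - n * ((n * Θ + d) * (Θ - 5 * b)) := by
        linear_combination n * e - a * hdet'
      have hm := Ideal.sub_mem (span ((fun x2 => (n * Θ + d) * x2) '' {(a : 𝓞 K), Θ - 5 * b}))
        (Ideal.mul_mem_left _ (A : 𝓞 K) (subset_span (Set.mem_image_of_mem _ (by simp : (a : 𝓞 K) ∈ _))))
        (Ideal.mul_mem_left _ (n : 𝓞 K) (subset_span (Set.mem_image_of_mem _ (by simp : Θ - 5 * b ∈ _))))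
      rw [← this] at hm
      exact hm

lemma IA_mul {a n : ℕ} (h : Nat.Coprime a n) (b : ℤ) : IA Θ n b * IA Θ a b = IA Θ (n * a) b := by
  have hc : IsCoprime (a : ℤ) (n : ℤ) := Nat.isCoprime_iff_coprime.mpr h
  obtain ⟨s, t, hst⟩ := hc
  have hst' : (s : 𝓞 K) * a + t * n = 1 := by exact_mod_cast congrArg (Int.cast : ℤ → 𝓞 K) hst
  rw [IA, IA, IA, Ideal.span_pair_mul_span_pair]
  apply le_antisymm
  · rw [Ideal.span_le]
    intro z hz
    simp only [Set.mem_insert_iff, Set.mem_singleton_iff] at hz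
    rw [SetLike.mem_coe, Ideal.mem_span_pair]
    rcases hz with rfl | rfl | rfl | rfl
    · exact ⟨1, 0, by push_cast; ring⟩
    · exact ⟨0, n, by push_cast; ring⟩
    · exact ⟨0, a, by push_cast; ring⟩
    · exact ⟨0, Θ - 5 * b, by push_cast; ring⟩
  · rw [Ideal.span_le]
    intro z hz
    simp only [Set.mem_insert_iff, Set.mem_singleton_iff] at hz
    rcases hz with rfl | rfl
    · exact subset_span (by simp)
    · have : Θ - 5 * b = s * ((Θ - 5 * b) * a) + t * (n * (Θ - 5 * b)) := by
        linear_combination -(Θ - 5 * b) * hst'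
      have h1 : (Θ - 5 * b) * a ∈ span {(n : 𝓞 K) * a, n * (Θ - 5 * b), (Θ - 5 * b) * a, (Θ - 5 * b) * (Θ - 5 * b)} :=
        subset_span (by simp)
      have h2 : n * (Θ - 5 * b) ∈ span {(n : 𝓞 K) * a, n * (Θ - 5 * b), (Θ - 5 * b) * a, (Θ - 5 * b) * (Θ - 5 * b)} :=
        subset_span (by simp)
      have hm := Ideal.add_mem _ (Ideal.mul_mem_left _ (s : 𝓞 K) h1) (Ideal.mul_mem_left _ (t : 𝓞 K) h2)
      rw [← this] at hm
      exact hm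

lemma IA_congr {a : ℕ} {b b' : ℤ} (h : (a : ℤ) ∣ b - b') : IA Θ a b = IA Θ a b' := by
  have key : ∀ {b b' : ℤ}, (a : ℤ) ∣ b - b' → IA Θ a b ≤ IA Θ a b' := by
    intro b b' h
    obtain ⟨k, hk⟩ := h
    have hk' : (b : 𝓞 K) - b' = a * k := by exact_mod_cast congrArg (Int.cast : ℤ → 𝓞 K) hk
    rw [IA, Ideal.span_le]
    intro z hz
    simp only [Set.mem_insert_iff, Set.mem_singleton_iff] at hz
    rw [SetLike.mem_coe, IA, Ideal.mem_span_pair]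
    rcases hz with rfl | rfl
    · exact ⟨1, 0, by ring⟩
    · exact ⟨-5 * k, 1, by linear_combination 5 * hk'⟩
  exact le_antisymm (key h) (key (by rw [← neg_sub]; exact (dvd_neg).mpr h))

lemma f_tau_congr (hl : 0 < l) {a : ℕ} (ha : 0 < a) {b b' : ℤ} (h : (a : ℤ) ∣ b - b') : f (tau l a b) = f (tau l a b') := by
  obtain ⟨k, hk⟩ := h
  have hk' : (b : ℂ) - b' = a * k := by exact_mod_cast congrArg (Int.cast : ℤ → ℂ) hk
  refine f_eq_of_sub (-k) ?_
  have ha0 : (a : ℂ) ≠ 0 := by exact_mod_cast ha.ne'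
  rw [coe_tau hl ha, coe_tau hl ha]
  field_simp
  push_cast
  linear_combination -5 * hk'

lemma CM.congr {a : ℕ} {b b' : ℤ} (h : (a : ℤ) ∣ b - b') (hc : CM l a b) : CM l a b' := by
  refine ⟨hc.1, ?_⟩
  have : 5 * b' ^ 2 + l = (5 * b ^ 2 + l) - (b - b') * (5 * (b + b')) := by ring
  rw [this]
  exact dvd_sub hc.2 (h.mul_right _)

lemma CM.of_mul {a n : ℕ} {b : ℤ} (h : CM l (n * a) b) : CM l a b ∧ CM l n b := by
  have h1 : 0 < a := Nat.pos_of_mul_pos_left h.1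
  have h2 : 0 < n := Nat.pos_of_mul_pos_right h.1
  refine ⟨⟨h1, ?_⟩, ⟨h2, ?_⟩⟩
  · exact (Dvd.intro_left (n : ℤ) (by push_cast; ring)).trans h.2
  · exact (Dvd.intro (a : ℤ) (by push_cast; ring)).trans h.2

lemma CM.crt {a n : ℕ} {b₁ b₀ : ℤ} (h₁ : CM l a b₁) (h₀ : CM l n b₀) (hc : Nat.Coprime a n) :
    ∃ b : ℤ, (a : ℤ) ∣ b - b₁ ∧ (n : ℤ) ∣ b - b₀ ∧ CM l (n * a) b := by
  have hcz : IsCoprime (a : ℤ) (n : ℤ) := Nat.isCoprime_iff_coprime.mpr hc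
  obtain ⟨s, t, hst⟩ := hcz
  have e1 : (a : ℤ) ∣ (s * a * b₀ + t * n * b₁) - b₁ := ⟨s * (b₀ - b₁), by linear_combination b₁ * hst⟩
  have e2 : (n : ℤ) ∣ (s * a * b₀ + t * n * b₁) - b₀ := ⟨t * (b₁ - b₀), by linear_combination b₀ * hst⟩
  refine ⟨s * a * b₀ + t * n * b₁, e1, e2, Nat.mul_pos h₀.1 h₁.1, ?_⟩
  have c1 := (h₁.congr (by rw [← neg_sub]; exact dvd_neg.mpr e1) : CM l a (s * a * b₀ + t * n * b₁)).2
  have c2 := (h₀.congr (by rw [← neg_sub]; exact dvd_neg.mpr e2) : CM l n (s * a * b₀ + t * n * b₁)).2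
  push_cast
  exact (Nat.isCoprime_iff_coprime.mpr hc).symm.mul_dvd c2 c1

end Quad2
end RR

namespace RR
open NumberField Ideal
open UpperHalfPlane hiding I
open scoped MatrixGroups

section Quad3

variable {l : ℕ} {K : Type} [Field K] [NumberField K] {Θ : 𝓞 K}

open Classical in
/-- ideal class (junk 1 on the zero ideal) -/
noncomputable def cl (I : Ideal (𝓞 K)) : ClassGroup (𝓞 K) :=
  if h : I = 0 then 1 else ClassGroup.mk0 ⟨I, mem_nonZeroDivisors_of_ne_zero h⟩

lemma cl_eq {I : Ideal (𝓞 K)} (h : I ≠ 0) : cl I = ClassGroup.mk0 ⟨I, mem_nonZeroDivisors_of_ne_zero h⟩ := by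
  rw [cl, dif_neg h]

lemma cl_mul {I J : Ideal (𝓞 K)} (hI : I ≠ 0) (hJ : J ≠ 0) : cl (I * J) = cl I * cl J := by
  rw [cl_eq hI, cl_eq hJ, cl_eq (mul_ne_zero hI hJ), ← map_mul]; rfl

lemma cl_iff {I J : Ideal (𝓞 K)} (hI : I ≠ 0) (hJ : J ≠ 0) :
    cl I = cl J ↔ ∃ x y : 𝓞 K, x ≠ 0 ∧ y ≠ 0 ∧ span {x} * I = span {y} * J := by
  rw [cl_eq hI, cl_eq hJ, ClassGroup.mk0_eq_mk0_iff]
  constructor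
  · rintro ⟨x, y, hx, hy, h⟩; exact ⟨x, y, hx, hy, h⟩
  · rintro ⟨x, y, hx, hy, h⟩; exact ⟨x, y, hx, hy, h⟩

lemma cl_span {x : 𝓞 K} (hx : x ≠ 0) : cl (span {x}) = 1 := by
  have h0 : span {x} ≠ 0 := by simpa using hx
  have h1 : cl (1 : Ideal (𝓞 K)) = 1 := by
    have := cl_mul (K := K) one_ne_zero one_ne_zero
    rw [one_mul] at this
    exact left_eq_mul.mp this
  rw [← h1, cl_iff h0 one_ne_zero]
  exact ⟨1, x, one_ne_zero, hx, by simp⟩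

/-- the two values of a CM class -/
def Pm (x y : ℂ) : Prop := x = y ∨ x = -y⁻¹

lemma Dat.pm_of_class (D : Dat l K Θ) {a a' : ℕ} {b b' : ℤ} (h : CM l a b) (h' : CM l a' b')
    (hc : cl (IA Θ a b) = cl (IA Θ a' b')) : Pm (f (tau l a b)) (f (tau l a' b')) := by
  obtain ⟨x, y, hx, hy, hI⟩ := (cl_iff (IA_ne h.1 b) (IA_ne h'.1 b')).mp hc
  obtain ⟨γ, h5, hγ⟩ := D.equiv_of_class h h' hx hy hI
  rw [← hγ, f_smul γ h5, dia]
  split_ifs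
  · exact Or.inl rfl
  · exact Or.inr rfl

lemma Dat.class_one (D : Dat l K Θ) {a : ℕ} {b : ℤ} (h : CM l a b) (hp : Pm (f (tau l a b)) (f (tau l 1 0))) :
    cl (IA Θ a b) = 1 := by
  have h13 : 13 ≤ l := by
    have h5 := D.h5
    have h4 := D.h4
    by_contra hlt
    have : l = 9 := by omega
    have hpr := D.hl
    rw [this] at hpr
    norm_num at hpr
  obtain ⟨γ, h5, hγ⟩ := near_cusp h13 hp
  have hγ' : γ⁻¹ • tau l 1 0 = tau l a b := by rw [← hγ, inv_smul_smul]
  have h5' : 5 ∣ γ⁻¹ 1 0 := by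
    rw [Matrix.SpecialLinearGroup.SL2_inv_expl]
    simpa using h5
  obtain ⟨u, hu, hI⟩ := D.principal_of h h5' hγ'
  have ha : (a : 𝓞 K) ≠ 0 := by exact_mod_cast h.1.ne'
  rw [← cl_span ha, ← hI, cl_mul (by simpa using hu) (IA_ne h.1 b), cl_span hu, one_mul]

/-- structure of ideals -/
lemma Dat.ideal_form (D : Dat l K Θ) {A : Ideal (𝓞 K)} (hA : A ≠ 0) : ∃ (g e : ℕ) (u : ℤ), g ≠ 0 ∧ e ≠ 0 ∧
    A = span {(g : 𝓞 K)} * span {(e : 𝓞 K), Θ - u} ∧ (e : ℤ) ∣ u ^ 2 + 5 * l := by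
  let T : AddSubgroup ℤ := 
    { carrier := {t | ∃ s : ℤ, (s : 𝓞 K) + t * Θ ∈ A}
      zero_mem' := ⟨0, by simp⟩
      add_mem' := by
        rintro t t' ⟨s, hs⟩ ⟨s', hs'⟩
        exact ⟨s + s', by have := A.add_mem hs hs'; push_cast; convert this using 1; ring⟩
      neg_mem' := by
        rintro t ⟨s, hs⟩
        exact ⟨-s, by have := A.neg_mem hs; push_cast; convert this using 1; ring⟩ }
  obtain ⟨g', hg'⟩ := Int.subgroup_cyclic T
  have hT : ∀ t, t ∈ T ↔ g' ∣ t := by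
    intro t; rw [hg', AddSubgroup.mem_closure_singleton]
    constructor
    · rintro ⟨n, rfl⟩; exact ⟨n, by simp [mul_comm]⟩
    · rintro ⟨n, rfl⟩; exact ⟨n, by simp [mul_comm]⟩
  set g := g'.natAbs with hg
  have hTg : ∀ t, t ∈ T ↔ (g : ℤ) ∣ t := fun t => by rw [hT, hg, Int.natAbs_dvd]
  set N := absNorm A with hN
  have hN0 : N ≠ 0 := fun h => hA (absNorm_eq_zero_iff.mp h)
  have hNA : (N : 𝓞 K) ∈ A := absNorm_mem A
  let E : AddSubgroup ℤ := A.toAddSubgroup.comap (Int.castAddHom (𝓞 K))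
  have hE : ∀ s, s ∈ E ↔ (s : 𝓞 K) ∈ A := fun s => Iff.rfl
  obtain ⟨k', hk'⟩ := Int.subgroup_cyclic E
  set k := k'.natAbs with hk
  have hEk : ∀ s, s ∈ E ↔ (k : ℤ) ∣ s := by
    intro t; rw [hk', AddSubgroup.mem_closure_singleton, hk, Int.natAbs_dvd]
    constructor
    · rintro ⟨n, rfl⟩; exact ⟨n, by simp [mul_comm]⟩
    · rintro ⟨n, rfl⟩; exact ⟨n, by simp [mul_comm]⟩
  have hk0 : k ≠ 0 := by
    intro h
    have : (k : ℤ) ∣ N := (hEk N).mp ((hE _).mpr (by exact_mod_cast hNA))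
    rw [h] at this; simp at this; exact hN0 this
  have hkA : (k : 𝓞 K) ∈ A := by
    have := (hE k).mp ((hEk k).mpr dvd_rfl); exact_mod_cast this
  have hgk : (g : ℤ) ∣ k := (hTg _).mp ⟨0, by simpa using A.mul_mem_right Θ hkA⟩
  have hg0 : g ≠ 0 := by
    intro h; rw [h] at hgk; simp at hgk; exact hk0 hgk
  obtain ⟨u₀, hu₀⟩ : (g : ℤ) ∈ T := (hTg _).mpr dvd_rfl
  have hgu : (g : ℤ) ∣ u₀ := (hTg _).mp ⟨-5 * l * g, by
    have := A.mul_mem_right Θ hu₀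
    convert this using 1
    push_cast
    linear_combination -(g : 𝓞 K) * D.hΘ⟩
  obtain ⟨e', he'⟩ := hgk
  obtain ⟨u₁, hu₁⟩ := hgu
  have he0 : 0 < e' := by
    have h1 : (0 : ℤ) < g * e' := by rw [← he']; exact_mod_cast Nat.pos_of_ne_zero hk0
    exact (pos_iff_pos_of_mul_pos h1).mp (by exact_mod_cast Nat.pos_of_ne_zero hg0)
  obtain ⟨e, rfl⟩ : ∃ e : ℕ, e' = e := ⟨e'.toNat, by omega⟩
  have hke : k = g * e := by exact_mod_cast he'
  have he : e ≠ 0 := by rintro rfl; simp at he0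
  refine ⟨g, e, -u₁, hg0, he, ?_, ?_⟩
  · apply le_antisymm
    · intro v hv
      obtain ⟨s, t, rfl⟩ := D.reprZ v
      obtain ⟨t', ht'⟩ := (hTg t).mp ⟨s, hv⟩
      have h1 : ((s - t' * u₀ : ℤ) : 𝓞 K) ∈ A := by
        have := A.sub_mem hv (A.mul_mem_left (t' : 𝓞 K) hu₀)
        convert this using 1
        rw [ht']; push_cast; ring
      obtain ⟨s', hs'⟩ := (hEk _).mp ((hE _).mpr h1)
      rw [Ideal.mem_span_singleton_mul]
      refine ⟨s' * e + t' * (Θ - (-u₁ : ℤ)), Ideal.mem_span_pair.mpr ⟨s', t', rfl⟩, ?_⟩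
      have hs2 : s = k * s' + t' * (g * u₁) := by rw [← hu₁]; linarith
      rw [hs2, ht', hke]; push_cast; ring
    · rw [Ideal.span_singleton_mul_le_iff]
      intro z hz
      obtain ⟨x, y, rfl⟩ := Ideal.mem_span_pair.mp hz
      have : (g : 𝓞 K) * (x * e + y * (Θ - (-u₁ : ℤ))) = x * k + y * (u₀ + (g : ℤ) * Θ) := by
        rw [hke, hu₁]; push_cast; ring
      rw [this]
      exact A.add_mem (A.mul_mem_left _ hkA) (A.mul_mem_left _ hu₀)
  · have h1 : (((g * (u₁ ^ 2 + 5 * l) : ℤ)) : 𝓞 K) ∈ A := by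
      have := A.mul_mem_left (u₁ - Θ) hu₀
      convert this using 1
      rw [hu₁]; push_cast
      linear_combination (g : 𝓞 K) * D.hΘ
    have h2 := (hEk _).mp ((hE _).mpr h1)
    rw [hke] at h2
    push_cast at h2
    have h3 := Int.dvd_of_mul_dvd_mul_left (a := (g : ℤ)) (by exact_mod_cast hg0) h2
    rw [neg_sq]; exact h3

lemma Dat.exists_rep (D : Dat l K Θ) (c : ClassGroup (𝓞 K)) {M : ℕ} (hM : M ≠ 0) :
    ∃ (a : ℕ) (b : ℤ), CM l a b ∧ Nat.Coprime a M ∧ cl (IA Θ a b) = c := by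
  set M' := 10 * M with hM'
  have hM0 : (M' : 𝓞 K) ≠ 0 := by
    have : M' ≠ 0 := by omega
    exact_mod_cast this
  obtain ⟨⟨J, hJm⟩, hJ⟩ := ClassGroup.mk0_surjective (R := 𝓞 K) c⁻¹
  have hJ0 : J ≠ 0 := nonZeroDivisors.ne_zero hJm
  have hclJ : cl J = c⁻¹ := by rw [cl_eq hJ0, hJ]
  have hspan : span {(M' : 𝓞 K)} ≠ 0 := by simpa using hM0
  obtain ⟨u, hu⟩ := IsDedekindDomain.exists_sup_span_eq (I := J * span {(M' : 𝓞 K)}) (J := J) Ideal.mul_le_left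
    (mul_ne_zero hJ0 hspan)
  have hntop : span {(M' : 𝓞 K)} ≠ ⊤ := by
    rw [Ne, Ideal.span_singleton_eq_top]
    intro h
    have h1 : absNorm (span {(M' : 𝓞 K)}) = 1 := by rw [Ideal.span_singleton_eq_top.mpr h]; simp
    rw [absNorm_span_natCast, NumberField.RingOfIntegers.rank, D.hK] at h1
    have h2 : M' = 1 := by
      rcases Nat.pow_eq_one.mp h1 with h | h
      · exact h
      · omega
    omega
  have hu0 : u ≠ 0 := by
    rintro rfl
    apply hntop
    simp only [Submodule.span_zero_singleton, Ideal.span, sup_bot_eq] at hu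
    have : J * span {(M' : 𝓞 K)} = J * ⊤ := by rw [Ideal.mul_top]; exact hu
    exact mul_left_cancel₀ hJ0 this
  have huJ : J ∣ span {u} := by
    rw [Ideal.dvd_iff_le, ← hu]; exact le_sup_right
  obtain ⟨A, hA⟩ := huJ
  have hA0 : A ≠ 0 := by
    rintro rfl
    rw [mul_zero] at hA
    exact hu0 (by simpa using hA)
  have hcop : span {(M' : 𝓞 K)} ⊔ A = ⊤ := by
    rw [hA, ← Ideal.mul_sup] at hu
    exact mul_left_cancel₀ hJ0 (hu.trans (Ideal.mul_top _).symm)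
  have hclA : cl A = c := by
    have := cl_mul hJ0 hA0
    rw [← hA, cl_span hu0, hclJ] at this
    rw [eq_comm, inv_mul_eq_one] at this
    exact this.symm
  obtain ⟨g, e, u', hg, he, hAe, hdvd⟩ := D.ideal_form hA0
  have hge : Nat.Coprime e M' := by
    rw [Nat.coprime_iff_gcd_eq_one]
    by_contra hne
    obtain ⟨p, hp, hpd⟩ := Nat.exists_prime_and_dvd hne
    have hpe : p ∣ e := hpd.trans (Nat.gcd_dvd_left _ _)
    have hpM : p ∣ M' := hpd.trans (Nat.gcd_dvd_right _ _)
    have h1 : (1 : 𝓞 K) ∈ span {(M' : 𝓞 K)} ⊔ A := by rw [hcop]; trivial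
    have hle : span {(M' : 𝓞 K)} ⊔ A ≤ span {(p : 𝓞 K), Θ - u'} := by
      apply sup_le
      · rw [Ideal.span_singleton_le_iff_mem]
        obtain ⟨k, hk⟩ := hpM
        rw [hk]; push_cast
        exact Ideal.mul_mem_right _ _ (subset_span (by simp))
      · rw [hAe]
        refine Ideal.mul_le_right.trans ?_
        rw [Ideal.span_le]
        obtain ⟨k, hk⟩ := hpe
        intro z hz
        simp only [Set.mem_insert_iff, Set.mem_singleton_iff] at hz
        rcases hz with rfl | rfl
        · rw [hk]; push_cast
          exact Ideal.mul_mem_right _ _ (subset_span (by simp))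
        · exact subset_span (by simp)
    obtain ⟨x, y, hxy⟩ := Ideal.mem_span_pair.mp (hle h1)
    obtain ⟨s, t, rfl⟩ := D.reprZ x
    obtain ⟨s', t', rfl⟩ := D.reprZ y
    obtain ⟨k, hk⟩ := (Int.natCast_dvd_natCast.mpr hpe).trans hdvd
    have hk' : (u' : 𝓞 K) ^ 2 + 5 * l = p * k := by exact_mod_cast congrArg (Int.cast : ℤ → 𝓞 K) hk
    obtain ⟨c1, c2⟩ := D.indepZ (s := 1) (t := 0) (s' := s * p - 5 * l * t' - s' * u') (t' := t * p + s' - t' * u') (by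
      push_cast
      linear_combination -hxy + t' * D.hΘ)
    have : (p : ℤ) ∣ 1 := ⟨s - t' * k + u' * t, by
      linear_combination c1 - t' * hk + u' * c2⟩
    exact hp.one_lt.ne' (by exact_mod_cast Int.eq_one_of_dvd_one (by positivity) this)
  have hc5 : IsCoprime (e : ℤ) 5 := by
    have : Nat.Coprime e 5 := hge.coprime_dvd_right ⟨2 * M, by rw [hM']; ring⟩
    exact_mod_cast Nat.isCoprime_iff_coprime.mpr this
  obtain ⟨x, y, hxy⟩ := hc5
  have hcl : cl A = cl (span {(e : 𝓞 K), Θ - u'}) := by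
    have hg' : (g : 𝓞 K) ≠ 0 := by exact_mod_cast hg
    have : span {(e : 𝓞 K), Θ - u'} ≠ 0 := by
      intro h0; rw [h0, mul_zero] at hAe; exact hA0 hAe
    rw [hAe, cl_mul (by simpa using hg') this, cl_span hg', one_mul]
  have hIA : span {(e : 𝓞 K), Θ - u'} = IA Θ e (y * u') := by
    have hxy' : (x : 𝓞 K) * e + y * 5 = 1 := by exact_mod_cast congrArg (Int.cast : ℤ → 𝓞 K) hxy
    rw [IA]
    apply le_antisymm
    · rw [Ideal.span_le]
      intro z hz
      simp only [Set.mem_insert_iff, Set.mem_singleton_iff] at hz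
      rw [SetLike.mem_coe, Ideal.mem_span_pair]
      rcases hz with rfl | rfl
      · exact ⟨1, 0, by ring⟩
      · exact ⟨-x * u', 1, by push_cast; linear_combination -(u' : 𝓞 K) * hxy'⟩
    · rw [Ideal.span_le]
      intro z hz
      simp only [Set.mem_insert_iff, Set.mem_singleton_iff] at hz
      rw [SetLike.mem_coe, Ideal.mem_span_pair]
      rcases hz with rfl | rfl
      · exact ⟨1, 0, by ring⟩
      · exact ⟨x * u', 1, by push_cast; linear_combination (u' : 𝓞 K) * hxy'⟩
  refine ⟨e, y * u', ⟨Nat.pos_of_ne_zero he, ?_⟩, hge.coprime_dvd_right ⟨10, by rw [hM']; ring⟩, ?_⟩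
  · have h1 : (e : ℤ) ∣ 5 * (5 * (y * u') ^ 2 + l) := by
      obtain ⟨k, hk⟩ := hdvd
      refine ⟨k - x * u' ^ 2 * (1 + 5 * y), ?_⟩
      linear_combination hk - u' ^ 2 * (1 + 5 * y) * (-hxy)
    exact (show IsCoprime (e : ℤ) 5 from ⟨x, y, hxy⟩).dvd_of_dvd_mul_left h1
  · rw [← hIA, ← hcl, hclA]

/-- degree one primes -/
lemma Dat.prime_form (D : Dat l K Θ) {P : Ideal (𝓞 K)} (hp : (absNorm P).Prime) (h5 : ¬ absNorm P ∣ 10 * l) :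
    ∃ b : ℤ, CM l (absNorm P) b ∧ Θ - 5 * b ∈ P := by
  set p := absNorm P with hpdef
  have hpP : (p : 𝓞 K) ∈ P := absNorm_mem P
  have hInt : ∀ n : ℤ, (n : 𝓞 K) ∈ P → (p : ℤ) ∣ n := by
    intro n hn
    have h1 : ¬ IsCoprime (p : ℤ) n := by
      rintro ⟨x, y, hxy⟩
      have hxy' : (x : 𝓞 K) * p + y * n = 1 := by exact_mod_cast congrArg (Int.cast : ℤ → 𝓞 K) hxy
      have : (1 : 𝓞 K) ∈ P := by
        rw [← hxy']; exact P.add_mem (P.mul_mem_left _ hpP) (P.mul_mem_left _ hn)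
      have ht : P = ⊤ := (Ideal.eq_top_iff_one _).mpr this
      rw [hpdef, ht] at hp
      simp at hp
      exact Nat.not_prime_one hp
    by_contra hnd
    exact h1 ((Nat.prime_iff_prime_int.mp hp).coprime_iff_not_dvd.mpr hnd)
  have hP0 : P ≠ 0 := by
    rintro rfl
    rw [hpdef] at hp; simp at hp; exact Nat.not_prime_zero hp
  obtain ⟨g, e, u, hg, he, hPe, hdvd⟩ := D.ideal_form hP0
  have hprime : Prime P := by
    have := Ideal.isPrime_of_irreducible_absNorm (I := P) (by rw [← hpdef]; exact hp)
    exact Ideal.prime_of_isPrime hP0 this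
  have hNg : absNorm (span {(g : 𝓞 K)}) = g ^ 2 := by
    rw [absNorm_span_natCast, NumberField.RingOfIntegers.rank, D.hK]
  have hg1 : g = 1 := by
    have : p = g ^ 2 * absNorm (span {(e : 𝓞 K), Θ - u}) := by
      rw [hpdef, ← hNg, ← map_mul, ← hPe]
    have h1 : g ^ 2 ∣ p := Dvd.intro _ this.symm
    by_contra hne
    have h2 : g * g ∣ p := by rwa [← sq]
    have h3 := hp.prime.squarefree g h2
    exact hne (Nat.isUnit_iff.mp h3)
  have huP : Θ - u ∈ P := by
    rw [hPe, hg1]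
    simp only [Nat.cast_one, Ideal.span_singleton_one, Ideal.top_mul]
    exact subset_span (by simp)
  have hc5 : IsCoprime (p : ℤ) 5 := by
    have : Nat.Coprime p 5 := by
      rw [Nat.Prime.coprime_iff_not_dvd hp]
      intro h; exact h5 (h.trans ⟨2 * l, by ring⟩)
    exact_mod_cast Nat.isCoprime_iff_coprime.mpr this
  obtain ⟨x, y, hxy⟩ := hc5
  have hxy' : (x : 𝓞 K) * p + y * 5 = 1 := by exact_mod_cast congrArg (Int.cast : ℤ → 𝓞 K) hxy
  have hm : Θ - 5 * (y * u : ℤ) ∈ P := by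
    have := P.add_mem huP (P.mul_mem_left (x * u) hpP)
    convert this using 1
    push_cast
    linear_combination -(u : 𝓞 K) * hxy'
  refine ⟨y * u, ⟨hp.pos, ?_⟩, hm⟩
  have h1 : (p : ℤ) ∣ 5 * (5 * (y * u) ^ 2 + l) := by
    apply hInt
    have := P.mul_mem_left (-(Θ + 5 * (y * u : ℤ))) hm
    convert this using 1
    push_cast
    linear_combination D.hΘ
  exact (show IsCoprime (p : ℤ) 5 from ⟨x, y, hxy⟩).dvd_of_dvd_mul_left h1

end Quad3
end RR

namespace RR
open NumberField Ideal

section Frob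

lemma absNorm_eq_of_pow {F : Type*} [Field F] [NumberField F] {p : ℕ} (hp : p.Prime) (Q : Ideal (𝓞 F)) [Q.IsPrime]
    (hpQ : (p : 𝓞 F) ∈ Q) (h : ∀ u : 𝓞 F, u - u ^ p ∈ Q) :
    absNorm Q = p ∧ ∀ u : 𝓞 F, ∃ m : ℤ, u - m ∈ Q := by
  have hQ0 : Q ≠ ⊥ := by
    rintro rfl
    rw [Ideal.mem_bot] at hpQ
    exact hp.ne_zero (by exact_mod_cast hpQ)
  have : Q.IsMaximal := IsPrime.isMaximal inferInstance hQ0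
  let := Ideal.Quotient.field Q
  have : Finite (𝓞 F ⧸ Q) := Ideal.finiteQuotientOfFreeOfNeBot Q hQ0
  let := Fintype.ofFinite (𝓞 F ⧸ Q)
  have hcard : absNorm Q = Fintype.card (𝓞 F ⧸ Q) := by
    rw [absNorm_apply, Submodule.cardQuot_apply, Nat.card_eq_fintype_card]
  have hle : Fintype.card (𝓞 F ⧸ Q) ≤ p := by
    have hne : (Polynomial.X ^ p - Polynomial.X : Polynomial (𝓞 F ⧸ Q)) ≠ 0 :=
      FiniteField.X_pow_card_sub_X_ne_zero _ hp.one_lt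
    have hdeg := FiniteField.X_pow_card_sub_X_natDegree_eq (𝓞 F ⧸ Q) hp.one_lt
    have := Polynomial.card_le_degree_of_subset_roots (p := (Polynomial.X ^ p - Polynomial.X : Polynomial (𝓞 F ⧸ Q)))
      (Z := Finset.univ) (by
        intro x hx
        rw [Polynomial.mem_roots hne, Polynomial.IsRoot.def, Polynomial.eval_sub, Polynomial.eval_pow, Polynomial.eval_X]
        obtain ⟨u, rfl⟩ := Ideal.Quotient.mk_surjective x
        rw [← map_pow, ← map_sub, Ideal.Quotient.eq_zero_iff_mem]
        have := Q.neg_mem (h u)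
        rwa [neg_sub] at this)
    rw [hdeg] at this
    simpa using this
  have hN : absNorm Q = p := by
    have h1 : absNorm Q ∣ p ^ (Module.finrank ℤ (𝓞 F)) := by
      rw [← absNorm_span_natCast]
      exact absNorm_dvd_absNorm_of_le ((span_singleton_le_iff_mem _).mpr hpQ)
    obtain ⟨j, -, hj⟩ := (Nat.dvd_prime_pow hp).mp h1
    have hj0 : j ≠ 0 := by
      rintro rfl
      rw [pow_zero] at hj
      exact IsPrime.ne_top inferInstance (absNorm_eq_one_iff.mp hj)
    refine le_antisymm (hcard ▸ hle) ?_
    rw [hj]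
    exact Nat.le_self_pow hj0 p
  refine ⟨hN, fun u => ?_⟩
  let e := ZMod.ringEquivOfPrime (𝓞 F ⧸ Q) hp (hcard ▸ hN)
  obtain ⟨x, hx⟩ := e.surjective (Ideal.Quotient.mk Q u)
  obtain ⟨m, rfl⟩ := ZMod.intCast_surjective x
  refine ⟨m, ?_⟩
  rw [← Ideal.Quotient.eq_zero_iff_mem, map_sub, ← hx, map_intCast, map_intCast, sub_self]

variable {K : Type*} [Field K] [NumberField K] {N : Type*} [Field N] [NumberField N] [Algebra K N] [IsGalois K N]

lemma nat_not_mem {p n : ℕ} (hp : p.Prime) {R : Type*} [CommRing R] (Q : Ideal R) [Q.IsPrime] (hpQ : (p : R) ∈ Q)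
    (h : ¬ p ∣ n) : (n : R) ∉ Q := by
  intro hn
  have hc : Nat.Coprime p n := (Nat.Prime.coprime_iff_not_dvd hp).mpr h
  have := Nat.isCoprime_iff_coprime.mpr hc
  obtain ⟨a, b, hab⟩ := this
  apply IsPrime.ne_top (I := Q) inferInstance
  rw [Ideal.eq_top_iff_one]
  have h1 : (1 : R) = a * (p : R) + b * (n : R) := by exact_mod_cast (congrArg (Int.cast : ℤ → R) hab).symm
  rw [h1]
  exact Q.add_mem (Q.mul_mem_left _ hpQ) (Q.mul_mem_left _ hn)

theorem frob_generate (hK : Module.finrank ℚ K = 2) (H : Subgroup (N ≃ₐ[K] N)) {B : ℕ} (hB : B ≠ 0)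
    (h : ∀ (𝔓 : Ideal (𝓞 N)) [𝔓.IsPrime] (p : ℕ), p.Prime → absNorm (𝔓.comap (algebraMap (𝓞 K) (𝓞 N))) = p →
      ¬ p ∣ B → ∀ σ : N ≃ₐ[K] N, (∀ u : 𝓞 N, σ • u - u ^ p ∈ 𝔓) → σ ∈ H) : H = ⊤ := by
  by_contra hH
  obtain ⟨σ₀, hσ₀⟩ : ∃ σ₀, σ₀ ∉ H := by
    by_contra hcon
    push Not at hcon
    exact hH (eq_top_iff.mpr fun x _ => hcon x)
  obtain ⟨e, he⟩ : ∃ e : 𝓞 (IntermediateField.fixedField H), σ₀ • (algebraMap _ (𝓞 N) e) ≠ algebraMap _ (𝓞 N) e := by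
    by_contra hcon
    push Not at hcon
    apply hσ₀
    rw [← IntermediateField.fixingSubgroup_fixedField H, IntermediateField.mem_fixingSubgroup_iff]
    intro x hx
    obtain ⟨u, v, hv, huv⟩ := IsFractionRing.div_surjective (A := 𝓞 (IntermediateField.fixedField H)) (⟨x, hx⟩ : IntermediateField.fixedField H)
    have hu := congrArg (algebraMap (𝓞 N) N) (hcon u)
    have hv := congrArg (algebraMap (𝓞 N) N) (hcon v)
    have hx' : x = algebraMap (𝓞 N) N (algebraMap _ (𝓞 N) u) / algebraMap (𝓞 N) N (algebraMap _ (𝓞 N) v) := by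
      have := congrArg (algebraMap (IntermediateField.fixedField H) N) huv
      rw [map_div₀] at this
      exact this.symm
    rw [hx', map_div₀]
    exact congrArg₂ (· / ·) hu hv
  let F := IntermediateField.fixedField H
  set δ : 𝓞 N := σ₀ • (algebraMap (𝓞 F) (𝓞 N) e) - algebraMap (𝓞 F) (𝓞 N) e with hδ
  have hδ0 : δ ≠ 0 := sub_ne_zero.mpr he
  set n := absNorm (span {δ}) with hn
  have hn0 : n ≠ 0 := by
    rw [hn, Ne, absNorm_eq_zero_iff, span_singleton_eq_bot]
    exact hδ0
  have key : ∀ (𝔓 : Ideal (𝓞 N)) [𝔓.IsPrime] (p : ℕ), p.Prime → absNorm (𝔓.comap (algebraMap (𝓞 K) (𝓞 N))) = p →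
      ¬ p ∣ B → absNorm (𝔓.comap (algebraMap (𝓞 F) (𝓞 N))) = p ∧
        ∀ u : 𝓞 F, ∃ m : ℤ, u - m ∈ 𝔓.comap (algebraMap (𝓞 F) (𝓞 N)) := by
    intro 𝔓 _ p hp hP hpB
    have hpP : (p : 𝓞 N) ∈ 𝔓 := by
      have := absNorm_mem (𝔓.comap (algebraMap (𝓞 K) (𝓞 N)))
      rw [hP, mem_comap, map_natCast] at this
      exact this
    have h0 : 𝔓 ≠ ⊥ := by
      rintro rfl
      rw [Ideal.mem_bot] at hpP
      exact hp.ne_zero (by exact_mod_cast hpP)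
    have : Finite (𝓞 N ⧸ 𝔓) := Ideal.finiteQuotientOfFreeOfNeBot 𝔓 h0
    obtain ⟨σ, hσ⟩ := IsArithFrobAt.exists_of_isInvariant (𝓞 K) (N ≃ₐ[K] N) 𝔓
    have hc : Nat.card (𝓞 K ⧸ 𝔓.under (𝓞 K)) = p := by
      rw [← hP, absNorm_apply, Submodule.cardQuot_apply]
    have hσ' : ∀ u : 𝓞 N, σ • u - u ^ p ∈ 𝔓 := by
      intro u
      have := hσ u
      rw [hc] at this
      exact this
    have hσH := h 𝔓 p hp hP hpB σ hσ'
    refine absNorm_eq_of_pow hp _ (by rw [mem_comap, map_natCast]; exact hpP) ?_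
    intro u
    rw [mem_comap, map_sub, map_pow]
    have h1 : σ • (algebraMap (𝓞 F) (𝓞 N) u) = algebraMap (𝓞 F) (𝓞 N) u := by
      apply RingOfIntegers.ext
      exact u.1.2 ⟨σ, hσH⟩
    have := hσ' (algebraMap (𝓞 F) (𝓞 N) u)
    rwa [h1] at this
  refine zeta_contra (K := K) (F := F) hK (B := B * n) (mul_ne_zero hB hn0)
    (fun Q => Q.comap (algebraMap (𝓞 K) (𝓞 F))) ?_
  intro P hP hPp hPB
  have hPB1 : ¬ absNorm P ∣ B := fun h => hPB (h.mul_right _)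
  have hPB2 : ¬ absNorm P ∣ n := fun h => hPB (h.mul_left _)
  have : P.IsPrime := isPrime_of_prime hP
  obtain ⟨𝔓, -, h𝔓, hcom⟩ := Ideal.exists_ideal_over_prime_of_isIntegral P (⊥ : Ideal (𝓞 N)) (by
    rw [Ideal.comap_bot_of_injective _ (FaithfulSMul.algebraMap_injective (𝓞 K) (𝓞 N))]; exact bot_le)
  let s₀ : 𝓞 N →+* 𝓞 N := MulSemiringAction.toRingHom (N ≃ₐ[K] N) (𝓞 N) σ₀
  have hs₀ : ∀ x, s₀ x = σ₀ • x := fun x => rfl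
  have hcom2 : (𝔓.comap s₀).comap (algebraMap (𝓞 K) (𝓞 N)) = P := by
    rw [← hcom]
    ext x
    simp only [mem_comap, hs₀, smul_algebraMap]
  obtain ⟨k1, k1'⟩ := key 𝔓 (absNorm P) hPp (by rw [hcom]) hPB1
  obtain ⟨k2, -⟩ := key (𝔓.comap s₀) (absNorm P) hPp (by rw [hcom2]) hPB1
  have hpr : ∀ Q : Ideal (𝓞 F), Q.IsPrime → absNorm Q = absNorm P → Prime Q := by
    intro Q hQ hn
    refine prime_of_isPrime ?_ hQ
    rintro rfl
    rw [absNorm_bot] at hn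
    exact hPp.ne_zero hn.symm
  have htow : ∀ x, algebraMap (𝓞 F) (𝓞 N) (algebraMap (𝓞 K) (𝓞 F) x) = algebraMap (𝓞 K) (𝓞 N) x := by
    intro x
    exact (IsScalarTower.algebraMap_apply (𝓞 K) (𝓞 F) (𝓞 N) x).symm
  refine ⟨𝔓.comap (algebraMap (𝓞 F) (𝓞 N)), (𝔓.comap s₀).comap (algebraMap (𝓞 F) (𝓞 N)), ?_,
    hpr _ inferInstance k1, hpr _ inferInstance k2, k1, k2, ?_, ?_⟩
  · intro heq
    obtain ⟨m, hm⟩ := k1' e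
    have hm2 := hm
    rw [heq] at hm2
    simp only [mem_comap, map_sub, map_intCast] at hm hm2
    have h3 := 𝔓.sub_mem hm2 hm
    rw [hs₀, sub_sub_sub_cancel_right] at h3
    have hmem : (n : 𝓞 N) ∈ 𝔓 := by
      have : span {δ} ≤ 𝔓 := (span_singleton_le_iff_mem _).mpr h3
      exact this (absNorm_mem _)
    refine nat_not_mem hPp 𝔓 ?_ hPB2 hmem
    have := absNorm_mem P
    rw [← hcom] at this
    rw [mem_comap, map_natCast, hcom] at this
    exact this
  · rw [← hcom]
    ext x
    simp only [mem_comap, htow]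
  · rw [← hcom2]
    ext x
    simp only [mem_comap, htow]

end Frob

end RR

namespace RR
open NumberField Ideal

section Setup

variable {l : ℕ} {K : Type} [Field K] [NumberField K] {Θ : 𝓞 K} {N : Type} [Field N] [NumberField N] [Algebra K N]

/-- a number field containing all the relevant values -/
structure Stp (l : ℕ) (K : Type) [Field K] [NumberField K] (Θ : 𝓞 K) (N : Type) [Field N] [NumberField N] [Algebra K N]
    (ψ : N →+* ℂ) : Prop where
  D : Dat l K Θ
  hψ : ψ (algebraMap K N Θ) = om l
  hX : ∀ a b, CM l a b → ∃ y : 𝓞 N, ψ y = f (tau l a b)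
  hX' : ∀ a b, CM l a b → ∃ y : 𝓞 N, ψ y = -(f (tau l a b))⁻¹

lemma int_mem_dvd {p : ℕ} {n : ℤ} (hp : p.Prime) {R : Type*} [CommRing R] (Q : Ideal R) [Q.IsPrime] (hpQ : (p : R) ∈ Q)
    (h : (n : R) ∈ Q) : (p : ℤ) ∣ n := by
  by_contra hn
  rw [Int.natCast_dvd] at hn
  refine nat_not_mem hp Q hpQ hn ?_
  rcases Int.natAbs_eq n with h1 | h1
  · rw [h1] at h; simpa using h
  · rw [h1, Int.cast_neg, Q.neg_mem_iff] at h; simpa using h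

lemma exists_of_mem_AA (ψ : N →+* ℂ) {y : N} (h : ψ y ∈ AA) : ∃ z : 𝓞 N, (z : N) = y := by
  have h1 : IsIntegral ℤ (ψ y) := h
  have h2 : IsIntegral ℤ y := (isIntegral_algHom_iff (ψ.toIntAlgHom) ψ.injective).mp h1
  exact ⟨⟨y, h2⟩, rfl⟩

variable {ψ : N →+* ℂ}

lemma Stp.frob_mem (S : Stp l K Θ N ψ) (𝔓 : Ideal (𝓞 N)) [𝔓.IsPrime] {p : ℕ} (hp : p.Prime) (hp𝔓 : (p : 𝓞 N) ∈ 𝔓)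
    (hp10 : ¬ p ∣ 10 * l) {a : ℕ} {b : ℤ} (hb : algebraMap (𝓞 K) (𝓞 N) Θ - 5 * b ∈ 𝔓) (hc : CM l (p * a) b)
    {y y' : 𝓞 N} (hy : ψ y = f (tau l (p * a) b)) (hy' : ψ y' = f (tau l a b)) : y ^ p - y' ∈ 𝔓 := by
  have ha : 0 < a := Nat.pos_of_mul_pos_left hc.1
  obtain ⟨z, hz, d, hd, heq⟩ := core S.D.hl.pos ha hp hp10 hc.2
  set Θ' := algebraMap (𝓞 K) (𝓞 N) Θ with hΘ'
  have hψΘ : ψ Θ' = om l := S.hψ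
  have hpc : (p : ℂ) ≠ 0 := by exact_mod_cast hp.ne_zero
  set w : 𝓞 N := (y ^ p - y') * (Θ' - 5 * b + d) ^ 48 with hw
  have hψw : ψ w = p * z := by
    rw [← heq, hw]
    simp only [map_mul, map_sub, map_pow, map_add, map_intCast, map_ofNat, hψΘ, hy, hy']
  obtain ⟨z', hz'⟩ := exists_of_mem_AA ψ (y := (w : N) / p) (by
    rw [map_div₀, hψw, map_natCast, mul_div_cancel_left₀ _ hpc]; exact hz)
  have hwz : w = p * z' := by
    apply RingOfIntegers.ext
    have hpn : (p : N) ≠ 0 := by exact_mod_cast hp.ne_zero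
    have : algebraMap (𝓞 N) N (p * z') = p * algebraMap (𝓞 N) N z' := by rw [map_mul, map_natCast]
    refine Eq.trans ?_ this.symm
    have h2 : algebraMap (𝓞 N) N z' = (w : N) / p := hz'
    rw [h2]
    field_simp
  have hwm : w ∈ 𝔓 := by rw [hwz]; exact 𝔓.mul_mem_right _ hp𝔓
  rcases IsPrime.mem_or_mem (I := 𝔓) inferInstance hwm with h | h
  · exact h
  exfalso
  have h1 := IsPrime.mem_of_pow_mem (I := 𝔓) inferInstance _ h
  have h2 : ((d : ℤ) : 𝓞 N) ∈ 𝔓 := by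
    have := 𝔓.sub_mem h1 hb
    rwa [add_sub_cancel_left] at this
  have h3 := int_mem_dvd hp 𝔓 hp𝔓 h2
  have h4 : (p : ℤ) ∣ 10 * b := by
    have := dvd_sub h3 hd
    rwa [sub_sub_cancel] at this
  have h5 : (p : ℤ) ∣ 5 * b ^ 2 + l := (Dvd.intro _ (by push_cast; rfl)).trans hc.2
  have hpp := Nat.prime_iff_prime_int.mp hp
  have h10 : ¬ (p : ℤ) ∣ 10 := fun h => hp10 (by
    have : p ∣ 10 := by exact_mod_cast h
    exact this.mul_right _)
  have h6 := (hpp.dvd_or_dvd h4).resolve_left h10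
  have h7 : (p : ℤ) ∣ l := by
    have : (p : ℤ) ∣ 5 * b ^ 2 := (h6.pow (by norm_num)).mul_left _
    exact (dvd_add_right this).mp h5
  exact hp10 ((by exact_mod_cast h7 : p ∣ l).mul_left _)

/-- representatives of the classes -/
noncomputable def Dat.rep (D : Dat l K Θ) (c : ClassGroup (𝓞 K)) : ℕ × ℤ :=
  (Classical.choose (D.exists_rep c (M := 1) one_ne_zero),
    Classical.choose (Classical.choose_spec (D.exists_rep c (M := 1) one_ne_zero)))

lemma Dat.rep_spec (D : Dat l K Θ) (c : ClassGroup (𝓞 K)) : CM l (D.rep c).1 (D.rep c).2 ∧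
    cl (IA Θ (D.rep c).1 (D.rep c).2) = c :=
  have h := Classical.choose_spec (Classical.choose_spec (D.exists_rep c (M := 1) one_ne_zero))
  ⟨h.1, h.2.2⟩

/-- value attached to a class -/
noncomputable def Dat.xc (D : Dat l K Θ) (c : ClassGroup (𝓞 K)) : ℂ := f (tau l (D.rep c).1 (D.rep c).2)

lemma Dat.pm_xc (D : Dat l K Θ) {a b} (h : CM l a b) : Pm (f (tau l a b)) (D.xc (cl (IA Θ a b))) :=
  D.pm_of_class h (D.rep_spec _).1 (D.rep_spec _).2.symm

/-- the finite set of values and their negative inverses -/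
def Stp.X (S : Stp l K Θ N ψ) : Set (𝓞 N) := {y | ∃ c, Pm (ψ y) (S.D.xc c)}

lemma Pm.symm {x y : ℂ} (h : Pm x y) : Pm y x := by
  rcases h with h | h
  · exact Or.inl h.symm
  · right; rw [h]; simp

lemma Pm.trans {x y z : ℂ} (h : Pm x y) (h' : Pm y z) : Pm x z := by
  rcases h with h | h <;> rcases h' with h' | h' <;> subst h <;> subst h'
  · left; rfl
  · right; rfl
  · right; rfl
  · left; simp

lemma Stp.X_of (S : Stp l K Θ N ψ) {a b} (h : CM l a b) {y : 𝓞 N} (hy : Pm (ψ y) (f (tau l a b))) : y ∈ S.X :=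
  ⟨_, hy.trans (S.D.pm_xc h)⟩

lemma Stp.inj (_S : Stp l K Θ N ψ) {y y' : 𝓞 N} (h : ψ y = ψ y') : y = y' :=
  RingOfIntegers.ext (ψ.injective h)

lemma Stp.X_fin (S : Stp l K Θ N ψ) : S.X.Finite := by
  have : S.X = ⋃ c : ClassGroup (𝓞 K), (fun y : 𝓞 N => ψ y) ⁻¹' {x | Pm x (S.D.xc c)} := by
    ext y; simp [Stp.X]
  rw [this]
  refine Set.finite_iUnion fun c => Set.Finite.preimage ?_ ?_
  · intro y _ y' _ h
    exact S.inj h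
  · have : {x | Pm x (S.D.xc c)} = {S.D.xc c, -(S.D.xc c)⁻¹} := by
      ext x; simp [Pm]
    rw [this]
    simp

lemma exists_bad (T : Set (𝓞 N)) (hT : T.Finite) : ∃ B : ℕ, B ≠ 0 ∧ ∀ t ∈ T, t ≠ 0 → (B : 𝓞 N) ∈ span {t} := by
  induction T, hT using Set.Finite.induction_on with
  | empty => exact ⟨1, one_ne_zero, by simp⟩
  | @insert a s _ _ ih =>
    obtain ⟨B, hB, h⟩ := ih
    by_cases ha : a = 0
    · refine ⟨B, hB, ?_⟩
      rintro t (rfl | ht) h0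
      · exact absurd ha h0
      · exact h t ht h0
    · refine ⟨B * absNorm (span {a}), mul_ne_zero hB ?_, ?_⟩
      · rw [Ne, absNorm_eq_zero_iff, span_singleton_eq_bot]; exact ha
      · rintro t (rfl | ht) h0
        · rw [Nat.cast_mul]; exact mul_mem_left _ _ (absNorm_mem _)
        · rw [Nat.cast_mul]; exact mul_mem_right _ _ (h t ht h0)

lemma Stp.exists_B (S : Stp l K Θ N ψ) : ∃ B : ℕ, B ≠ 0 ∧ 10 * l ∣ B ∧ ∀ (σ : N ≃ₐ[K] N) (y y' : 𝓞 N), y ∈ S.X → y' ∈ S.X →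
    ∀ (𝔓 : Ideal (𝓞 N)) [𝔓.IsPrime] (p : ℕ), p.Prime → (p : 𝓞 N) ∈ 𝔓 → ¬ p ∣ B → σ • y - y' ∈ 𝔓 → σ • y = y' := by
  obtain ⟨B, hB, h⟩ := exists_bad (Set.range fun q : (N ≃ₐ[K] N) × S.X × S.X => q.1 • (q.2.1 : 𝓞 N) - (q.2.2 : 𝓞 N)) (by
    have := S.X_fin.to_subtype
    have : Finite (N ≃ₐ[K] N) := by
      have : Module.Finite K N := Module.Finite.of_restrictScalars_finite ℚ K N
      infer_instance
    exact Set.finite_range _)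
  refine ⟨10 * l * B, mul_ne_zero (mul_ne_zero (by norm_num) S.D.hl.ne_zero) hB, Dvd.intro _ rfl, ?_⟩
  intro σ y y' hy hy' 𝔓 _ p hp hp𝔓 hpB hmem
  by_contra hne
  have h1 := h _ ⟨(σ, ⟨y, hy⟩, ⟨y', hy'⟩), rfl⟩ (sub_ne_zero.mpr hne)
  have h2 : (B : 𝓞 N) ∈ 𝔓 := (span_singleton_le_iff_mem _).mpr hmem h1
  exact nat_not_mem hp 𝔓 hp𝔓 (fun h => hpB (h.mul_left _)) h2

end Setup

end RR

namespace RR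
open NumberField Ideal
open scoped Pointwise

section Path

variable {l : ℕ} {K : Type} [Field K] [NumberField K] {Θ : 𝓞 K} {N : Type} [Field N] [NumberField N] [Algebra K N]
  {ψ : N →+* ℂ}

/-- the integer B kills all coincidences -/
def Stp.Good (S : Stp l K Θ N ψ) (B : ℕ) : Prop := B ≠ 0 ∧ 10 * l ∣ B ∧ ∀ (σ : N ≃ₐ[K] N) (y y' : 𝓞 N), y ∈ S.X → y' ∈ S.X →
    ∀ (𝔓 : Ideal (𝓞 N)) [𝔓.IsPrime] (p : ℕ), p.Prime → (p : 𝓞 N) ∈ 𝔓 → ¬ p ∣ B → σ • y - y' ∈ 𝔓 → σ • y = y'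

lemma Stp.frob_apply (S : Stp l K Θ N ψ) {B : ℕ} (hB : S.Good B) (𝔓 : Ideal (𝓞 N)) [𝔓.IsPrime] {p : ℕ} (hp : p.Prime)
    (hp𝔓 : (p : 𝓞 N) ∈ 𝔓) (hpB : ¬ p ∣ B) {σ : N ≃ₐ[K] N} (hσ : ∀ u : 𝓞 N, σ • u - u ^ p ∈ 𝔓) {b₀ : ℤ}
    (hb₀ : algebraMap (𝓞 K) (𝓞 N) Θ - 5 * b₀ ∈ 𝔓) {a : ℕ} {b : ℤ} (hb : (p : ℤ) ∣ b - b₀) (hc : CM l (p * a) b)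
    {y y' : 𝓞 N} (hy : ψ y = f (tau l (p * a) b)) (hy' : ψ y' = f (tau l a b)) : σ • y = y' := by
  have h10 : ¬ p ∣ 10 * l := fun h => hpB (h.trans hB.2.1)
  have h1 : algebraMap (𝓞 K) (𝓞 N) Θ - 5 * b ∈ 𝔓 := by
    obtain ⟨k, hk⟩ := hb
    have hb' : b = b₀ + p * k := by linarith
    have : algebraMap (𝓞 K) (𝓞 N) Θ - 5 * (b : 𝓞 N) = (algebraMap (𝓞 K) (𝓞 N) Θ - 5 * (b₀ : 𝓞 N)) - (5 * k) * (p : 𝓞 N) := by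
      rw [hb']; push_cast; ring
    rw [this]
    exact 𝔓.sub_mem hb₀ (𝔓.mul_mem_left _ hp𝔓)
  have h2 := S.frob_mem 𝔓 hp hp𝔓 h10 h1 hc hy hy'
  refine hB.2.2 σ y y' (S.X_of hc (Or.inl hy)) (S.X_of (CM.of_mul hc).1 (Or.inl hy')) 𝔓 p hp hp𝔓 hpB ?_
  have := 𝔓.add_mem (hσ y) h2
  rwa [sub_add_sub_cancel] at this

lemma pm_smul (ψ : N →+* ℂ) (σ : N ≃ₐ[K] N) {y y' : 𝓞 N} (h : Pm (ψ y) (ψ y')) : Pm (ψ (σ • y : 𝓞 N)) (ψ (σ • y' : 𝓞 N)) := by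
  rcases h with h | h
  · left
    rw [RingOfIntegers.ext (ψ.injective h)]
  · right
    have h1 : (y : N) = -(y' : N)⁻¹ := ψ.injective (by rw [h, map_neg, map_inv₀])
    have h2 : ((σ • y : 𝓞 N) : N) = σ (y : N) := rfl
    have h3 : ((σ • y' : 𝓞 N) : N) = σ (y' : N) := rfl
    rw [h2, h3, h1, map_neg, map_inv₀, map_neg, map_inv₀]

lemma Dat.class_mul (_D : Dat l K Θ) {a n : ℕ} {b b₁ b₀ : ℤ} (ha : 0 < a) (hn : 0 < n) (hc : Nat.Coprime a n)
    (h1 : (a : ℤ) ∣ b - b₁) (h0 : (n : ℤ) ∣ b - b₀) :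
    cl (IA Θ (n * a) b) = cl (IA Θ n b₀) * cl (IA Θ a b₁) := by
  rw [← IA_mul hc, cl_mul (IA_ne hn b) (IA_ne ha b), IA_congr h1, IA_congr h0]

theorem Stp.stab [IsGalois K N] (S : Stp l K Θ N ψ) {B : ℕ} (hB : S.Good B) (σ : N ≃ₐ[K] N) {y : 𝓞 N} (hy : y ∈ S.X) : σ • y ∈ S.X := by
  have hfin := S.X_fin
  have key : MulAction.stabilizer (N ≃ₐ[K] N) S.X = ⊤ := by
    refine frob_generate S.D.hK _ hB.1 ?_
    intro 𝔓 _ p hp hP hpB σ hσ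
    have hp𝔓 : (p : 𝓞 N) ∈ 𝔓 := by
      have := absNorm_mem (𝔓.comap (algebraMap (𝓞 K) (𝓞 N)))
      rw [hP, mem_comap, map_natCast] at this
      exact this
    rw [MulAction.mem_stabilizer_set_iff_smul_set_subset hfin]
    rintro _ ⟨y, ⟨c, hy⟩, rfl⟩
    obtain ⟨b₀, hb₀, hΘ⟩ := S.D.prime_form (P := 𝔓.comap (algebraMap (𝓞 K) (𝓞 N))) (by rw [hP]; exact hp)
      (by rw [hP]; exact fun h => hpB (h.trans hB.2.1))
    rw [hP] at hb₀
    rw [mem_comap, map_sub, map_mul, map_ofNat, map_intCast] at hΘ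
    obtain ⟨a, b₁, h₁, hcop, hcl⟩ := S.D.exists_rep (c * (cl (IA Θ p b₀))⁻¹) (M := p) hp.ne_zero
    obtain ⟨b, hb1, hb0, hcm⟩ := CM.crt h₁ hb₀ hcop
    have hclass : cl (IA Θ (p * a) b) = c := by
      rw [S.D.class_mul h₁.1 hp.pos hcop hb1 hb0, hcl, mul_comm, inv_mul_cancel_right]
    have hpm := S.D.pm_xc hcm
    rw [hclass] at hpm
    obtain ⟨y1, hy1⟩ := S.hX _ _ hcm
    have hcm' := (CM.of_mul hcm).1
    obtain ⟨y', hy'⟩ := S.hX _ _ hcm'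
    have h1 := S.frob_apply hB 𝔓 hp hp𝔓 hpB hσ hΘ hb0 hcm hy1 hy'
    have h2 : Pm (ψ y) (ψ y1) := by rw [hy1]; exact hy.trans hpm.symm
    have h3 := pm_smul ψ σ h2
    rw [h1, hy'] at h3
    exact S.X_of hcm' h3
  have : σ ∈ MulAction.stabilizer (N ≃ₐ[K] N) S.X := by rw [key]; trivial
  rw [MulAction.mem_stabilizer_set_iff_smul_set_subset hfin] at this
  exact this ⟨y, hy, rfl⟩

lemma exists_frob [IsGalois K N] (𝔓 : Ideal (𝓞 N)) [𝔓.IsPrime] {p : ℕ} (hp : p.Prime)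
    (hP : absNorm (𝔓.comap (algebraMap (𝓞 K) (𝓞 N))) = p) : ∃ σ : N ≃ₐ[K] N, ∀ u : 𝓞 N, σ • u - u ^ p ∈ 𝔓 := by
  have hpP : (p : 𝓞 N) ∈ 𝔓 := by
    have := absNorm_mem (𝔓.comap (algebraMap (𝓞 K) (𝓞 N)))
    rw [hP, mem_comap, map_natCast] at this
    exact this
  have h0 : 𝔓 ≠ ⊥ := by
    rintro rfl
    rw [Ideal.mem_bot] at hpP
    exact hp.ne_zero (by exact_mod_cast hpP)
  have : Finite (𝓞 N ⧸ 𝔓) := Ideal.finiteQuotientOfFreeOfNeBot 𝔓 h0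
  obtain ⟨σ, hσ⟩ := IsArithFrobAt.exists_of_isInvariant (𝓞 K) (N ≃ₐ[K] N) 𝔓
  have hc : Nat.card (𝓞 K ⧸ 𝔓.under (𝓞 K)) = p := by
    rw [← hP, absNorm_apply, Submodule.cardQuot_apply]
  refine ⟨σ, fun u => ?_⟩
  have := hσ u
  rw [hc] at this
  exact this

lemma Dat.exists_prime (D : Dat l K Θ) {p : ℕ} (hp : p.Prime) {b₀ : ℤ} (h : CM l p b₀) :
    ∃ P : Ideal (𝓞 K), P.IsPrime ∧ absNorm P = p ∧ Θ - 5 * b₀ ∈ P := by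
  have hne : IA Θ p b₀ ≠ ⊤ := by
    intro htop
    have h1 : (1 : 𝓞 K) ∈ IA Θ p b₀ := by rw [htop]; trivial
    obtain ⟨u, v, huv⟩ := Ideal.mem_span_pair.mp h1
    obtain ⟨C, hC⟩ := h.2
    have hC' : (5 * (b₀ : 𝓞 K) ^ 2 + l) = p * C := by exact_mod_cast congrArg (Int.cast : ℤ → 𝓞 K) hC
    have h2 : Θ + 5 * b₀ = p * (u * (Θ + 5 * b₀) - 5 * C * v) := by
      have := D.hΘ
      linear_combination (-(Θ + 5 * b₀)) * huv + v * this - 5 * v * hC'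
    obtain ⟨s, t, hst⟩ := D.reprZ (u * (Θ + 5 * b₀) - 5 * C * v)
    rw [hst] at h2
    have := (D.indepZ (s := 5 * b₀) (t := 1) (s' := p * s) (t' := p * t) (by push_cast; linear_combination h2)).2
    exact hp.one_lt.ne' (by
      have h3 : (p : ℤ) ∣ 1 := Dvd.intro _ this.symm
      have h4 : p ∣ 1 := by exact_mod_cast h3
      exact Nat.dvd_one.mp h4)
  obtain ⟨P, hPm, hle⟩ := Ideal.exists_le_maximal _ hne
  have hpP : (p : 𝓞 K) ∈ P := hle (subset_span (by simp))
  have hΘP : Θ - 5 * b₀ ∈ P := hle (subset_span (by simp))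
  have hPp := hPm.isPrime
  refine ⟨P, hPp, (absNorm_eq_of_pow hp P hpP ?_).1, hΘP⟩
  intro u
  obtain ⟨s, t, rfl⟩ := D.reprZ u
  have h1 : ((s : 𝓞 K) + t * Θ) - ((s + 5 * t * b₀ : ℤ) : 𝓞 K) ∈ P := by
    have : ((s : 𝓞 K) + t * Θ) - ((s + 5 * t * b₀ : ℤ) : 𝓞 K) = t * (Θ - 5 * b₀) := by push_cast; ring
    rw [this]; exact P.mul_mem_left _ hΘP
  set m : ℤ := s + 5 * t * b₀
  have h2 : ((s : 𝓞 K) + t * Θ) ^ p - (m : 𝓞 K) ^ p ∈ P := Ideal.mem_of_dvd _ (sub_dvd_pow_sub_pow _ _ _) h1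
  have h3 : (m : 𝓞 K) - (m : 𝓞 K) ^ p ∈ P := by
    have hf := Fact.mk hp
    have : (p : ℤ) ∣ m - m ^ p := by
      rw [← ZMod.intCast_zmod_eq_zero_iff_dvd] 
      push_cast
      rw [ZMod.pow_card, sub_self]
    obtain ⟨k, hk⟩ := this
    have hk' : (m : 𝓞 K) - (m : 𝓞 K) ^ p = p * k := by exact_mod_cast congrArg (Int.cast : ℤ → 𝓞 K) hk
    rw [hk']; exact P.mul_mem_right _ hpP
  have := P.sub_mem (P.add_mem h1 h3) h2
  convert this using 1
  ring

theorem Stp.path [IsGalois K N] (S : Stp l K Θ N ψ) {B : ℕ} (hB : S.Good B) (n : ℕ) : Nat.Coprime n B → ∀ b₀ : ℤ, CM l n b₀ →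
    ∃ σ : N ≃ₐ[K] N, ∀ (a : ℕ) (b : ℤ), (n : ℤ) ∣ b - b₀ → CM l (n * a) b → ∀ y y' : 𝓞 N,
      ψ y = f (tau l (n * a) b) → ψ y' = f (tau l a b) → σ • y = y' := by
  induction n using induction_on_primes with
  | zero => intro _ b₀ h; exact absurd h.1 (lt_irrefl _)
  | one =>
    intro _ b₀ _
    refine ⟨1, fun a b _ _ y y' hy hy' => ?_⟩
    rw [one_mul, ← hy'] at hy
    rw [one_smul]
    exact S.inj hy
  | prime_mul p m hp ih =>
    intro hcop b₀ hb₀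
    obtain ⟨σ, hσ⟩ := ih hcop.coprime_mul_left b₀ (CM.of_mul hb₀).1
    have hcp := (CM.of_mul hb₀).2
    have hpB : ¬ p ∣ B := (Nat.Prime.coprime_iff_not_dvd hp).mp hcop.coprime_mul_right
    obtain ⟨P, hP, hPn, hΘP⟩ := S.D.exists_prime hp hcp
    obtain ⟨𝔓, -, h𝔓, hcom⟩ := Ideal.exists_ideal_over_prime_of_isIntegral P (⊥ : Ideal (𝓞 N)) (by
      rw [Ideal.comap_bot_of_injective _ (FaithfulSMul.algebraMap_injective (𝓞 K) (𝓞 N))]; exact bot_le)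
    obtain ⟨σp, hσp⟩ := exists_frob (K := K) 𝔓 hp (by rw [hcom, hPn])
    have hΘ𝔓 : algebraMap (𝓞 K) (𝓞 N) Θ - 5 * b₀ ∈ 𝔓 := by
      rw [← hcom, mem_comap, map_sub, map_mul, map_ofNat, map_intCast] at hΘP
      exact hΘP
    have hp𝔓 : (p : 𝓞 N) ∈ 𝔓 := by
      have := absNorm_mem P
      rw [hPn, ← hcom, mem_comap, map_natCast] at this
      exact this
    refine ⟨σ * σp, fun a b hb hc y y' hy hy' => ?_⟩
    have hb1 : (p : ℤ) ∣ b - b₀ := (Dvd.intro _ (by push_cast; rfl)).trans hb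
    have hb2 : (m : ℤ) ∣ b - b₀ := (Dvd.intro_left _ (by push_cast; rfl)).trans hb
    rw [mul_assoc] at hc hy
    have hc' := (CM.of_mul hc).1
    obtain ⟨y1, hy1⟩ := S.hX _ _ hc'
    rw [mul_smul, S.frob_apply hB 𝔓 hp hp𝔓 hpB hσp hΘ𝔓 hb1 hc hy hy1]
    exact hσ a b hb2 hc' y1 y' hy1 hy'

end Path

end RR

namespace RR
open NumberField Ideal
open UpperHalfPlane hiding I

section Orbit

variable {l : ℕ} {K : Type} [Field K] [NumberField K] {Θ : 𝓞 K} {N : Type} [Field N] [NumberField N] [Algebra K N]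
  {ψ : N →+* ℂ}

lemma CM.one (l : ℕ) (b : ℤ) : CM l 1 b := ⟨one_pos, by simp⟩

lemma Dat.le13 (D : Dat l K Θ) : 13 ≤ l := by
  have h5 := D.h5
  have h4 := D.h4
  by_contra h
  have : l = 9 := by omega
  have hl := D.hl
  rw [this] at hl
  revert hl
  norm_num

lemma Dat.norm_rho (D : Dat l K Θ) : ‖f (tau l 1 0)‖ < 1 :=
  (f_tau0 D.le13).trans (by norm_num)

lemma Dat.flip (D : Dat l K Θ) {B : ℕ} (hB : B ≠ 0) : ∃ (n : ℕ) (b : ℤ), CM l n b ∧ Nat.Coprime n B ∧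
    f (tau l n b) = -(f (tau l 1 0))⁻¹ := by
  obtain ⟨x, hxgt, hx, hx5⟩ := Nat.forall_exists_prime_gt_and_zmodEq (q := 5) (a := 2) (5 + B)
    (by norm_num) (by rw [Int.isCoprime_iff_gcd_eq_one]; rfl)
  have hxm : (x : ℤ) % 5 = 2 := hx5
  have hcop : IsCoprime (x : ℤ) ((5 * B : ℕ) : ℤ) := by
    rw [Nat.isCoprime_iff_coprime]
    refine Nat.Coprime.mul_right ?_ ?_
    · rw [Nat.Prime.coprime_iff_not_dvd hx]
      intro h
      have := Nat.le_of_dvd (by norm_num) h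
      omega
    · rw [Nat.Prime.coprime_iff_not_dvd hx]
      intro h
      have := Nat.le_of_dvd (Nat.pos_of_ne_zero hB) h
      omega
  obtain ⟨α, β', hab⟩ := hcop
  obtain ⟨β, rfl⟩ : ∃ β, β' = -β := ⟨-β', by ring⟩
  push_cast at hab
  have hdet : α * (x : ℤ) - β * (5 * B) = 1 := by linarith
  have hα : α % 5 = 3 := by
    have h1 : α * x % 5 = 1 := by
      have : α * x = 1 + 5 * (β * B) := by linarith
      omega
    rw [Int.mul_emod, hxm] at h1
    omega
  have hn0 : 0 < x ^ 2 + 5 * l * B ^ 2 := by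
    have := hx.pos; positivity
  refine ⟨x ^ 2 + 5 * l * B ^ 2, -(β * x + α * l * B), ⟨hn0, 5 * β ^ 2 + l * α ^ 2, ?_⟩, ?_, ?_⟩
  · push_cast
    have h2 : (α * (x : ℤ) - β * (5 * B)) ^ 2 = 1 := by rw [hdet]; norm_num
    linear_combination (-(l : ℤ)) * h2
  · have h1 : x ^ 2 + 5 * l * B ^ 2 = x ^ 2 + (5 * l * B) * B := by ring
    rw [h1, Nat.coprime_add_mul_right_left]
    apply Nat.Coprime.pow_left
    rw [Nat.Prime.coprime_iff_not_dvd hx]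
    intro h
    have := Nat.le_of_dvd (Nat.pos_of_ne_zero hB) h
    omega
  · have hs := f_smul (mkSL α β (5 * B) x hdet) (by simp) (tau l 1 0)
    have he : mkSL α β (5 * B) x hdet • tau l 1 0 = tau l (x ^ 2 + 5 * l * B ^ 2) (-(β * x + α * l * B)) := by
      apply UpperHalfPlane.ext
      have hden := den_ne_zero (mkSL α β (5 * B) x hdet) (tau l 1 0)
      rw [coe_smul]
      rw [div_eq_iff hden, coe_tau D.hl.pos one_pos, coe_tau D.hl.pos hn0]
      have hn0' : ((x : ℂ) ^ 2 + 5 * l * B ^ 2) ≠ 0 := by exact_mod_cast hn0.ne'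
      have hdetC : (α : ℂ) * x - β * (5 * B) = 1 := by exact_mod_cast congrArg (Int.cast : ℤ → ℂ) hdet
      have hom := om_sq l
      simp only [mkSL_00, mkSL_01, mkSL_10, mkSL_11]
      push_cast
      field_simp
      linear_combination (om l * x - 5 * l * B) * hdetC - B * hom
    rw [he] at hs
    rw [hs, mkSL_00, dia, if_neg (by omega)]

variable [IsGalois K N]

lemma Stp.to_rho (S : Stp l K Θ N ψ) {B : ℕ} (hB : S.Good B) {n : ℕ} {b : ℤ} (h : CM l n b) (hc : Nat.Coprime n B) :
    ∃ σ : N ≃ₐ[K] N, ∀ y : 𝓞 N, ψ y = f (tau l n b) → ψ (σ • y : 𝓞 N) = f (tau l 1 0) := by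
  obtain ⟨σ, hσ⟩ := S.path hB n hc b h
  refine ⟨σ, fun y hy => ?_⟩
  obtain ⟨r, hr⟩ := S.hX 1 b (CM.one l b)
  rw [hσ 1 b (by simp) (by rwa [mul_one]) y r (by rwa [mul_one]) hr, hr]
  exact f_tau_congr S.D.hl.pos one_pos (by simp)

/-- every element of X is conjugate to rho up to sign inverse -/
lemma Stp.to_rho_pm (S : Stp l K Θ N ψ) {B : ℕ} (hB : S.Good B) (c : ClassGroup (𝓞 K)) :
    ∃ σ : N ≃ₐ[K] N, ∀ y : 𝓞 N, Pm (ψ y) (S.D.xc c) → Pm (ψ (σ • y : 𝓞 N)) (f (tau l 1 0)) := by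
  obtain ⟨n, b, hcm, hcop, hcl⟩ := S.D.exists_rep c hB.1
  obtain ⟨σ, hσ⟩ := S.to_rho hB hcm hcop
  refine ⟨σ, fun y hy => ?_⟩
  obtain ⟨z, hz⟩ := S.hX _ _ hcm
  have h1 := S.D.pm_xc hcm
  rw [hcl] at h1
  have h2 : Pm (ψ y) (ψ z) := by rw [hz]; exact hy.trans h1.symm
  have h3 := pm_smul ψ σ h2
  rwa [hσ z hz] at h3

theorem Stp.transitive (S : Stp l K Θ N ψ) {B : ℕ} (hB : S.Good B) {r y : 𝓞 N} (hr : ψ r = f (tau l 1 0)) (hy : y ∈ S.X) :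
    ∃ σ : N ≃ₐ[K] N, σ • y = r := by
  obtain ⟨c, hc⟩ := hy
  obtain ⟨σ, hσ⟩ := S.to_rho_pm hB c
  rcases hσ y hc with h | h
  · exact ⟨σ, S.inj (by rw [h, hr])⟩
  · obtain ⟨n, b, hcm, hcop, hf⟩ := S.D.flip hB.1
    obtain ⟨σ', hσ'⟩ := S.to_rho hB hcm hcop
    refine ⟨σ' * σ, S.inj ?_⟩
    rw [mul_smul, hr]
    exact hσ' _ (by rw [h, hf])

lemma Stp.sq_ne (S : Stp l K Θ N ψ) {B : ℕ} (hB : S.Good B) (c : ClassGroup (𝓞 K)) : S.D.xc c ≠ -(S.D.xc c)⁻¹ := by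
  intro h
  obtain ⟨y, hy⟩ := S.hX _ _ (S.D.rep_spec c).1
  have hy' : ψ y = S.D.xc c := hy
  obtain ⟨r, hr⟩ := S.hX 1 0 (CM.one l 0)
  obtain ⟨σ, hσ⟩ := S.transitive hB hr (y := y) ⟨c, Or.inl hy'⟩
  have hx0 : S.D.xc c ≠ 0 := f_ne_zero _
  have h2 : (S.D.xc c) ^ 2 = -1 := by
    field_simp at h
    exact h
  have h3 : y ^ 2 = -1 := S.inj (by rw [← hy'] at h2; simpa using h2)
  have h4 : r ^ 2 = -1 := by rw [← hσ, ← smul_pow', h3]; simp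
  have h5 : (f (tau l 1 0)) ^ 2 = -1 := by
    rw [← hr]
    have := congrArg (fun u : 𝓞 N => ψ u) h4
    simpa using this
  have h6 := congrArg norm h5
  rw [norm_pow, norm_neg, norm_one] at h6
  have := S.D.norm_rho
  nlinarith [norm_nonneg (f (tau l 1 0))]

lemma Stp.class_inj (S : Stp l K Θ N ψ) {B : ℕ} (hB : S.Good B) {c c' : ClassGroup (𝓞 K)} (h : Pm (S.D.xc c) (S.D.xc c')) :
    c = c' := by
  obtain ⟨n, b₀, h₀, hcop, hcl⟩ := S.D.exists_rep c hB.1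
  obtain ⟨a, b₁, h₁, hcopa, hcla⟩ := S.D.exists_rep (c' * c⁻¹) h₀.1.ne'
  obtain ⟨b, hb1, hb0, hcm⟩ := CM.crt h₁ h₀ hcopa
  have hclass : cl (IA Θ (n * a) b) = c' := by
    rw [S.D.class_mul h₁.1 h₀.1 hcopa hb1 hb0, hcla, hcl, mul_comm, inv_mul_cancel_right]
  obtain ⟨σ, hσ⟩ := S.path hB n hcop b₀ h₀
  have hcm' := (CM.of_mul hcm).1
  obtain ⟨y, hy⟩ := S.hX _ _ hcm
  obtain ⟨y', hy'⟩ := S.hX _ _ hcm'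
  obtain ⟨z, hz⟩ := S.hX _ _ h₀
  obtain ⟨r, hr⟩ := S.hX 1 b₀ (CM.one l b₀)
  have h1 := hσ a b hb0 hcm y y' hy hy'
  have h2 := hσ 1 b₀ (by simp) (by rwa [mul_one]) z r (by rwa [mul_one]) hr
  have h3 : Pm (ψ y) (ψ z) := by
    rw [hy, hz]
    have e1 := S.D.pm_xc hcm
    have e2 := S.D.pm_xc h₀
    rw [hclass] at e1
    rw [hcl] at e2
    exact (e1.trans h.symm).trans e2.symm
  have h4 := pm_smul ψ σ h3
  rw [h1, h2, hy', hr, f_tau_congr S.D.hl.pos one_pos (b' := 0) (by simp)] at h4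
  have h5 := S.D.class_one hcm' h4
  rw [IA_congr hb1, hcla] at h5
  exact (mul_inv_eq_one.mp h5).symm

theorem Stp.card_X (S : Stp l K Θ N ψ) {B : ℕ} (hB : S.Good B) : S.X.ncard = 2 * classNumber K := by
  let g : ClassGroup (𝓞 K) × Bool → ℂ := fun q => if q.2 then S.D.xc q.1 else -(S.D.xc q.1)⁻¹
  have hg : ∀ q, Pm (g q) (S.D.xc q.1) := by
    rintro ⟨c, b⟩
    cases b
    · right; simp [g]
    · left; simp [g]
  have hinj : Function.Injective g := by
    rintro ⟨c, b⟩ ⟨c', b'⟩ h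
    have h1 := (hg (c, b)).symm
    rw [h] at h1
    have h2 := S.class_inj hB (h1.trans (hg (c', b')))
    subst h2
    have h3 := S.sq_ne hB c
    cases b <;> cases b' <;> simp [g] at h ⊢
    · exact h3 h.symm
    · exact h3 h
  have himg : (fun y : 𝓞 N => ψ y) '' S.X = Set.range g := by
    ext x
    constructor
    · rintro ⟨y, ⟨c, hc⟩, rfl⟩
      rcases hc with h | h
      · exact ⟨(c, true), by simp [g, h]⟩
      · exact ⟨(c, false), by simp [g, h]⟩
    · rintro ⟨⟨c, b⟩, rfl⟩
      cases b
      · obtain ⟨y, hy⟩ := S.hX' _ _ (S.D.rep_spec c).1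
        refine ⟨y, ⟨c, Or.inr hy⟩, ?_⟩
        simp only [g]
        exact hy
      · obtain ⟨y, hy⟩ := S.hX _ _ (S.D.rep_spec c).1
        refine ⟨y, ⟨c, Or.inl hy⟩, ?_⟩
        simp only [g]
        exact hy
  have h1 := Set.ncard_image_of_injective S.X (f := fun y : 𝓞 N => ψ y) (fun y y' h => S.inj h)
  rw [← h1, himg, ← Set.image_univ, Set.ncard_image_of_injective _ hinj, Set.ncard_univ, Nat.card_prod,
    Nat.card_eq_fintype_card, Nat.card_eq_fintype_card, Fintype.card_bool, mul_comm]
  rfl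

theorem Stp.degree (S : Stp l K Θ N ψ) {r : 𝓞 N} (hr : ψ r = f (tau l 1 0)) :
    (minpoly K (r : N)).natDegree = 2 * classNumber K := by
  obtain ⟨B, hB⟩ : ∃ B, S.Good B := S.exists_B
  rw [← S.card_X hB]
  have hfd : Module.Finite K N := Module.Finite.of_restrictScalars_finite ℚ K N
  have hInt : IsIntegral K (r : N) := IsIntegral.of_finite K _
  rw [← Polynomial.card_rootSet_eq_natDegree (K := N) (p := minpoly K (r : N)) (IsGalois.separable K _) (IsGalois.splits K _),
    ← Set.ncard_image_of_injective S.X (f := fun y : 𝓞 N => (y : N)) RingOfIntegers.coe_injective,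
    ← Nat.card_eq_fintype_card, Nat.card_coe_set_eq]
  congr 1
  ext x
  constructor
  · intro hx
    rw [Polynomial.mem_rootSet] at hx
    have h1 : minpoly K x = minpoly K (r : N) :=
      (minpoly.eq_of_irreducible_of_monic (minpoly.irreducible hInt) hx.2 (minpoly.monic hInt)).symm
    rw [Normal.minpoly_eq_iff_mem_orbit] at h1
    obtain ⟨σ, hσ⟩ := h1
    have hσ' : ((σ • r : 𝓞 N) : N) = x := hσ
    exact ⟨σ • r, S.stab hB σ (S.X_of (CM.one l 0) (Or.inl hr)), hσ'⟩
  · rintro ⟨y, hy, rfl⟩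
    obtain ⟨σ, hσ⟩ := S.transitive hB hr hy
    have h1 : minpoly K (r : N) = minpoly K (y : N) := by
      rw [Normal.minpoly_eq_iff_mem_orbit]
      refine ⟨σ, ?_⟩
      rw [← hσ]
      rfl
    simp only
    rw [Polynomial.mem_rootSet, h1]
    exact ⟨minpoly.ne_zero (IsIntegral.of_finite K _), minpoly.aeval _ _⟩

end Orbit

end RR

namespace RR
open NumberField Ideal

section Final

variable {l : ℕ} {K : Type} [Field K] [NumberField K] {Θ : 𝓞 K}

lemma CM.unit (hl : 0 < l) {a : ℕ} {b : ℤ} (h : CM l a b) : f (tau l a b) ∈ AA ∧ (f (tau l a b))⁻¹ ∈ AA := by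
  obtain ⟨C, hC⟩ := h.2
  exact unit_tau hl h.1 hC.symm

lemma Dat.exists_stp (D : Dat l K Θ) : ∃ (N : Type) (_ : Field N) (_ : NumberField N) (_ : Algebra K N) (_ : IsGalois K N)
    (ψ : N →+* ℂ), Stp l K Θ N ψ := by
  obtain ⟨φ, hφ⟩ := D.emb
  letI : Algebra K ℂ := φ.toAlgebra
  have hInt : ∀ c, IsIntegral K (D.xc c) := by
    intro c
    have h : IsIntegral ℤ (D.xc c) := (CM.unit D.hl.pos (D.rep_spec c).1).1
    exact h.tower_top
  let P : Polynomial K := ∏ c : ClassGroup (𝓞 K), minpoly K (D.xc c)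
  have hP : P ≠ 0 := Finset.prod_ne_zero_iff.mpr fun c _ => minpoly.ne_zero (hInt c)
  have hroot : ∀ c, D.xc c ∈ P.rootSet ℂ := by
    intro c
    rw [Polynomial.mem_rootSet]
    refine ⟨hP, ?_⟩
    rw [map_prod]
    exact Finset.prod_eq_zero (Finset.mem_univ c) (minpoly.aeval _ _)
  let N := IntermediateField.adjoin K (P.rootSet ℂ)
  have hs : P.IsSplittingField K N := IntermediateField.adjoin_rootSet_isSplittingField (IsAlgClosed.splits _)
  have hfd : FiniteDimensional K N := Polynomial.IsSplittingField.finiteDimensional N P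
  have hnf : NumberField N := NumberField.of_module_finite K N
  have hnorm : Normal K N := Normal.of_isSplittingField P
  have hgal : IsGalois K N := ⟨⟩
  have hxN : ∀ c, D.xc c ∈ N := fun c => IntermediateField.subset_adjoin K _ (hroot c)
  have hmem : ∀ a b, CM l a b → f (tau l a b) ∈ N := by
    intro a b h
    rcases D.pm_xc h with h1 | h1 <;> rw [h1]
    · exact hxN _
    · exact N.neg_mem (N.inv_mem (hxN _))
  refine ⟨N, inferInstance, hnf, inferInstance, hgal, algebraMap N ℂ, D, hφ, ?_, ?_⟩
  · intro a b h
    obtain ⟨z, hz⟩ := exists_of_mem_AA (N := N) (algebraMap N ℂ) (y := ⟨_, hmem a b h⟩) (CM.unit D.hl.pos h).1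
    exact ⟨z, by rw [hz]; rfl⟩
  · intro a b h
    obtain ⟨z, hz⟩ := exists_of_mem_AA (N := N) (algebraMap N ℂ) (y := ⟨_, N.neg_mem (N.inv_mem (hmem a b h))⟩)
      (AA.neg_mem (CM.unit D.hl.pos h).2)
    exact ⟨z, by rw [hz]; rfl⟩

lemma real_poly {x : ℂ} (hx : x.im = 0) (A : Polynomial ℚ) : (Polynomial.aeval x A).im = 0 := by
  obtain ⟨r, rfl⟩ : ∃ r : ℝ, x = r := ⟨x.re, Complex.ext rfl (by simpa using hx)⟩
  have : (Polynomial.aeval (r : ℂ) A) = ((Polynomial.aeval r A : ℝ) : ℂ) := by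
    have := Polynomial.aeval_algebraMap_apply ℂ r A
    exact this
  rw [this]
  exact Complex.ofReal_im _

theorem Dat.degreeQ (D : Dat l K Θ) (hre : (f (tau l 1 0)).im = 0) :
    (minpoly ℚ (f (tau l 1 0))).natDegree = 2 * classNumber K := by
  obtain ⟨N, _, _, _, _, ψ, S⟩ := D.exists_stp
  obtain ⟨r, hr⟩ := S.hX 1 0 (CM.one l 0)
  have hdeg := S.degree hr
  have hfd : Module.Finite K N := Module.Finite.of_restrictScalars_finite ℚ K N
  have hInt : IsIntegral K (r : N) := IsIntegral.of_finite K _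
  have hintQ : IsIntegral ℚ (r : N) := IsIntegral.of_finite ℚ _
  have hmp : minpoly ℚ (f (tau l 1 0)) = minpoly ℚ (r : N) := by
    rw [← hr]
    exact minpoly.algHom_eq (ψ.toRatAlgHom) ψ.injective (r : N)
  apply le_antisymm
  · rw [← hdeg]
    set g := minpoly K (r : N) with hg
    choose s t hst using D.reprQ
    set d := g.natDegree with hd
    let A : Polynomial ℚ := ∑ i ∈ Finset.range (d + 1), Polynomial.monomial i (s (g.coeff i))
    let C : Polynomial ℚ := ∑ i ∈ Finset.range (d + 1), Polynomial.monomial i (t (g.coeff i))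
    have hsum : Polynomial.aeval (f (tau l 1 0)) A + om l * Polynomial.aeval (f (tau l 1 0)) C = 0 := by
      have h1 : Polynomial.aeval (r : N) g = 0 := minpoly.aeval _ _
      rw [Polynomial.aeval_eq_sum_range] at h1
      have h2 := congrArg ψ h1
      rw [map_zero, map_sum] at h2
      rw [← h2, map_sum, map_sum, Finset.mul_sum, ← Finset.sum_add_distrib]
      refine Finset.sum_congr rfl fun i _ => ?_
      rw [Polynomial.aeval_monomial, Polynomial.aeval_monomial, Algebra.smul_def, map_mul, map_pow, hr]
      conv_rhs => rw [hst (g.coeff i)]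
      rw [map_add, map_mul, map_add, map_mul, S.hψ, map_ratCast, map_ratCast, map_ratCast, map_ratCast]
      rw [eq_ratCast, eq_ratCast]
      ring
    have hA0 : Polynomial.aeval (f (tau l 1 0)) A = 0 := by
      have h1 := real_poly hre A
      have h2 := real_poly hre C
      refine Complex.ext ?_ h1
      have := congrArg Complex.re hsum
      rw [Complex.add_re, Complex.mul_re, om_re, h2, zero_mul, mul_zero, sub_zero, add_zero] at this
      exact this
    have hcoeff : A.coeff d = 1 := by
      have h1 : A.coeff d = s (g.coeff d) := by
        simp only [A, Polynomial.finsetSum_coeff, Polynomial.coeff_monomial]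
        rw [Finset.sum_eq_single d]
        · simp
        · intro i _ hi; simp [hi]
        · intro h; simp at h
      rw [h1]
      have h2 : g.coeff d = 1 := minpoly.monic hInt
      have h3 := hst (g.coeff d)
      exact (D.indep (s' := 1) (t' := 0) (by rw [← h3, h2]; simp)).1
    have hAne : A ≠ 0 := by
      intro h
      rw [h] at hcoeff
      simp at hcoeff
    have hAdeg : A.natDegree ≤ d := by
      refine Polynomial.natDegree_sum_le_of_forall_le _ _ fun i hi => ?_
      refine (Polynomial.natDegree_monomial_le _).trans ?_
      rw [Finset.mem_range] at hi
      omega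
    exact (Polynomial.natDegree_le_of_dvd (minpoly.dvd ℚ _ hA0) hAne).trans hAdeg
  · rw [← hdeg, hmp]
    have h1 := minpoly.dvd_map_of_isScalarTower ℚ K (r : N)
    have h2 := Polynomial.natDegree_le_of_dvd h1 (by
      rw [Polynomial.map_ne_zero_iff (algebraMap ℚ K).injective]
      exact minpoly.ne_zero hintQ)
    rwa [Polynomial.natDegree_map] at h2

end Final

end RR

theorem rogers_ramanujan_value_degree_one_mod_four
    (l : ℕ) (hl : Nat.Prime l) (hl5 : 5 < l) (hmod4 : l % 4 = 1)
    (K : Type) [Field K] [NumberField K] (θ : K)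
    (hθ : θ ^ 2 = -((5 * l : ℕ) : K))
    (hK : Module.finrank ℚ K = 2)
    (τ : ℂ) (hτ : τ = Complex.I * (Real.sqrt (5 * l) : ℂ) / 5)
    (q : ℂ) (hq : q = Complex.exp (2 * (Real.pi : ℂ) * Complex.I * τ))
    (ρ : ℂ)
    (hρ : ρ = q * ∏' n : ℕ, (1 - q ^ (n + 1)) ^ (5 * jacobiSym (n + 1) 5)) :
    Multipliable (fun n : ℕ => (1 - q ^ (n + 1)) ^ (5 * jacobiSym (n + 1) 5)) ∧
    ρ.im = 0 ∧
    IsAlgebraic ℚ ρ ∧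
    (minpoly ℚ ρ).natDegree = 2 * NumberField.classNumber K := by
  have hInt : IsIntegral ℤ θ := by
    refine ⟨Polynomial.X ^ 2 + Polynomial.C ((5 * l : ℕ) : ℤ), Polynomial.monic_X_pow_add_C _ (by norm_num), ?_⟩
    simp only [Polynomial.eval₂_add, Polynomial.eval₂_pow, Polynomial.eval₂_X, Polynomial.eval₂_C, hθ]
    simp
  have D : RR.Dat l K ⟨θ, hInt⟩ := by
    refine ⟨hl, hl5, hmod4, ?_, hK⟩
    apply NumberField.RingOfIntegers.ext
    have h1 : algebraMap (NumberField.RingOfIntegers K) K (-(5 * (l : NumberField.RingOfIntegers K))) = -((5 * l : ℕ) : K) := by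
      rw [map_neg, map_mul, map_ofNat, map_natCast]; push_cast; rfl
    exact hθ.trans h1.symm
  have hτ' : (RR.tau l 1 0 : ℂ) = τ := by
    rw [RR.coe_tau hl.pos one_pos, hτ, RR.om]
    push_cast
    ring
  have hqq : RR.qq (RR.tau l 1 0) = q := by
    rw [RR.qq, hτ', hq]
  have hf : ρ = RR.f (RR.tau l 1 0) := by
    rw [RR.f, hqq, hρ, RR.U]
  have hq1 : ‖q‖ < 1 := by rw [← hqq]; exact RR.norm_qq_lt _
  have hqreal : ∃ x : ℝ, q = x := by
    refine ⟨Real.exp (-(2 * Real.pi * (Real.sqrt (5 * l) / 5))), ?_⟩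
    rw [hq, hτ, Complex.ofReal_exp]
    congr 1
    push_cast
    linear_combination (2 * (Real.pi : ℂ) * (Real.sqrt (5 * l) : ℂ) / 5) * Complex.I_sq
  have hre : ρ.im = 0 := by
    obtain ⟨x, hx⟩ := hqreal
    have hm := RR.U_multipliable hq1
    have h1 := hm.map_tprod (starRingEnd ℂ) Complex.continuous_conj
    apply Complex.conj_eq_iff_im.mp
    rw [hρ, map_mul, h1]
    have hc : (starRingEnd ℂ) q = q := by rw [hx, Complex.conj_ofReal]
    rw [hc]
    congr 1
    refine tprod_congr fun n => ?_
    rw [map_zpow₀, map_sub, map_one, map_pow, hc]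
  refine ⟨RR.U_multipliable hq1, hre, ?_, ?_⟩
  · have h : IsIntegral ℤ ρ := by
      rw [hf]
      exact (RR.CM.unit hl.pos (RR.CM.one l 0)).1
    exact (h.tower_top (A := ℚ)).isAlgebraic
  · rw [hf]
    exact D.degreeQ (by rw [← hf]; exact hre)
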